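/- Fix one of the two signs ± and let γ ∈ ℕ² be a multi-index. For all q, r ≥ 2 with 1/q + 1/r = 1/2 and r < ∞ there exists a constant C > 0 such that for every T > 0, every μ ∈ (0,1], every ε ∈ (0,1] and every Schwartz function f on ℝ², one has ‖ t ↦ e^{± i (t/ε) |D|/√(1+μ|D|²/3)} (∇^γ/|D|^{|γ|}) f ‖_{L^{q}(0,T; L^{r}(ℝ²))} ≤ C (ε/√μ)^{1/2 − 1/r} ‖(1 + μ|D|²)^{2(1/2 − 1/r)} f‖_{L²(ℝ²)}. -/

import Mathlib

open MeasureTheory Real Complex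
open scoped ENNReal InnerProductSpace

/-- Fourier transform with the convention `f̂(ξ) = (2π)^{-n/2} ∫ e^{-i x·ξ} f(x) dx`. -/
noncomputable def ft {n : ℕ} (f : EuclideanSpace ℝ (Fin n) → ℂ) (ξ : EuclideanSpace ℝ (Fin n)) : ℂ :=
  (((2 * π) ^ (-(n : ℝ) / 2) : ℝ) : ℂ) *
    ∫ x : EuclideanSpace ℝ (Fin n), Complex.exp (-Complex.I * (⟪x, ξ⟫_ℝ : ℂ)) * f x

/-- Fourier multiplier `m(D) f (x) = (2π)^{-n/2} ∫ e^{i x·ξ} m(ξ) f̂(ξ) dξ`. -/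
noncomputable def fmult {n : ℕ} (m : EuclideanSpace ℝ (Fin n) → ℂ)
    (f : EuclideanSpace ℝ (Fin n) → ℂ) (x : EuclideanSpace ℝ (Fin n)) : ℂ :=
  (((2 * π) ^ (-(n : ℝ) / 2) : ℝ) : ℂ) *
    ∫ ξ : EuclideanSpace ℝ (Fin n), Complex.exp (Complex.I * (⟪x, ξ⟫_ℝ : ℂ)) * m ξ * ft f ξ

/-- Symbol `e^{σ i τ |ξ| (1 + μ|ξ|²/3)^{-1/2}}` of the free propagator of the linearized
2D classical Boussinesq system (`σ = ±1`). -/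
noncomputable def prop2 (σ τ μ : ℝ) (ξ : EuclideanSpace ℝ (Fin 2)) : ℂ :=
  Complex.exp (Complex.I * ((σ * τ * ‖ξ‖ / Real.sqrt (1 + μ * ‖ξ‖ ^ 2 / 3) : ℝ) : ℂ))

/-- Symbol `(iξ)^γ / |ξ|^{|γ|}` of the Riesz-type multiplier `∇^γ/|D|^{|γ|}`
(extended by `0` at `ξ = 0`). -/
noncomputable def rieszSym (γ : Fin 2 → ℕ) (ξ : EuclideanSpace ℝ (Fin 2)) : ℂ :=
  (∏ i, (Complex.I * (ξ i : ℂ)) ^ γ i) / ((‖ξ‖ ^ (∑ i, γ i) : ℝ) : ℂ)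

/-- `L^q` norm in time on `(0,T)` of an `ℝ≥0∞`-valued function (used for mixed
space-time norms `L^q(0,T;L^r)`), with the usual `essSup` convention for `q = ∞`. -/
noncomputable def timeLp (q : ℝ≥0∞) (T : ℝ) (g : ℝ → ℝ≥0∞) : ℝ≥0∞ :=
  if q = ⊤ then essSup g (MeasureTheory.volume.restrict (Set.Ioo 0 T))
  else (∫⁻ t in Set.Ioo 0 T, g t ^ q.toReal) ^ (1 / q.toReal)


open MeasureTheory Real Complex
open scoped ENNReal InnerProductSpace

/-! ### Bessel-type function -/

/-- `2π J₀`. -/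
noncomputable def bA (s : ℝ) : ℝ := ∫ θ in (-π)..π, Real.cos (s * Real.cos θ)
/-- its derivative -/
noncomputable def bA1 (s : ℝ) : ℝ := ∫ θ in (-π)..π, -(Real.cos θ * Real.sin (s * Real.cos θ))
/-- its second derivative -/
noncomputable def bA2 (s : ℝ) : ℝ := ∫ θ in (-π)..π, -(Real.cos θ ^ 2 * Real.cos (s * Real.cos θ))

lemma bA_hasDeriv (s : ℝ) : HasDerivAt bA (bA1 s) s := by
  have := intervalIntegral.hasDerivAt_integral_of_dominated_loc_of_deriv_le (𝕜 := ℝ) (μ := volume)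
    (F := fun s θ => Real.cos (s * Real.cos θ))
    (F' := fun s θ => -(Real.cos θ * Real.sin (s * Real.cos θ))) (x₀ := s) (s := Set.univ)
    (a := -π) (b := π) (bound := fun _ => 1) Filter.univ_mem ?_ ?_ ?_ ?_ ?_ ?_
  · exact this.2
  · exact Filter.Eventually.of_forall fun x => (by fun_prop : Continuous _).aestronglyMeasurable
  · exact (by fun_prop : Continuous _).intervalIntegrable _ _
  · exact (by fun_prop : Continuous _).aestronglyMeasurable
  · refine Filter.Eventually.of_forall fun θ _ x _ => ?_
    rw [norm_neg, norm_mul, Real.norm_eq_abs, Real.norm_eq_abs]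
    exact mul_le_one₀ (Real.abs_cos_le_one _) (abs_nonneg _) (Real.abs_sin_le_one _)
  · exact intervalIntegrable_const
  · refine Filter.Eventually.of_forall fun θ _ x _ => ?_
    have := ((hasDerivAt_id x).mul_const (Real.cos θ)).cos
    refine HasDerivAt.congr_deriv this ?_
    simp only [id]; ring

lemma bA1_hasDeriv (s : ℝ) : HasDerivAt bA1 (bA2 s) s := by
  have := intervalIntegral.hasDerivAt_integral_of_dominated_loc_of_deriv_le (𝕜 := ℝ) (μ := volume)
    (F := fun s θ => -(Real.cos θ * Real.sin (s * Real.cos θ)))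
    (F' := fun s θ => -(Real.cos θ ^ 2 * Real.cos (s * Real.cos θ))) (x₀ := s) (s := Set.univ)
    (a := -π) (b := π) (bound := fun _ => 1) Filter.univ_mem ?_ ?_ ?_ ?_ ?_ ?_
  · exact this.2
  · exact Filter.Eventually.of_forall fun x => (by fun_prop : Continuous _).aestronglyMeasurable
  · exact (by fun_prop : Continuous _).intervalIntegrable _ _
  · exact (by fun_prop : Continuous _).aestronglyMeasurable
  · refine Filter.Eventually.of_forall fun θ _ x _ => ?_
    rw [norm_neg, norm_mul, Real.norm_eq_abs, Real.norm_eq_abs, abs_pow]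
    exact mul_le_one₀ (pow_le_one₀ (abs_nonneg _) (Real.abs_cos_le_one _)) (abs_nonneg _)
      (Real.abs_cos_le_one _)
  · exact intervalIntegrable_const
  · refine Filter.Eventually.of_forall fun θ _ x _ => ?_
    have := (((hasDerivAt_id x).mul_const (Real.cos θ)).sin.const_mul (Real.cos θ)).neg
    refine HasDerivAt.congr_deriv this ?_
    simp only [id]; ring

lemma bA_ode (s : ℝ) : s * (bA s + bA2 s) = - bA1 s := by
  have h : ∫ θ in (-π)..π, (Real.cos θ * Real.sin (s * Real.cos θ)
      + Real.sin θ * (Real.cos (s * Real.cos θ) * (s * (-Real.sin θ)))) =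
      Real.sin π * Real.sin (s * Real.cos π) - Real.sin (-π) * Real.sin (s * Real.cos (-π)) := by
    refine intervalIntegral.integral_eq_sub_of_hasDerivAt (f := fun θ => Real.sin θ * Real.sin (s * Real.cos θ)) (fun θ _ => ?_) ?_
    · exact (Real.hasDerivAt_sin θ).mul (((Real.hasDerivAt_cos θ).const_mul s).sin)
    · exact (by fun_prop : Continuous _).intervalIntegrable _ _
  simp only [Real.sin_neg, Real.sin_pi, neg_zero, zero_mul, sub_zero] at h
  have h2 : s * (bA s + bA2 s) + bA1 s = - ∫ θ in (-π)..π, (Real.cos θ * Real.sin (s * Real.cos θ)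
      + Real.sin θ * (Real.cos (s * Real.cos θ) * (s * (-Real.sin θ)))) := by
    unfold bA bA1 bA2
    rw [← intervalIntegral.integral_add, ← intervalIntegral.integral_const_mul,
      ← intervalIntegral.integral_add, ← intervalIntegral.integral_neg]
    · congr 1; ext θ
      have := Real.sin_sq_add_cos_sq θ
      linear_combination (-s * Real.cos (s * Real.cos θ)) * this
    all_goals exact (by fun_prop : Continuous _).intervalIntegrable _ _
  rw [h] at h2; linarith

lemma bA_abs_le (s : ℝ) : |bA s| ≤ 2 * π := by
  have := intervalIntegral.norm_integral_le_of_norm_le_const (a := -π) (b := π) (C := 1)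
    (f := fun θ => Real.cos (s * Real.cos θ)) (fun x _ => Real.abs_cos_le_one _)
  rw [Real.norm_eq_abs] at this
  refine this.trans (le_of_eq ?_)
  rw [abs_of_nonneg (by linarith [Real.pi_pos])]; ring

lemma bA1_abs_le (s : ℝ) : |bA1 s| ≤ 2 * π := by
  have := intervalIntegral.norm_integral_le_of_norm_le_const (a := -π) (b := π) (C := 1)
    (f := fun θ => -(Real.cos θ * Real.sin (s * Real.cos θ))) (fun x _ => by
      rw [norm_neg, norm_mul, Real.norm_eq_abs, Real.norm_eq_abs]
      exact mul_le_one₀ (Real.abs_cos_le_one _) (abs_nonneg _) (Real.abs_sin_le_one _))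
  rw [Real.norm_eq_abs] at this
  refine this.trans (le_of_eq ?_)
  rw [abs_of_nonneg (by linarith [Real.pi_pos])]; ring

lemma bA1_abs_le_mul {s : ℝ} (hs : 0 ≤ s) : |bA1 s| ≤ 2 * π * s := by
  have := intervalIntegral.norm_integral_le_of_norm_le_const (a := -π) (b := π) (C := s)
    (f := fun θ => -(Real.cos θ * Real.sin (s * Real.cos θ))) (fun x _ => by
      rw [norm_neg, norm_mul, Real.norm_eq_abs, Real.norm_eq_abs]
      have h1 : |Real.sin (s * Real.cos x)| ≤ |s * Real.cos x| := Real.abs_sin_le_abs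
      rw [abs_mul, abs_of_nonneg hs] at h1
      have h2 := Real.abs_cos_le_one x
      have h3 := abs_nonneg (Real.cos x)
      have h4 := abs_nonneg (Real.sin (s * Real.cos x))
      have : |Real.cos x| * |Real.sin (s * Real.cos x)| ≤ 1 * (s * 1) := by
        gcongr
        exact h1.trans (by gcongr)
      linarith)
  rw [Real.norm_eq_abs] at this
  refine this.trans (le_of_eq ?_)
  rw [abs_of_nonneg (by linarith [Real.pi_pos])]; ring

lemma bA_zero : bA 0 = 2 * π := by
  simp [bA]; ring

lemma bA_sub_le {s : ℝ} (hs : 0 ≤ s) : |bA s - 2 * π| ≤ 2 * π * s ^ 2 := by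
  have := Convex.norm_image_sub_le_of_norm_hasDerivWithin_le (f := bA) (f' := bA1) (C := 2 * π * s)
    (s := Set.Icc 0 s) (x := 0) (y := s) (fun x _ => (bA_hasDeriv x).hasDerivWithinAt)
    (fun x hx => by
      rw [Real.norm_eq_abs]
      refine (bA1_abs_le_mul hx.1).trans ?_
      have := Real.pi_pos
      have := hx.2
      gcongr) (convex_Icc _ _) ⟨le_rfl, hs⟩ ⟨hs, le_rfl⟩
  rw [bA_zero, Real.norm_eq_abs, Real.norm_eq_abs, sub_zero, abs_of_nonneg hs] at this
  linarith [this]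

/-- Energy. -/
lemma bA_energy {s : ℝ} (hs : 1 ≤ s) : s * (bA s ^ 2 + bA1 s ^ 2) ≤ 36 * π ^ 2 := by
  set E : ℝ → ℝ := fun s => s * (bA s ^ 2 + bA1 s ^ 2) + bA s * bA1 s + bA s ^ 2 / (2 * s) with hE
  have hder : ∀ x, 1 ≤ x → HasDerivAt E (-(bA x ^ 2) / (2 * x ^ 2)) x := by
    intro x hx
    have hx0 : x ≠ 0 := by positivity
    have h0 := bA_hasDeriv x
    have h1 := bA1_hasDeriv x
    have h2 := (((hasDerivAt_id x).mul ((h0.pow 2).add (h1.pow 2))).add (h0.mul h1)).add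
      ((h0.pow 2).div ((hasDerivAt_id x).const_mul 2) (by simpa using hx0))
    have ode : bA2 x = - bA x - bA1 x / x := by
      have := bA_ode x
      field_simp; linarith
    refine HasDerivAt.congr_deriv h2 ?_
    simp only [ode, id, Pi.pow_apply, Pi.add_apply]
    field_simp
    ring
  have hmono : E s ≤ E 1 := by
    have := antitoneOn_of_deriv_nonpos (convex_Ici (1:ℝ)) (f := E)
      (fun x hx => (hder x hx).continuousAt.continuousWithinAt)
      (fun x hx => (hder x (interior_subset hx)).differentiableAt.differentiableWithinAt)
      (fun x hx => by
        rw [(hder x (interior_subset hx)).deriv]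
        have : 0 ≤ bA x ^ 2 / (2 * x ^ 2) := by positivity
        rw [neg_div]; linarith)
    exact this (Set.self_mem_Ici) hs hs
  have hE1 : E 1 ≤ 14 * π ^ 2 := by
    simp only [hE]
    have a1 := sq_le_sq' (abs_le.1 (bA_abs_le 1)).1 (abs_le.1 (bA_abs_le 1)).2
    have a2 := sq_le_sq' (abs_le.1 (bA1_abs_le 1)).1 (abs_le.1 (bA1_abs_le 1)).2
    nlinarith [sq_nonneg (bA 1 - bA1 1)]
  have hEs : s * (bA s ^ 2 + bA1 s ^ 2) / 2 ≤ E s := by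
    simp only [hE]
    have : 0 ≤ bA s ^ 2 / (2 * s) := by positivity
    nlinarith [sq_nonneg (bA s + bA1 s), sq_nonneg (bA s), sq_nonneg (bA1 s)]
  nlinarith [Real.pi_pos]

lemma bA_le {s : ℝ} (hs : 1 ≤ s) : |bA s| ≤ 6 * π * s ^ (-(1/2) : ℝ) ∧ |bA1 s| ≤ 6 * π * s ^ (-(1/2) : ℝ) := by
  have h := bA_energy hs
  have hs0 : 0 < s := by linarith
  have hsq : (s ^ (-(1/2) : ℝ)) ^ 2 = 1 / s := by
    rw [← Real.rpow_natCast, ← Real.rpow_mul hs0.le]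
    norm_num [Real.rpow_neg_one]
  have hp : 0 ≤ 6 * π * s ^ (-(1/2) : ℝ) := by positivity
  have key : bA s ^ 2 + bA1 s ^ 2 ≤ (6 * π * s ^ (-(1/2) : ℝ)) ^ 2 := by
    rw [mul_pow, hsq]
    rw [mul_one_div, le_div_iff₀ hs0]; nlinarith
  constructor
  · exact abs_le_of_sq_le_sq (by nlinarith [sq_nonneg (bA1 s)]) hp
  · exact abs_le_of_sq_le_sq (by nlinarith [sq_nonneg (bA s)]) hp

/-- amplitudes: `bA s = e^{is} aP s + e^{-is} aM s`; `η = ±1`. -/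
noncomputable def amp (η : ℝ) (s : ℝ) : ℂ :=
  Complex.exp (-Complex.I * η * s) * ((bA s : ℂ) - Complex.I * η * (bA1 s : ℂ)) / 2

lemma bA_eq_amp (s : ℝ) : (bA s : ℂ) = Complex.exp (Complex.I * s) * amp 1 s
    + Complex.exp (-Complex.I * s) * amp (-1) s := by
  unfold amp
  have h1 : Complex.exp (Complex.I * s) * Complex.exp (-Complex.I * s) = 1 := by
    rw [← Complex.exp_add]; simp
  push_cast
  have h2 : (-Complex.I * -1 * (s:ℂ)) = Complex.I * s := by ring
  have h3 : (-Complex.I * 1 * (s:ℂ)) = -Complex.I * s := by ring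
  rw [h2, h3]
  linear_combination (-(bA s : ℂ)) * h1

lemma amp_norm_le {η : ℝ} (hη : |η| = 1) {s : ℝ} (hs : 1 ≤ s) :
    ‖amp η s‖ ≤ 6 * π * s ^ (-(1/2) : ℝ) := by
  obtain ⟨h1, h2⟩ := bA_le hs
  unfold amp
  have : ‖Complex.exp (-Complex.I * η * s)‖ = 1 := by
    rw [Complex.norm_exp]; simp
  rw [norm_div, norm_mul, this, one_mul]
  have h3 : ‖(bA s : ℂ) - Complex.I * η * (bA1 s : ℂ)‖ ≤ |bA s| + |bA1 s| := by
    refine (norm_sub_le _ _).trans (le_of_eq ?_)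
    simp [hη]
  simp only [Complex.norm_ofNat]
  linarith

lemma amp_hasDeriv {η : ℝ} (hη : |η| = 1) {s : ℝ} (hs : 0 < s) :
    HasDerivAt (amp η) (Complex.I * η * Complex.exp (-Complex.I * η * s) * (bA1 s : ℂ) / (2 * s)) s := by
  have h0 := (bA_hasDeriv s).ofReal_comp
  have h1 := (bA1_hasDeriv s).ofReal_comp
  have he : HasDerivAt (fun s : ℝ => Complex.exp (-Complex.I * η * s))
      (Complex.exp (-Complex.I * η * s) * (-Complex.I * η)) s := by
    have := (((hasDerivAt_id s).ofReal_comp).const_mul (-Complex.I * η)).cexp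
    simpa using this
  have h2 := ((he.mul (h0.sub (h1.const_mul (Complex.I * η)))).div_const 2)
  have ode : (bA2 s : ℂ) = - bA s - bA1 s / s := by
    have := bA_ode s
    have h : bA2 s = - bA s - bA1 s / s := by field_simp; linarith
    rw [h]; push_cast; ring
  have hsc : (s : ℂ) ≠ 0 := by exact_mod_cast hs.ne'
  have hη2 : (η : ℂ) ^ 2 = 1 := by
    have : η ^ 2 = 1 := by rw [← sq_abs, hη]; norm_num
    exact_mod_cast this
  refine HasDerivAt.congr_deriv h2 ?_
  simp only [ode, Pi.sub_apply]
  field_simp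
  ring_nf
  simp only [hη2, Complex.I_sq]
  ring

lemma amp_deriv_le {η : ℝ} (hη : |η| = 1) {s : ℝ} (hs : 1 ≤ s) :
    ‖Complex.I * η * Complex.exp (-Complex.I * η * s) * (bA1 s : ℂ) / (2 * s)‖
      ≤ 3 * π * s ^ (-(1/2) : ℝ) / s := by
  obtain ⟨h1, h2⟩ := bA_le hs
  have : ‖Complex.exp (-Complex.I * η * s)‖ = 1 := by
    rw [Complex.norm_exp]; simp
  have hs0 : 0 < s := by linarith
  rw [norm_div, norm_mul, norm_mul, norm_mul, this]
  simp only [Complex.norm_I, Complex.norm_real, Real.norm_eq_abs, hη, norm_mul, Complex.norm_ofNat,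
    abs_of_pos hs0]
  rw [div_le_div_iff₀ (by positivity) hs0]
  nlinarith [Real.rpow_pos_of_pos hs0 (-(1/2))]

open MeasureTheory Real Complex
open scoped ENNReal InnerProductSpace

/-! ### One-dimensional oscillatory integrals -/

lemma osc_ibp {F F' : ℝ → ℂ} {ψ p p' : ℝ → ℝ} {α β : ℝ} (hαβ : α ≤ β)
    (hF : ∀ x ∈ Set.Icc α β, HasDerivAt F (F' x) x) (hψ : ∀ x ∈ Set.Icc α β, HasDerivAt ψ (p x) x)
    (hp : ∀ x ∈ Set.Icc α β, HasDerivAt p (p' x) x)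
    (hF'c : ContinuousOn F' (Set.Icc α β)) (hp'c : ContinuousOn p' (Set.Icc α β))
    (hp0 : ∀ x ∈ Set.Icc α β, p x ≠ 0) :
    ‖∫ x in α..β, F x * Complex.exp (Complex.I * ψ x)‖ ≤ ‖F α‖ / |p α| + ‖F β‖ / |p β|
      + ∫ x in α..β, (‖F' x‖ / |p x| + ‖F x‖ * |p' x| / (p x) ^ 2) := by
  have hFc : ContinuousOn F (Set.Icc α β) := fun x hx => (hF x hx).continuousAt.continuousWithinAt
  have hpc : ContinuousOn p (Set.Icc α β) := fun x hx => (hp x hx).continuousAt.continuousWithinAt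
  have hψc : ContinuousOn ψ (Set.Icc α β) := fun x hx => (hψ x hx).continuousAt.continuousWithinAt
  have hpcC : ContinuousOn (fun x => (p x : ℂ)) (Set.Icc α β) :=
    Complex.continuous_ofReal.comp_continuousOn hpc
  have hp'cC : ContinuousOn (fun x => (p' x : ℂ)) (Set.Icc α β) :=
    Complex.continuous_ofReal.comp_continuousOn hp'c
  have hp0C : ∀ x ∈ Set.Icc α β, Complex.I * (p x : ℂ) ≠ 0 := fun x hx =>
    mul_ne_zero Complex.I_ne_zero (by exact_mod_cast hp0 x hx)
  have hec : ContinuousOn (fun x => Complex.exp (Complex.I * ψ x)) (Set.Icc α β) :=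
    Complex.continuous_exp.comp_continuousOn
      (continuousOn_const.mul (Complex.continuous_ofReal.comp_continuousOn hψc))
  set G : ℝ → ℂ := fun x => F x / (Complex.I * p x) with hG
  set G' : ℝ → ℂ := fun x => (F' x * (Complex.I * p x) - F x * (Complex.I * p' x)) / (Complex.I * p x) ^ 2 with hG'
  have hGd : ∀ x ∈ Set.Icc α β, HasDerivAt G (G' x) x := fun x hx =>
    (hF x hx).div ((hp x hx).ofReal_comp.const_mul Complex.I) (hp0C x hx)
  have hG'c : ContinuousOn G' (Set.Icc α β) := by
    refine ContinuousOn.div ?_ ((continuousOn_const.mul hpcC).pow 2) (fun x hx => pow_ne_zero _ (hp0C x hx))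
    exact (hF'c.mul (continuousOn_const.mul hpcC)).sub (hFc.mul (continuousOn_const.mul hp'cC))
  have hed : ∀ x ∈ Set.Icc α β, HasDerivAt (fun x => Complex.exp (Complex.I * ψ x))
      (Complex.exp (Complex.I * ψ x) * (Complex.I * p x)) x := fun x hx =>
    ((hψ x hx).ofReal_comp.const_mul Complex.I).cexp
  have hu : Set.uIcc α β = Set.Icc α β := Set.uIcc_of_le hαβ
  have hibp := intervalIntegral.integral_mul_deriv_eq_deriv_mul (a := α) (b := β)
    (u := G) (v := fun x => Complex.exp (Complex.I * ψ x)) (u' := G')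
    (v' := fun x => Complex.exp (Complex.I * ψ x) * (Complex.I * p x))
    (by rw [hu]; exact hGd) (by rw [hu]; exact hed)
    (by apply ContinuousOn.intervalIntegrable; rw [hu]; exact hG'c)
    (by apply ContinuousOn.intervalIntegrable; rw [hu]; exact hec.mul (continuousOn_const.mul hpcC))
  have heq : ∫ x in α..β, F x * Complex.exp (Complex.I * ψ x) =
      ∫ x in α..β, G x * (Complex.exp (Complex.I * ψ x) * (Complex.I * p x)) := by
    apply intervalIntegral.integral_congr
    intro x hx
    rw [hu] at hx
    have : (p x : ℂ) ≠ 0 := by exact_mod_cast hp0 x hx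
    simp only [hG]
    field_simp
  have hnorm : ∀ x : ℝ, ‖Complex.exp (Complex.I * (x:ℂ))‖ = 1 := fun x => by
    rw [Complex.norm_exp]; simp
  rw [heq, hibp]
  refine (norm_sub_le _ _).trans ?_
  have hGn : ∀ x, ‖G x‖ = ‖F x‖ / |p x| := fun x => by simp [hG]
  have e1 : ‖G β * Complex.exp (Complex.I * ψ β) - G α * Complex.exp (Complex.I * ψ α)‖
      ≤ ‖F α‖ / |p α| + ‖F β‖ / |p β| := by
    refine (norm_sub_le _ _).trans (le_of_eq ?_)
    rw [norm_mul, norm_mul, hnorm, hnorm, hGn, hGn]; ring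
  refine add_le_add e1 ?_
  refine intervalIntegral.norm_integral_le_of_norm_le hαβ ?_ ?_
  · refine Filter.Eventually.of_forall fun x hx => ?_
    have hx' : x ∈ Set.Icc α β := ⟨hx.1.le, hx.2⟩
    have hpx := hp0 x hx'
    rw [norm_mul, hnorm, mul_one, hG']
    simp only [norm_div, norm_pow, norm_mul, Complex.norm_I, one_mul, Complex.norm_real, Real.norm_eq_abs, sq_abs]
    have : ‖F' x‖ / |p x| + ‖F x‖ * |p' x| / p x ^ 2 = (‖F' x‖ * |p x| + ‖F x‖ * |p' x|) / p x ^ 2 := by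
      rw [← sq_abs (p x)]
      have : |p x| ≠ 0 := abs_ne_zero.2 hpx
      field_simp
    rw [this]
    gcongr
    refine (norm_sub_le _ _).trans (le_of_eq ?_)
    simp
  · apply ContinuousOn.intervalIntegrable
    rw [hu]
    refine ContinuousOn.add ?_ ?_
    · exact hF'c.norm.div hpc.abs (fun x hx => abs_ne_zero.2 (hp0 x hx))
    · exact (hFc.norm.mul hp'c.abs).div (hpc.pow 2) (fun x hx => pow_ne_zero _ (hp0 x hx))

lemma osc_power {F F' : ℝ → ℂ} {ψ p p' : ℝ → ℝ} {α β : ℝ} (hα : 0 < α) (hαβ : α ≤ β)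
    (hF : ∀ x ∈ Set.Icc α β, HasDerivAt F (F' x) x) (hψ : ∀ x ∈ Set.Icc α β, HasDerivAt ψ (p x) x)
    (hp : ∀ x ∈ Set.Icc α β, HasDerivAt p (p' x) x)
    (hF'c : ContinuousOn F' (Set.Icc α β)) (hp'c : ContinuousOn p' (Set.Icc α β))
    (hp0 : ∀ x ∈ Set.Icc α β, p x ≠ 0) {c k M M' : ℝ} (hk : k ≠ 0) (hc : 0 ≤ c) (hM : 0 ≤ M) (hM' : 0 ≤ M')
    (b1 : ∀ x ∈ Set.Icc α β, ‖F x‖ ≤ c * x ^ k * |p x|)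
    (b2 : ∀ x ∈ Set.Icc α β, ‖F' x‖ ≤ M * (c * x ^ k * |p x| / x))
    (b3 : ∀ x ∈ Set.Icc α β, |p' x| ≤ M' * (|p x| / x)) :
    ‖∫ x in α..β, F x * Complex.exp (Complex.I * ψ x)‖ ≤
      c * (1 + (M + M') / |k|) * (α ^ k + β ^ k) := by
  refine (osc_ibp hαβ hF hψ hp hF'c hp'c hp0).trans ?_
  have hβ : 0 < β := hα.trans_le hαβ
  have ha : α ∈ Set.Icc α β := ⟨le_rfl, hαβ⟩
  have hb : β ∈ Set.Icc α β := ⟨hαβ, le_rfl⟩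
  have e1 : ‖F α‖ / |p α| ≤ c * α ^ k := by
    rw [div_le_iff₀ (abs_pos.2 (hp0 α ha))]; exact b1 α ha
  have e2 : ‖F β‖ / |p β| ≤ c * β ^ k := by
    rw [div_le_iff₀ (abs_pos.2 (hp0 β hb))]; exact b1 β hb
  have hFc : ContinuousOn F (Set.Icc α β) := fun x hx => (hF x hx).continuousAt.continuousWithinAt
  have hpc : ContinuousOn p (Set.Icc α β) := fun x hx => (hp x hx).continuousAt.continuousWithinAt
  have hu : Set.uIcc α β = Set.Icc α β := Set.uIcc_of_le hαβ
  have h0 : (0:ℝ) ∉ Set.uIcc α β := by rw [hu]; exact fun h => absurd h.1 (not_le.2 hα)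
  have e3 : ∫ x in α..β, (‖F' x‖ / |p x| + ‖F x‖ * |p' x| / (p x) ^ 2) ≤
      ∫ x in α..β, ((M + M') * c) * x ^ (k - 1) := by
    apply intervalIntegral.integral_mono_on hαβ
    · apply ContinuousOn.intervalIntegrable
      rw [hu]
      refine ContinuousOn.add ?_ ?_
      · exact hF'c.norm.div hpc.abs (fun x hx => abs_ne_zero.2 (hp0 x hx))
      · exact (hFc.norm.mul hp'c.abs).div (hpc.pow 2) (fun x hx => pow_ne_zero _ (hp0 x hx))
    · exact (intervalIntegral.intervalIntegrable_rpow (Or.inr h0)).const_mul _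
    · intro x hx
      have hx0 : 0 < x := hα.trans_le hx.1
      have hP : 0 < |p x| := abs_pos.2 (hp0 x hx)
      rw [← sq_abs (p x), Real.rpow_sub_one hx0.ne']
      have f1 : ‖F' x‖ / |p x| ≤ M * c * (x ^ k / x) := by
        rw [div_le_iff₀ hP]
        refine (b2 x hx).trans (le_of_eq ?_); ring
      have f2 : ‖F x‖ * |p' x| / |p x| ^ 2 ≤ M' * c * (x ^ k / x) := by
        rw [div_le_iff₀ (by positivity)]
        have hxk : 0 ≤ x ^ k := by positivity
        calc ‖F x‖ * |p' x| ≤ (c * x ^ k * |p x|) * (M' * (|p x| / x)) := by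
              gcongr
              · exact b1 x hx
              · exact b3 x hx
          _ = _ := by ring
      linarith
  have e4 : ∫ x in α..β, ((M + M') * c) * x ^ (k - 1) = (M + M') * c * ((β ^ k - α ^ k) / k) := by
    rw [intervalIntegral.integral_const_mul, integral_rpow (Or.inr ⟨by intro h; apply hk; linarith, h0⟩)]
    simp
  have e5 : (β ^ k - α ^ k) / k ≤ (α ^ k + β ^ k) / |k| := by
    have ha' : 0 < α ^ k := by positivity
    have hb' : 0 < β ^ k := by positivity
    refine (le_abs_self _).trans ?_
    rw [abs_div]
    gcongr
    rw [abs_le]; constructor <;> linarith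
  have e6 : (M + M') * c * ((β ^ k - α ^ k) / k) ≤ (M + M') * c * ((α ^ k + β ^ k) / |k|) := by
    gcongr
  calc _ ≤ c * α ^ k + c * β ^ k + (M + M') * c * ((α ^ k + β ^ k) / |k|) := by linarith
    _ = _ := by ring

lemma osc_side {F F' : ℝ → ℂ} {ψ p p' : ℝ → ℝ} {α β : ℝ} (hαβ : α ≤ β)
    (hF : ∀ x ∈ Set.Icc α β, HasDerivAt F (F' x) x) (hψ : ∀ x ∈ Set.Icc α β, HasDerivAt ψ (p x) x)
    (hp : ∀ x ∈ Set.Icc α β, HasDerivAt p (p' x) x)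
    (hF'c : ContinuousOn F' (Set.Icc α β)) (hp'c : ContinuousOn p' (Set.Icc α β))
    {κ M D : ℝ} (hκ : 0 < κ) (hM : 0 ≤ M)
    (b0 : ∀ x ∈ Set.Icc α β, κ ≤ |p x|) (b3 : ∀ x ∈ Set.Icc α β, p' x ≤ 0)
    (b1 : ∀ x ∈ Set.Icc α β, ‖F x‖ ≤ M) (b2 : ∀ x ∈ Set.Icc α β, ‖F' x‖ ≤ D) :
    ‖∫ x in α..β, F x * Complex.exp (Complex.I * ψ x)‖ ≤ (4 * M + D * (β - α)) / κ := by
  have hp0 : ∀ x ∈ Set.Icc α β, p x ≠ 0 := fun x hx => abs_pos.1 (hκ.trans_le (b0 x hx))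
  refine (osc_ibp hαβ hF hψ hp hF'c hp'c hp0).trans ?_
  have ha : α ∈ Set.Icc α β := ⟨le_rfl, hαβ⟩
  have hb : β ∈ Set.Icc α β := ⟨hαβ, le_rfl⟩
  have e1 : ‖F α‖ / |p α| ≤ M / κ := div_le_div₀ hM (b1 α ha) hκ (b0 α ha)
  have e2 : ‖F β‖ / |p β| ≤ M / κ := div_le_div₀ hM (b1 β hb) hκ (b0 β hb)
  have hD : 0 ≤ D := (norm_nonneg _).trans (b2 α ha)
  have hFc : ContinuousOn F (Set.Icc α β) := fun x hx => (hF x hx).continuousAt.continuousWithinAt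
  have hpc : ContinuousOn p (Set.Icc α β) := fun x hx => (hp x hx).continuousAt.continuousWithinAt
  have hu : Set.uIcc α β = Set.Icc α β := Set.uIcc_of_le hαβ
  have hic : ContinuousOn (fun x => -p' x / (p x) ^ 2) (Set.Icc α β) :=
    (hp'c.neg).div (hpc.pow 2) (fun x hx => pow_ne_zero _ (hp0 x hx))
  have hi : IntervalIntegrable (fun x => -p' x / (p x) ^ 2) volume α β := by
    apply ContinuousOn.intervalIntegrable; rw [hu]; exact hic
  have e3 : ∫ x in α..β, (‖F' x‖ / |p x| + ‖F x‖ * |p' x| / (p x) ^ 2) ≤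
      ∫ x in α..β, (D / κ + M * (-p' x / (p x) ^ 2)) := by
    apply intervalIntegral.integral_mono_on hαβ
    · apply ContinuousOn.intervalIntegrable
      rw [hu]
      refine ContinuousOn.add ?_ ?_
      · exact hF'c.norm.div hpc.abs (fun x hx => abs_ne_zero.2 (hp0 x hx))
      · exact (hFc.norm.mul hp'c.abs).div (hpc.pow 2) (fun x hx => pow_ne_zero _ (hp0 x hx))
    · exact intervalIntegrable_const.add (hi.const_mul _)
    · intro x hx
      refine add_le_add (div_le_div₀ hD (b2 x hx) hκ (b0 x hx)) ?_
      rw [abs_of_nonpos (b3 x hx), mul_div_assoc]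
      refine mul_le_mul_of_nonneg_right (b1 x hx) ?_
      have := b3 x hx
      apply div_nonneg (by linarith) (sq_nonneg _)
  have e4 : ∫ x in α..β, -p' x / (p x) ^ 2 = (p β)⁻¹ - (p α)⁻¹ := by
    refine intervalIntegral.integral_eq_sub_of_hasDerivAt (f := fun x => (p x)⁻¹) ?_ hi
    intro x hx
    rw [hu] at hx
    exact (hp x hx).inv (hp0 x hx)
  rw [intervalIntegral.integral_add intervalIntegrable_const (hi.const_mul _),
    intervalIntegral.integral_const_mul, e4, intervalIntegral.integral_const, smul_eq_mul] at e3
  have e5 : (p β)⁻¹ - (p α)⁻¹ ≤ 2 / κ := by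
    have h1 : |(p β)⁻¹| ≤ 1 / κ := by
      rw [abs_inv, inv_eq_one_div]; exact div_le_div₀ zero_le_one le_rfl hκ (b0 β hb)
    have h2 : |(p α)⁻¹| ≤ 1 / κ := by
      rw [abs_inv, inv_eq_one_div]; exact div_le_div₀ zero_le_one le_rfl hκ (b0 α ha)
    have := (abs_le.1 h1).2
    have := (abs_le.1 h2).1
    rw [show 2 / κ = 1 / κ + 1 / κ by ring]; linarith
  have e6 := mul_le_mul_of_nonneg_left e5 hM
  calc _ ≤ M / κ + M / κ + ((β - α) * (D / κ) + M * (2 / κ)) := by linarith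
    _ = _ := by ring

lemma osc_mid {F F' : ℝ → ℂ} {ψ p p' : ℝ → ℝ} {α β : ℝ} (hαβ : α ≤ β)
    (hF : ∀ x ∈ Set.Icc α β, HasDerivAt F (F' x) x) (hψ : ∀ x ∈ Set.Icc α β, HasDerivAt ψ (p x) x)
    (hp : ∀ x ∈ Set.Icc α β, HasDerivAt p (p' x) x)
    (hF'c : ContinuousOn F' (Set.Icc α β)) (hp'c : ContinuousOn p' (Set.Icc α β))
    {lam M D x0 : ℝ} (hl : 0 < lam) (hM : 0 ≤ M)
    (b0 : ∀ x ∈ Set.Icc α β, lam * |x - x0| ≤ |p x|) (b3 : ∀ x ∈ Set.Icc α β, p' x ≤ 0)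
    (b1 : ∀ x ∈ Set.Icc α β, ‖F x‖ ≤ M) (b2 : ∀ x ∈ Set.Icc α β, ‖F' x‖ ≤ D) :
    ‖∫ x in α..β, F x * Complex.exp (Complex.I * ψ x)‖ ≤ (10 * M + 2 * (D * (β - α))) / √lam := by
  set δ := 1 / √lam with hδ
  have hsl : 0 < √lam := Real.sqrt_pos.2 hl
  have hδ0 : 0 < δ := by positivity
  have hlδ : lam * δ = √lam := by
    rw [hδ, mul_one_div, div_eq_iff hsl.ne', Real.mul_self_sqrt hl.le]
  have hD : 0 ≤ D := (norm_nonneg _).trans (b2 α ⟨le_rfl, hαβ⟩)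
  set x1 := max α (min β (x0 - δ)) with hx1
  set x2 := max α (min β (x0 + δ)) with hx2
  have h1 : α ≤ x1 := le_max_left _ _
  have h12 : x1 ≤ x2 := by
    apply max_le_max le_rfl; apply min_le_min le_rfl; linarith
  have h2 : x2 ≤ β := max_le hαβ (min_le_left _ _)
  have hFc : ContinuousOn F (Set.Icc α β) := fun x hx => (hF x hx).continuousAt.continuousWithinAt
  have hψc : ContinuousOn ψ (Set.Icc α β) := fun x hx => (hψ x hx).continuousAt.continuousWithinAt
  have hcont : ContinuousOn (fun x => F x * Complex.exp (Complex.I * ψ x)) (Set.Icc α β) :=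
    hFc.mul (Complex.continuous_exp.comp_continuousOn
      (continuousOn_const.mul (Complex.continuous_ofReal.comp_continuousOn hψc)))
  have hii : ∀ a b, α ≤ a → a ≤ b → b ≤ β → IntervalIntegrable (fun x => F x * Complex.exp (Complex.I * ψ x)) volume a b := by
    intro a b ha hab hb
    apply ContinuousOn.intervalIntegrable
    rw [Set.uIcc_of_le hab]
    exact hcont.mono (Set.Icc_subset_Icc ha hb)
  rw [← intervalIntegral.integral_add_adjacent_intervals (hii α x2 le_rfl (h1.trans h12) h2)
      (hii x2 β (h1.trans h12) h2 le_rfl),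
    ← intervalIntegral.integral_add_adjacent_intervals (hii α x1 le_rfl h1 (h12.trans h2))
      (hii x1 x2 h1 h12 h2)]
  have side : ∀ a b, α ≤ a → a ≤ b → b ≤ β → (∀ x ∈ Set.Icc a b, δ ≤ |x - x0|) →
      ‖∫ x in a..b, F x * Complex.exp (Complex.I * ψ x)‖ ≤ (4 * M + D * (β - α)) / √lam := by
    intro a b ha hab hb hd
    have hs : Set.Icc a b ⊆ Set.Icc α β := Set.Icc_subset_Icc ha hb
    refine (osc_side hab (fun x hx => hF x (hs hx)) (fun x hx => hψ x (hs hx)) (fun x hx => hp x (hs hx))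
      (hF'c.mono hs) (hp'c.mono hs) hsl hM (fun x hx => ?_) (fun x hx => b3 x (hs hx))
      (fun x hx => b1 x (hs hx)) (fun x hx => b2 x (hs hx))).trans ?_
    · rw [← hlδ]
      refine le_trans ?_ (b0 x (hs hx))
      gcongr
      exact hd x hx
    · gcongr
  have triv : 0 ≤ (4 * M + D * (β - α)) / √lam := by
    have : 0 ≤ β - α := by linarith
    positivity
  have i1 : ‖∫ x in α..x1, F x * Complex.exp (Complex.I * ψ x)‖ ≤ (4 * M + D * (β - α)) / √lam := by
    by_cases h : x1 = α
    · rw [h]; simpa using triv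
    · apply side _ _ le_rfl h1 (h12.trans h2)
      intro x hx
      have : x1 ≤ x0 - δ := by
        rcases max_choice α (min β (x0 - δ)) with h' | h'
        · exact absurd h' h
        · rw [hx1, h']; exact min_le_right _ _
      have := hx.2
      rw [abs_of_nonpos (by linarith)]; linarith
  have i3 : ‖∫ x in x2..β, F x * Complex.exp (Complex.I * ψ x)‖ ≤ (4 * M + D * (β - α)) / √lam := by
    by_cases h : x2 = β
    · rw [h]; simpa using triv
    · apply side _ _ (h1.trans h12) h2 le_rfl
      intro x hx
      have : x0 + δ ≤ x2 := by
        rcases min_choice β (x0 + δ) with h' | h'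
        · exfalso; apply h; rw [hx2, h']; exact max_eq_right hαβ
        · rw [hx2, h']; exact le_max_right _ _
      have := hx.1
      rw [abs_of_nonneg (by linarith)]; linarith
  have i2 : ‖∫ x in x1..x2, F x * Complex.exp (Complex.I * ψ x)‖ ≤ 2 * M / √lam := by
    have := intervalIntegral.norm_integral_le_of_norm_le_const (a := x1) (b := x2) (C := M)
      (f := fun x => F x * Complex.exp (Complex.I * ψ x)) (fun x hx => by
        rw [Set.uIoc_of_le h12] at hx
        rw [norm_mul, Complex.norm_exp]
        simpa using b1 x ⟨h1.trans hx.1.le, hx.2.trans h2⟩)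
    refine this.trans ?_
    rw [abs_of_nonneg (by linarith)]
    have : x2 - x1 ≤ 2 * δ := by
      have a1 : x2 ≤ x1 + 2 * δ := by
        apply max_le
        · linarith
        · rcases le_total β (x0 - δ) with h | h
          · have : min β (x0 - δ) ≤ x1 := le_max_right _ _
            rw [min_eq_left h] at this
            have := min_le_left β (x0 + δ)
            linarith
          · have : min β (x0 - δ) ≤ x1 := le_max_right _ _
            rw [min_eq_right h] at this
            have := min_le_right β (x0 + δ)
            linarith
      linarith
    calc M * (x2 - x1) ≤ M * (2 * δ) := by gcongr
      _ = _ := by rw [hδ]; ring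
  refine (norm_add_le _ _).trans ?_
  refine (add_le_add_left (norm_add_le _ _) _).trans ?_
  calc _ ≤ (4 * M + D * (β - α)) / √lam + 2 * M / √lam + (4 * M + D * (β - α)) / √lam := by linarith
    _ = _ := by ring

open MeasureTheory Real Complex
open scoped ENNReal InnerProductSpace

/-! ### The phase and the amplitude -/

/-- `√(1+ρ²/3)` -/
noncomputable def vW (ρ : ℝ) : ℝ := √(1 + ρ ^ 2 / 3)

lemma vW_sq (ρ : ℝ) : vW ρ ^ 2 = 1 + ρ ^ 2 / 3 := Real.sq_sqrt (by positivity)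
lemma vW_ge_one (ρ : ℝ) : 1 ≤ vW ρ := by
  rw [vW, Real.one_le_sqrt]; nlinarith [sq_nonneg ρ]
lemma vW_pos (ρ : ℝ) : 0 < vW ρ := by linarith [vW_ge_one ρ]
lemma vW_le_two {ρ : ℝ} (h : 0 ≤ ρ) : ρ ≤ 2 * vW ρ := by
  have := vW_sq ρ; have := vW_pos ρ; nlinarith [sq_nonneg ρ]
lemma vW_mono {a b : ℝ} (ha : 0 ≤ a) (hab : a ≤ b) : vW a ≤ vW b := by
  apply Real.sqrt_le_sqrt; nlinarith
lemma vW_continuous : Continuous vW := by unfold vW; fun_prop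

lemma vW_hasDeriv (ρ : ℝ) : HasDerivAt vW (ρ / (3 * vW ρ)) ρ := by
  have h : HasDerivAt (fun ρ : ℝ => 1 + ρ ^ 2 / 3) (2 * ρ / 3) ρ := by
    have := (((hasDerivAt_id ρ).pow 2).div_const 3).const_add 1
    refine HasDerivAt.congr_deriv this ?_
    simp
  have := h.sqrt (by positivity)
  refine HasDerivAt.congr_deriv this ?_
  have hv : √(1 + ρ ^ 2 / 3) = vW ρ := rfl
  rw [hv]
  have := (vW_pos ρ).ne'
  field_simp

/-- `w` -/
noncomputable def wW (ρ : ℝ) : ℝ := ρ / vW ρ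

lemma wW_hasDeriv (ρ : ℝ) : HasDerivAt wW (1 / vW ρ ^ 3) ρ := by
  have := (hasDerivAt_id ρ).div (vW_hasDeriv ρ) (vW_pos ρ).ne'
  refine HasDerivAt.congr_deriv this ?_
  have h1 := vW_sq ρ
  have h2 := (vW_pos ρ).ne'
  simp only [id]
  field_simp
  linear_combination 3 * h1

lemma vW3_hasDeriv (ρ : ℝ) : HasDerivAt (fun ρ => 1 / vW ρ ^ 3) (-ρ / vW ρ ^ 5) ρ := by
  have h2 := (vW_pos ρ).ne'
  have := (hasDerivAt_const ρ (1:ℝ)).div ((vW_hasDeriv ρ).pow 3) (pow_ne_zero _ h2)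
  refine HasDerivAt.congr_deriv this ?_
  simp only [Pi.pow_apply]
  field_simp
  norm_num
  ring

/-- complex power of the weight -/
noncomputable def cW (c : ℂ) (ρ : ℝ) : ℂ := ((1 + ρ ^ 2 / 3 : ℝ) : ℂ) ^ c

lemma cW_hasDeriv (c : ℂ) (ρ : ℝ) : HasDerivAt (cW c) (c * cW (c - 1) ρ * (2 * ρ / 3 : ℝ)) ρ := by
  have h : HasDerivAt (fun ρ : ℝ => 1 + ρ ^ 2 / 3) (2 * ρ / 3) ρ := by
    have := (((hasDerivAt_id ρ).pow 2).div_const 3).const_add 1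
    refine HasDerivAt.congr_deriv this ?_
    simp
  have hs : ((1 + ρ ^ 2 / 3 : ℝ) : ℂ) ∈ Complex.slitPlane := by
    left; rw [Complex.ofReal_re]; positivity
  have h3 : HasDerivAt (fun w : ℂ => w ^ c) (c * ((1 + ρ ^ 2 / 3 : ℝ) : ℂ) ^ (c - 1)) ((1 + ρ ^ 2 / 3 : ℝ) : ℂ) := by
    simpa using (hasDerivAt_id (((1 + ρ ^ 2 / 3 : ℝ) : ℂ))).cpow_const (c := c) hs
  have h4 : HasDerivAt (fun ρ : ℝ => ((1 + ρ ^ 2 / 3 : ℝ) : ℂ)) ((2 * ρ / 3 : ℝ) : ℂ) ρ := h.ofReal_comp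
  exact HasDerivAt.comp ρ h3 h4

lemma cW_continuous (c : ℂ) : Continuous (cW c) :=
  continuous_iff_continuousAt.2 fun ρ => (cW_hasDeriv c ρ).continuousAt

lemma cW_norm (c : ℂ) (ρ : ℝ) : ‖cW c ρ‖ = (1 + ρ ^ 2 / 3) ^ c.re := by
  unfold cW
  rw [Complex.norm_cpow_eq_rpow_re_of_pos (by positivity)]

lemma cW_norm_neg_nat (c : ℂ) (ρ : ℝ) (n : ℕ) (h : c.re = -(n : ℝ) / 2) : ‖cW c ρ‖ = 1 / vW ρ ^ n := by
  rw [cW_norm, h, ← vW_sq, ← Real.rpow_natCast (vW ρ) 2, ← Real.rpow_mul (vW_pos ρ).le]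
  rw [show ((2:ℕ):ℝ) * (-(n:ℝ)/2) = -(n:ℝ) by push_cast; ring, Real.rpow_neg (vW_pos ρ).le,
    Real.rpow_natCast, one_div]

lemma cW_mul (c d : ℂ) (ρ : ℝ) : cW c ρ * cW d ρ = cW (c + d) ρ := by
  unfold cW
  rw [Complex.cpow_add]
  have : (0:ℝ) < 1 + ρ ^ 2 / 3 := by positivity
  exact_mod_cast this.ne'

/-- the amplitude `ρ u^{-2z} amp(ρ r)` -/
noncomputable def FA (η r : ℝ) (z : ℂ) (ρ : ℝ) : ℂ := ρ * cW (-(2 * z)) ρ * amp η (ρ * r)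
/-- its derivative -/
noncomputable def FA' (η r : ℝ) (z : ℂ) (ρ : ℝ) : ℂ :=
  (cW (-(2 * z)) ρ + ρ * (-(2 * z) * cW (-(2 * z) - 1) ρ * (2 * ρ / 3 : ℝ))) * amp η (ρ * r)
  + ρ * cW (-(2 * z)) ρ * ((Complex.I * η * Complex.exp (-Complex.I * η * (ρ * r : ℝ)) * (bA1 (ρ * r) : ℂ) / (2 * (ρ * r : ℝ))) * r)

lemma rcW_hasDeriv (z : ℂ) (ρ : ℝ) : HasDerivAt (fun ρ : ℝ => (ρ : ℂ) * cW (-(2 * z)) ρ)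
    (cW (-(2 * z)) ρ + ρ * (-(2 * z) * cW (-(2 * z) - 1) ρ * (2 * ρ / 3 : ℝ))) ρ := by
  have := ((hasDerivAt_id ρ).ofReal_comp).mul (cW_hasDeriv (-(2 * z)) ρ)
  refine HasDerivAt.congr_deriv this ?_
  simp

lemma FA_hasDeriv {η r : ℝ} (hη : |η| = 1) (z : ℂ) {ρ : ℝ} (h : 0 < ρ * r) :
    HasDerivAt (FA η r z) (FA' η r z ρ) ρ := by
  have h1 : HasDerivAt (fun ρ : ℝ => amp η (ρ * r)) ((Complex.I * η * Complex.exp (-Complex.I * η * (ρ * r : ℝ)) * (bA1 (ρ * r) : ℂ) / (2 * (ρ * r : ℝ))) * r) ρ := by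
    have h2 : HasDerivAt (fun ρ : ℝ => ρ * r) r ρ := by simpa using (hasDerivAt_id ρ).mul_const r
    have := HasDerivAt.scomp ρ (amp_hasDeriv hη h) h2
    refine HasDerivAt.congr_deriv this ?_
    rw [Complex.real_smul]; ring
  exact (rcW_hasDeriv z ρ).mul h1

lemma bA1_continuous : Continuous bA1 :=
  continuous_iff_continuousAt.2 fun s => (bA1_hasDeriv s).continuousAt
lemma bA_continuous : Continuous bA :=
  continuous_iff_continuousAt.2 fun s => (bA_hasDeriv s).continuousAt
lemma amp_continuous (η : ℝ) : Continuous (amp η) := by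
  have := bA1_continuous
  have := bA_continuous
  unfold amp; fun_prop

lemma FA'_continuousOn (η r : ℝ) (z : ℂ) {α β : ℝ} (h : ∀ x ∈ Set.Icc α β, 0 < x * r) :
    ContinuousOn (FA' η r z) (Set.Icc α β) := by
  have h1 := bA1_continuous
  have h2 := amp_continuous η
  have h3 := cW_continuous (-(2 * z))
  have h4 := cW_continuous (-(2 * z) - 1)
  unfold FA'
  apply ContinuousOn.add
  · fun_prop
  · apply ContinuousOn.mul
    · fun_prop
    · apply ContinuousOn.mul _ continuousOn_const
      apply ContinuousOn.div
      · fun_prop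
      · fun_prop
      · intro x hx
        have := (h x hx).ne'
        norm_cast
        positivity

lemma sqrt_rpow {s : ℝ} (hs : 0 ≤ s) : s ^ (-(1/2) : ℝ) = 1 / √s := by
  rw [Real.rpow_neg hs, ← Real.sqrt_eq_rpow, one_div]

lemma rcW_deriv_le {z : ℂ} (hz : z.re = 1) (ρ : ℝ) :
    ‖cW (-(2 * z)) ρ + ρ * (-(2 * z) * cW (-(2 * z) - 1) ρ * (2 * ρ / 3 : ℝ))‖ ≤
      (1 + 4 * ‖z‖) / vW ρ ^ 4 := by
  have hv := vW_pos ρ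
  refine (norm_add_le _ _).trans ?_
  rw [cW_norm_neg_nat _ ρ 4 (by simp [hz]; norm_num)]
  rw [norm_mul, norm_mul, norm_mul, cW_norm_neg_nat _ ρ 6 (by simp [hz]; norm_num)]
  simp only [Complex.norm_real, Real.norm_eq_abs, norm_neg, norm_mul, Complex.norm_ofNat]
  have h1 : |ρ| * |2 * ρ / 3| = 2 * (vW ρ ^ 2 - 1) := by
    rw [vW_sq, ← abs_mul, abs_of_nonneg (by nlinarith [sq_nonneg ρ])]; ring
  have h2 : |ρ| * (2 * ‖z‖ * (1 / vW ρ ^ 6) * |2 * ρ / 3|) = 4 * ‖z‖ * (vW ρ ^ 2 - 1) / vW ρ ^ 6 := by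
    linear_combination (2 * ‖z‖ * (1 / vW ρ ^ 6)) * h1
  rw [h2, add_div]
  refine add_le_add le_rfl ?_
  rw [div_le_div_iff₀ (by positivity) (by positivity)]
  have := norm_nonneg z
  have : 0 ≤ 4 * ‖z‖ * vW ρ ^ 4 := by positivity
  nlinarith

lemma FA_norm_le {η r : ℝ} (hη : |η| = 1) {z : ℂ} (hz : z.re = 1) {ρ : ℝ} (hρ : 0 < ρ) (h : 1 ≤ ρ * r) :
    ‖FA η r z ρ‖ ≤ 6 * π * (ρ / (vW ρ ^ 4 * √(ρ * r))) := by
  have h1 := amp_norm_le hη h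
  rw [sqrt_rpow (by linarith)] at h1
  have hv := vW_pos ρ
  unfold FA
  rw [norm_mul, norm_mul, cW_norm_neg_nat _ ρ 4 (by simp [hz]; norm_num)]
  rw [Complex.norm_real, Real.norm_eq_abs, abs_of_pos hρ]
  calc _ ≤ ρ * (1 / vW ρ ^ 4) * (6 * π * (1 / √(ρ * r))) := by gcongr
    _ = _ := by
      have : √(ρ * r) ≠ 0 := (Real.sqrt_pos.2 (by linarith)).ne'
      field_simp

lemma FA'_norm_le {η r : ℝ} (hη : |η| = 1) {z : ℂ} (hz : z.re = 1) {ρ : ℝ} (hρ : 0 < ρ) (h : 1 ≤ ρ * r) :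
    ‖FA' η r z ρ‖ ≤ (2 + 4 * ‖z‖) * (6 * π * (ρ / (vW ρ ^ 4 * √(ρ * r))) / ρ) := by
  have h1 := amp_norm_le hη h
  have h2 := amp_deriv_le hη h
  rw [sqrt_rpow (by linarith)] at h1 h2
  have hv := vW_pos ρ
  have hr : 0 < r := by
    by_contra hr; nlinarith
  have hs : 0 < √(ρ * r) := Real.sqrt_pos.2 (by linarith)
  unfold FA'
  refine (norm_add_le _ _).trans ?_
  rw [norm_mul, norm_mul, norm_mul, norm_mul, cW_norm_neg_nat _ ρ 4 (by simp [hz]; norm_num)]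
  rw [Complex.norm_real, Complex.norm_real, Real.norm_eq_abs, Real.norm_eq_abs, abs_of_pos hρ, abs_of_pos hr]
  calc _ ≤ (1 + 4 * ‖z‖) / vW ρ ^ 4 * (6 * π * (1 / √(ρ * r))) + ρ * (1 / vW ρ ^ 4) * (3 * π * (1 / √(ρ * r)) / (ρ * r) * r) := by
        gcongr
        exact rcW_deriv_le hz ρ
    _ ≤ (1 + 4 * ‖z‖) / vW ρ ^ 4 * (6 * π * (1 / √(ρ * r))) + 1 / vW ρ ^ 4 * (6 * π * (1 / √(ρ * r))) := by
        refine add_le_add le_rfl ?_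
        rw [show ρ * (1 / vW ρ ^ 4) * (3 * π * (1 / √(ρ * r)) / (ρ * r) * r) = 1 / vW ρ ^ 4 * (3 * π * (1 / √(ρ * r))) by field_simp]
        gcongr
        norm_num
    _ = _ := by
      field_simp
      ring

/-- phase -/
noncomputable def psi (η r t ρ : ℝ) : ℝ := t * wW ρ + η * r * ρ
/-- phase derivative -/
noncomputable def psi1 (η r t ρ : ℝ) : ℝ := t * (1 / vW ρ ^ 3) + η * r
/-- second derivative -/
noncomputable def psi2 (t ρ : ℝ) : ℝ := t * (-ρ / vW ρ ^ 5)

lemma psi_hasDeriv (η r t ρ : ℝ) : HasDerivAt (psi η r t) (psi1 η r t ρ) ρ := by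
  have := ((wW_hasDeriv ρ).const_mul t).add ((hasDerivAt_id ρ).const_mul (η * r))
  refine HasDerivAt.congr_deriv this ?_
  simp [psi1]
lemma psi1_hasDeriv (η r t ρ : ℝ) : HasDerivAt (psi1 η r t) (psi2 t ρ) ρ :=
  ((vW3_hasDeriv ρ).const_mul t).add_const (η * r)
lemma psi2_continuous (t : ℝ) : Continuous (psi2 t) := by
  have := vW_continuous
  unfold psi2
  apply continuous_const.mul
  apply Continuous.div (by fun_prop) (by fun_prop)
  intro x; exact pow_ne_zero _ (vW_pos x).ne'

/-- Wrapped version of `osc_power` for our phases. -/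
lemma osc_FA {η r t : ℝ} (hη : |η| = 1) {z : ℂ} (hz : z.re = 1) {α β : ℝ} (hα : 0 < α) (hαβ : α ≤ β)
    (hr : 0 < r) (hαr : 1 ≤ α * r) {c k M' : ℝ} (hk : k < 0) (hc : 0 ≤ c) (hM' : 0 ≤ M')
    (hp0 : ∀ x ∈ Set.Icc α β, psi1 η r t x ≠ 0)
    (b1 : ∀ x ∈ Set.Icc α β, 6 * π * (x / (vW x ^ 4 * √(x * r))) ≤ c * x ^ k * |psi1 η r t x|)
    (b3 : ∀ x ∈ Set.Icc α β, |psi2 t x| ≤ M' * (|psi1 η r t x| / x)) :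
    ‖∫ x in α..β, FA η r z x * Complex.exp (Complex.I * psi η r t x)‖ ≤
      2 * c * (1 + (2 + 4 * ‖z‖ + M') / |k|) * α ^ k := by
  have hx0 : ∀ x ∈ Set.Icc α β, 0 < x := fun x hx => hα.trans_le hx.1
  have hxr : ∀ x ∈ Set.Icc α β, 1 ≤ x * r := fun x hx => hαr.trans (by have := hx.1; gcongr)
  have hz0 := norm_nonneg z
  refine (osc_power hα hαβ (fun x hx => FA_hasDeriv hη z (by linarith [hxr x hx]))
    (fun x _ => psi_hasDeriv η r t x) (fun x _ => psi1_hasDeriv η r t x)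
    (FA'_continuousOn η r z (fun x hx => by linarith [hxr x hx])) (psi2_continuous t).continuousOn hp0
    hk.ne hc (M := 2 + 4 * ‖z‖) (by positivity) hM' (fun x hx => (FA_norm_le hη hz (hx0 x hx) (hxr x hx)).trans (b1 x hx))
    (fun x hx => (FA'_norm_le hη hz (hx0 x hx) (hxr x hx)).trans ?_) b3).trans ?_
  · have := hx0 x hx
    exact mul_le_mul_of_nonneg_left (div_le_div_of_nonneg_right (b1 x hx) this.le) (by positivity)
  · have : β ^ k ≤ α ^ k := Real.rpow_le_rpow_of_nonpos hα hαβ hk.le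
    calc _ ≤ c * (1 + (2 + 4 * ‖z‖ + M') / |k|) * (α ^ k + α ^ k) := by gcongr
      _ = _ := by ring

open MeasureTheory Real Complex
open scoped ENNReal InnerProductSpace

lemma vsq_eq {x : ℝ} : x ^ 2 = 3 * (vW x ^ 2 - 1) := by rw [vW_sq]; ring

lemma Q_form {x r : ℝ} (hx : 0 < x) (hr : 0 < r) :
    6 * π * (x / (vW x ^ 4 * √(x * r))) = 6 * π * √x / (√r * vW x ^ 4) := by
  have h1 := vW_pos x
  have h2 := Real.sqrt_pos.2 hx
  have h3 := Real.sqrt_pos.2 hr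
  rw [Real.sqrt_mul hx.le]
  have : x = √x * √x := (Real.mul_self_sqrt hx.le).symm
  field_simp
  nlinarith

lemma rpow_m32 {s : ℝ} (hs : 0 < s) : s ^ (-(3/2) : ℝ) = 1 / (s * √s) := by
  rw [show (-(3/2) : ℝ) = -(1 + 1/2) by norm_num, Real.rpow_neg hs.le, Real.rpow_add hs, Real.rpow_one,
    ← Real.sqrt_eq_rpow, one_div]

lemma osc_plus {r t : ℝ} {z : ℂ} (hz : z.re = 1) {α β : ℝ} (hα : 0 < α) (hαβ : α ≤ β)
    (hr : 0 < r) (ht : 0 < t) (hαr : 1 ≤ α * r) :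
    ‖∫ x in α..β, FA 1 r z x * Complex.exp (Complex.I * psi 1 r t x)‖ ≤
      12288 * π * (1 + ‖z‖) / t := by
  have hx0 : ∀ x ∈ Set.Icc α β, 0 < x := fun x hx => hα.trans_le hx.1
  have hp : ∀ x, t / vW x ^ 3 ≤ psi1 1 r t x := by
    intro x; unfold psi1; rw [mul_one_div]; linarith
  have hp' : ∀ x, 0 < psi1 1 r t x := fun x => lt_of_lt_of_le (by have := vW_pos x; positivity) (hp x)
  have hsr := Real.sqrt_pos.2 hr
  refine (osc_FA (by norm_num) hz hα hαβ hr hαr (c := 12 * π / (t * √r)) (k := -(1/2)) (M' := 3) (by norm_num)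
    (by positivity) (by norm_num) (fun x _ => (hp' x).ne') ?_ ?_).trans ?_
  · intro x hx
    have h0 := hx0 x hx
    have hv := vW_pos x
    have hsx := Real.sqrt_pos.2 h0
    rw [Q_form h0 hr, sqrt_rpow h0.le, abs_of_pos (hp' x)]
    calc _ ≤ 12 * π / (t * √r) * (1 / √x) * (t / vW x ^ 3) := by
          rw [show 12 * π / (t * √r) * (1 / √x) * (t / vW x ^ 3) = 12 * π / (√r * √x * vW x ^ 3) by field_simp]
          rw [div_le_div_iff₀ (by positivity) (by positivity)]
          have h1 := vW_le_two h0.le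
          have h2 : √x * √x = x := Real.mul_self_sqrt h0.le
          have : 0 ≤ π * √r * vW x ^ 3 := by positivity
          calc _ = 6 * (π * √r * vW x ^ 3) * (√x * √x) := by ring
            _ ≤ 6 * (π * √r * vW x ^ 3) * (2 * vW x) := by rw [h2]; gcongr
            _ = _ := by ring
      _ ≤ _ := by gcongr; exact hp x
  · intro x hx
    have h0 := hx0 x hx
    have hv := vW_pos x
    unfold psi2
    rw [abs_mul, abs_div, abs_neg, abs_of_pos ht, abs_of_pos h0, abs_of_pos (hp' x), abs_of_pos (by positivity)]
    calc _ ≤ 3 * (t / vW x ^ 3 / x) := by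
          rw [show 3 * (t / vW x ^ 3 / x) = t * (3 / (vW x ^ 3 * x)) by field_simp]
          refine mul_le_mul_of_nonneg_left ?_ ht.le
          rw [div_le_div_iff₀ (by positivity) (by positivity)]
          have h2 := vW_sq x
          calc _ = vW x ^ 3 * x ^ 2 := by ring
            _ ≤ vW x ^ 3 * (3 * vW x ^ 2) := by gcongr; linarith
            _ = _ := by ring
      _ ≤ _ := by gcongr; exact hp x
  · rw [sqrt_rpow hα.le]
    have hz0 := norm_nonneg z
    have hsα := Real.sqrt_pos.2 hα
    have h1 : 1 ≤ √α * √r := by rw [← Real.sqrt_mul hα.le]; exact Real.one_le_sqrt.2 hαr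
    rw [show |(-(1/2) : ℝ)| = 1/2 by norm_num [abs_of_neg]]
    calc _ = 24 * π * (11 + 8 * ‖z‖) / t * (1 / (√α * √r)) := by field_simp; ring
      _ ≤ 24 * π * (11 + 8 * ‖z‖) / t * 1 := by
        gcongr; rw [div_le_one (by positivity)]; exact h1
      _ ≤ _ := by
        rw [mul_one]; gcongr ?_ / _
        nlinarith [pi_pos, mul_nonneg pi_pos.le hz0]

lemma osc_right {r t v0 ρ0 : ℝ} {z : ℂ} (hz : z.re = 1) {α β : ℝ} (hα : 0 < α) (hαβ : α ≤ β)
    (hr : 0 < r) (ht : 0 < t) (hαr : 1 ≤ α * r) (hv0 : 0 < v0) (hρ0 : 0 ≤ ρ0) (hv : v0 ^ 2 = 1 + ρ0 ^ 2 / 3)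
    (hrt : t ≤ r * v0 ^ 3) (hαρ : 2 * ρ0 ≤ α) (hfin : t ≤ (r * √r) * (α * √α) * vW α ^ 2) :
    ‖∫ x in α..β, FA (-1) r z x * Complex.exp (Complex.I * psi (-1) r t x)‖ ≤
      12288 * π * (1 + ‖z‖) / t := by
  have hx0 : ∀ x ∈ Set.Icc α β, 0 < x := fun x hx => hα.trans_le hx.1
  have hvx : ∀ x ∈ Set.Icc α β, v0 ≤ vW x := by
    intro x hx
    have := vW_sq x
    have h1 := vW_pos x
    refine (sq_le_sq₀ (by positivity) (by positivity)).1 ?_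
    rw [this, hv]
    have := hx.1
    nlinarith
  have hp : ∀ x ∈ Set.Icc α β, r * x ^ 2 / (4 * vW x ^ 2) ≤ - psi1 (-1) r t x := by
    intro x hx
    have h1 := hvx x hx
    have h2 := vW_pos x
    have h3 := hx.1
    have h5 := vW_sq x
    unfold psi1
    have : t * (1 / vW x ^ 3) ≤ r * v0 ^ 2 / vW x ^ 2 := by
      rw [mul_one_div, div_le_div_iff₀ (by positivity) (by positivity)]
      calc t * vW x ^ 2 ≤ (r * v0 ^ 3) * vW x ^ 2 := by gcongr
        _ = r * v0 ^ 2 * (v0 * vW x ^ 2) := by ring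
        _ ≤ r * v0 ^ 2 * (vW x * vW x ^ 2) := by gcongr
        _ = _ := by ring
    have h4 : r * x ^ 2 / (4 * vW x ^ 2) ≤ r - r * v0 ^ 2 / vW x ^ 2 := by
      rw [show r - r * v0 ^ 2 / vW x ^ 2 = r * (4 * (vW x ^ 2 - v0 ^ 2)) / (4 * vW x ^ 2) by field_simp]
      gcongr
      rw [h5, hv]
      nlinarith
    linarith
  have hp' : ∀ x ∈ Set.Icc α β, psi1 (-1) r t x < 0 := by
    intro x hx
    have := hp x hx
    have h1 := vW_pos x
    have h2 := hx0 x hx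
    have : 0 < r * x ^ 2 / (4 * vW x ^ 2) := by positivity
    linarith
  have hsr := Real.sqrt_pos.2 hr
  have hvα := vW_pos α
  refine (osc_FA (by norm_num) hz hα hαβ hr hαr (c := 24 * π / (r * √r * vW α ^ 2)) (k := -(3/2)) (M' := 4) (by norm_num)
    (by positivity) (by norm_num) (fun x hx => (hp' x hx).ne) ?_ ?_).trans ?_
  · intro x hx
    have h0 := hx0 x hx
    have hv := vW_pos x
    have hsx := Real.sqrt_pos.2 h0
    rw [Q_form h0 hr, rpow_m32 h0, abs_of_neg (hp' x hx)]
    calc _ ≤ 24 * π / (r * √r * vW α ^ 2) * (1 / (x * √x)) * (r * x ^ 2 / (4 * vW x ^ 2)) := by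
          rw [show 24 * π / (r * √r * vW α ^ 2) * (1 / (x * √x)) * (r * x ^ 2 / (4 * vW x ^ 2)) = 6 * π * x / (√r * √x * vW x ^ 2 * vW α ^ 2) by field_simp; ring]
          rw [div_le_div_iff₀ (by positivity) (by positivity)]
          have h1 : vW α ≤ vW x := vW_mono hα.le hx.1
          have h2 : √x * √x = x := Real.mul_self_sqrt h0.le
          calc _ = 6 * π * √r * vW x ^ 2 * vW α ^ 2 * (√x * √x) := by ring
            _ ≤ 6 * π * √r * vW x ^ 2 * vW x ^ 2 * x := by rw [h2]; gcongr
            _ = _ := by ring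
      _ ≤ _ := by gcongr; exact hp x hx
  · intro x hx
    have h0 := hx0 x hx
    have hv := vW_pos x
    have h1 := hvx x hx
    unfold psi2
    rw [abs_mul, abs_div, abs_neg, abs_of_pos ht, abs_of_pos h0, abs_of_neg (hp' x hx), abs_of_pos (by positivity)]
    calc _ ≤ 4 * (r * x ^ 2 / (4 * vW x ^ 2) / x) := by
          rw [show 4 * (r * x ^ 2 / (4 * vW x ^ 2) / x) = r * x / vW x ^ 2 by field_simp, mul_div_assoc', div_le_div_iff₀ (by positivity) (by positivity)]
          calc t * x * vW x ^ 2 ≤ (r * v0 ^ 3) * x * vW x ^ 2 := by gcongr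
            _ ≤ (r * vW x ^ 3) * x * vW x ^ 2 := by gcongr
            _ = _ := by ring
      _ ≤ _ := by gcongr; exact hp x hx
  · rw [rpow_m32 hα]
    have hz0 := norm_nonneg z
    have hsα := Real.sqrt_pos.2 hα
    rw [show |(-(3/2) : ℝ)| = 3/2 by norm_num [abs_of_neg]]
    calc _ = 16 * π * (15 + 8 * ‖z‖) * (1 / ((r * √r) * (α * √α) * vW α ^ 2)) := by field_simp; ring
      _ ≤ 16 * π * (15 + 8 * ‖z‖) * (1 / t) := by gcongr
      _ ≤ _ := by
        rw [mul_one_div]; gcongr ?_ / _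
        nlinarith [pi_pos, mul_nonneg pi_pos.le hz0]

lemma left_psi {r t v0 ρ0 : ℝ} {β : ℝ}
    (ht : 0 < t) (hv0 : 0 < v0) (hρ0 : 0 < ρ0) (hv : v0 ^ 2 = 1 + ρ0 ^ 2 / 3)
    (hrt : t = r * v0 ^ 3) (hβρ : β ≤ ρ0 / 2) (x : ℝ) (hx0 : 0 < x) (hx : x ≤ β) :
    t / vW x ^ 3 * (ρ0 ^ 2 / (4 * v0 ^ 2)) ≤ psi1 (-1) r t x ∧ |psi2 t x| ≤ 4 * (|psi1 (-1) r t x| / x) := by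
  have h2 := vW_pos x
  have h5 := vW_sq x
  have h6 : x ^ 2 ≤ ρ0 ^ 2 / 4 := by nlinarith
  have h1 : vW x ≤ v0 := by
    refine (sq_le_sq₀ (by positivity) (by positivity)).1 ?_
    rw [h5, hv]; nlinarith
  have A : t / vW x ^ 3 * (ρ0 ^ 2 / (4 * v0 ^ 2)) ≤ psi1 (-1) r t x := by
    unfold psi1
    have hr : r = t / v0 ^ 3 := by rw [hrt]; field_simp
    have : t / vW x ^ 3 * (ρ0 ^ 2 / (4 * v0 ^ 2)) ≤ t / vW x ^ 3 * (1 - vW x ^ 3 / v0 ^ 3) := by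
      gcongr
      have : vW x ^ 3 / v0 ^ 3 ≤ vW x ^ 2 / v0 ^ 2 := by
        rw [div_le_div_iff₀ (by positivity) (by positivity)]
        calc _ = vW x ^ 2 * v0 ^ 2 * vW x := by ring
          _ ≤ vW x ^ 2 * v0 ^ 2 * v0 := by gcongr
          _ = _ := by ring
      have : ρ0 ^ 2 / (4 * v0 ^ 2) ≤ 1 - vW x ^ 2 / v0 ^ 2 := by
        rw [show 1 - vW x ^ 2 / v0 ^ 2 = (4 * (v0 ^ 2 - vW x ^ 2)) / (4 * v0 ^ 2) by field_simp]
        gcongr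
        rw [h5, hv]; linarith
      linarith
    have e : t / vW x ^ 3 * (1 - vW x ^ 3 / v0 ^ 3) = t * (1 / vW x ^ 3) + -1 * r := by
      rw [hr]; field_simp; ring
    linarith
  refine ⟨A, ?_⟩
  have A0 : 0 < psi1 (-1) r t x := lt_of_lt_of_le (by positivity) A
  unfold psi2
  rw [abs_mul, abs_div, abs_neg, abs_of_pos ht, abs_of_pos hx0, abs_of_pos A0, abs_of_pos (by positivity)]
  calc _ ≤ 4 * (t / vW x ^ 3 * (ρ0 ^ 2 / (4 * v0 ^ 2)) / x) := by
          rw [show 4 * (t / vW x ^ 3 * (ρ0 ^ 2 / (4 * v0 ^ 2)) / x) = t * (ρ0 ^ 2 / (vW x ^ 3 * v0 ^ 2 * x)) by field_simp]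
          refine mul_le_mul_of_nonneg_left ?_ ht.le
          rw [div_le_div_iff₀ (by positivity) (by positivity)]
          have : x ^ 2 * v0 ^ 2 ≤ ρ0 ^ 2 * vW x ^ 2 := by
            rw [h5, hv]; nlinarith
          calc _ = vW x ^ 3 * (x ^ 2 * v0 ^ 2) := by ring
            _ ≤ vW x ^ 3 * (ρ0 ^ 2 * vW x ^ 2) := by gcongr
            _ = _ := by ring
    _ ≤ _ := by gcongr

lemma osc_left {r t v0 ρ0 : ℝ} {z : ℂ} (hz : z.re = 1) {α β : ℝ} (hα : 0 < α) (hαβ : α ≤ β)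
    (hr : 0 < r) (ht : 0 < t) (hαr : 1 ≤ α * r) (hv0 : 0 < v0) (hρ0 : 0 < ρ0) (hv : v0 ^ 2 = 1 + ρ0 ^ 2 / 3)
    (hrt : t = r * v0 ^ 3) (hβρ : β ≤ ρ0 / 2) (hfin : 2 ≤ v0 ∨ (v0 ≤ 2 ∧ 1 ≤ r * α ^ 3)) :
    ‖∫ x in α..β, FA (-1) r z x * Complex.exp (Complex.I * psi (-1) r t x)‖ ≤
      12288 * π * (1 + ‖z‖) / t := by
  have hx0 : ∀ x ∈ Set.Icc α β, 0 < x := fun x hx => hα.trans_le hx.1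
  have hl := fun x (hx : x ∈ Set.Icc α β) => left_psi (r := r) ht hv0 hρ0 hv hrt hβρ x (hx0 x hx) hx.2
  have hp' : ∀ x ∈ Set.Icc α β, 0 < psi1 (-1) r t x := fun x hx =>
    lt_of_lt_of_le (by have := vW_pos x; positivity) (hl x hx).1
  have hsr := Real.sqrt_pos.2 hr
  have hsα := Real.sqrt_pos.2 hα
  have hz0 := norm_nonneg z
  rcases hfin with hf | ⟨hf, hf2⟩
  · refine (osc_FA (by norm_num) hz hα hαβ hr hαr (c := 24 * π / (t * √r)) (k := -(1/2)) (M' := 4) (by norm_num)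
      (by positivity) (by norm_num) (fun x hx => (hp' x hx).ne') ?_ (fun x hx => (hl x hx).2)).trans ?_
    · intro x hx
      have h0 := hx0 x hx
      have hvx := vW_pos x
      have hsx := Real.sqrt_pos.2 h0
      rw [Q_form h0 hr, sqrt_rpow h0.le, abs_of_pos (hp' x hx)]
      calc _ ≤ 24 * π / (t * √r) * (1 / √x) * (t / vW x ^ 3 * (1 / 2)) := by
            rw [show 24 * π / (t * √r) * (1 / √x) * (t / vW x ^ 3 * (1 / 2)) = 12 * π / (√r * √x * vW x ^ 3) by field_simp; ring]
            rw [div_le_div_iff₀ (by positivity) (by positivity)]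
            have h1 := vW_le_two h0.le
            have h2 : √x * √x = x := Real.mul_self_sqrt h0.le
            calc _ = 6 * (π * √r * vW x ^ 3) * (√x * √x) := by ring
              _ ≤ 6 * (π * √r * vW x ^ 3) * (2 * vW x) := by rw [h2]; gcongr
              _ = _ := by ring
        _ ≤ 24 * π / (t * √r) * (1 / √x) * (t / vW x ^ 3 * (ρ0 ^ 2 / (4 * v0 ^ 2))) := by
            have : 1 / 2 ≤ ρ0 ^ 2 / (4 * v0 ^ 2) := by
              rw [div_le_div_iff₀ (by positivity) (by positivity)]
              nlinarith
            gcongr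
        _ ≤ _ := by gcongr; exact (hl x hx).1
    · rw [sqrt_rpow hα.le]
      have h1 : 1 ≤ √α * √r := by rw [← Real.sqrt_mul hα.le]; exact Real.one_le_sqrt.2 hαr
      rw [show |(-(1/2) : ℝ)| = 1/2 by norm_num [abs_of_neg]]
      calc _ = 48 * π * (13 + 8 * ‖z‖) / t * (1 / (√α * √r)) := by field_simp; ring
        _ ≤ 48 * π * (13 + 8 * ‖z‖) / t * 1 := by
          gcongr; rw [div_le_one (by positivity)]; exact h1
        _ ≤ _ := by
          rw [mul_one]; gcongr ?_ / _
          nlinarith [pi_pos, mul_nonneg pi_pos.le hz0]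
  · refine (osc_FA (by norm_num) hz hα hαβ hr hαr (c := 24 * π / (t * √r)) (k := -(3/2)) (M' := 4) (by norm_num)
      (by positivity) (by norm_num) (fun x hx => (hp' x hx).ne') ?_ (fun x hx => (hl x hx).2)).trans ?_
    · intro x hx
      have h0 := hx0 x hx
      have hvx := vW_pos x
      have hvx1 := vW_ge_one x
      have hsx := Real.sqrt_pos.2 h0
      rw [Q_form h0 hr, rpow_m32 h0, abs_of_pos (hp' x hx)]
      calc _ ≤ 24 * π / (t * √r) * (1 / (x * √x)) * (t / vW x ^ 3 * (ρ0 ^ 2 / (4 * v0 ^ 2))) := by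
            rw [show 24 * π / (t * √r) * (1 / (x * √x)) * (t / vW x ^ 3 * (ρ0 ^ 2 / (4 * v0 ^ 2))) = 6 * π * ρ0 ^ 2 / (√r * (x * √x) * vW x ^ 3 * v0 ^ 2) by field_simp; ring]
            rw [div_le_div_iff₀ (by positivity) (by positivity)]
            have h2 : √x * √x = x := Real.mul_self_sqrt h0.le
            have h3 : x ^ 2 ≤ ρ0 ^ 2 / 4 := by have := hx.2; nlinarith
            have h4 : v0 ^ 2 ≤ 4 := by nlinarith
            calc _ = 6 * π * √r * vW x ^ 3 * x * v0 ^ 2 * (√x * √x) := by ring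
              _ = 6 * π * √r * vW x ^ 3 * v0 ^ 2 * x ^ 2 := by rw [h2]; ring
              _ ≤ 6 * π * √r * vW x ^ 3 * 4 * (ρ0 ^ 2 / 4) := by gcongr
              _ = 6 * π * √r * ρ0 ^ 2 * vW x ^ 3 * 1 := by ring
              _ ≤ 6 * π * √r * ρ0 ^ 2 * vW x ^ 3 * vW x := by gcongr
              _ = _ := by ring
        _ ≤ _ := by gcongr; exact (hl x hx).1
    · rw [rpow_m32 hα]
      have h1 : 1 ≤ √r * (α * √α) := by
        refine (sq_le_sq₀ (by positivity) (by positivity)).1 ?_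
        rw [mul_pow, mul_pow, Real.sq_sqrt hr.le, Real.sq_sqrt hα.le]; linarith
      rw [show |(-(3/2) : ℝ)| = 3/2 by norm_num [abs_of_neg]]
      calc _ = 16 * π * (15 + 8 * ‖z‖) / t * (1 / (√r * (α * √α))) := by field_simp; ring
        _ ≤ 16 * π * (15 + 8 * ‖z‖) / t * 1 := by
          gcongr; rw [div_le_one (by positivity)]; exact h1
        _ ≤ _ := by
          rw [mul_one]; gcongr ?_ / _
          nlinarith [pi_pos, mul_nonneg pi_pos.le hz0]

open MeasureTheory Real Complex
open scoped ENNReal InnerProductSpace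

lemma mid_psi {r t v0 ρ0 : ℝ} (ht : 0 < t) (hv0 : 0 < v0) (hρ0 : 0 < ρ0) (hv : v0 ^ 2 = 1 + ρ0 ^ 2 / 3)
    (hrt : t = r * v0 ^ 3) (x : ℝ) (hx1 : ρ0 / 2 ≤ x) (hx2 : x ≤ 2 * ρ0) :
    t * ρ0 / (8 * v0 ^ 5) * |x - ρ0| ≤ |psi1 (-1) r t x| := by
  have h2 := vW_pos x
  have h5 := vW_sq x
  have h1 : vW x ≤ 2 * v0 := by
    refine (sq_le_sq₀ (by positivity) (by positivity)).1 ?_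
    rw [h5, mul_pow, hv]; nlinarith
  have hr : r = t / v0 ^ 3 := by rw [hrt]; field_simp
  have e : psi1 (-1) r t x * (3 * (v0 + vW x) * vW x ^ 3 * v0 ^ 3)
      = -(t * (x - ρ0) * (x + ρ0) * (v0 ^ 2 + v0 * vW x + vW x ^ 2)) := by
    unfold psi1
    have : (v0 - vW x) * (3 * (v0 + vW x)) = -((x - ρ0) * (x + ρ0)) := by
      have : (v0 - vW x) * (3 * (v0 + vW x)) = 3 * (v0 ^ 2 - vW x ^ 2) := by ring
      rw [this, hv, h5]; ring
    rw [hr]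
    field_simp
    linear_combination (v0 ^ 2 + v0 * vW x + vW x ^ 2) * this
  have e2 : |psi1 (-1) r t x| * (3 * (v0 + vW x) * vW x ^ 3 * v0 ^ 3)
      = t * |x - ρ0| * (x + ρ0) * (v0 ^ 2 + v0 * vW x + vW x ^ 2) := by
    have := congrArg abs e
    have hxp : 0 < x + ρ0 := by linarith
    have hq : 0 < v0 ^ 2 + v0 * vW x + vW x ^ 2 := by positivity
    have hw : 0 < 3 * (v0 + vW x) * vW x ^ 3 * v0 ^ 3 := by positivity
    rw [abs_neg, abs_mul (psi1 (-1) r t x), abs_of_pos hw, abs_mul (t * (x - ρ0) * (x + ρ0)), abs_of_pos hq,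
      abs_mul (t * (x - ρ0)), abs_of_pos hxp, abs_mul t, abs_of_pos ht] at this
    exact this
  have hpos : 0 < 3 * (v0 + vW x) * vW x ^ 3 * v0 ^ 3 := by positivity
  refine le_of_mul_le_mul_right ?_ hpos
  rw [e2]
  have h7 : (v0 + vW x) * vW x ≤ v0 ^ 2 + v0 * vW x + vW x ^ 2 := by nlinarith
  have h8 : 3 / 2 * ρ0 ≤ x + ρ0 := by linarith
  calc _ = t * |x - ρ0| * (3 / 2 * ρ0) * ((v0 + vW x) * vW x) * (vW x ^ 2 / (4 * v0 ^ 2)) := by field_simp; ring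
    _ ≤ t * |x - ρ0| * (x + ρ0) * (v0 ^ 2 + v0 * vW x + vW x ^ 2) * 1 := by
      have hxp : 0 < x + ρ0 := by linarith
      have h9 : vW x ^ 2 / (4 * v0 ^ 2) ≤ 1 := by
        rw [div_le_one (by positivity)]; nlinarith
      gcongr
    _ = _ := by ring

lemma osc_mid' {r t v0 ρ0 : ℝ} {z : ℂ} (hz : z.re = 1) {α β : ℝ} (hα : 0 < α) (hαβ : α ≤ β)
    (hr : 0 < r) (ht : 0 < t) (hαr : 1 ≤ α * r) (hv0 : 0 < v0) (hρ0 : 0 < ρ0) (hv : v0 ^ 2 = 1 + ρ0 ^ 2 / 3)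
    (hrt : t = r * v0 ^ 3) (hα1 : ρ0 / 2 ≤ α) (hβρ : β ≤ 2 * ρ0) :
    ‖∫ x in α..β, FA (-1) r z x * Complex.exp (Complex.I * psi (-1) r t x)‖ ≤
      12288 * π * (1 + ‖z‖) / t := by
  have hx0 : ∀ x ∈ Set.Icc α β, 0 < x := fun x hx => hα.trans_le hx.1
  have hxr : ∀ x ∈ Set.Icc α β, 1 ≤ x * r := fun x hx => hαr.trans (by have := hx.1; gcongr)
  have hsr := Real.sqrt_pos.2 hr
  have hz0 := norm_nonneg z
  set MF : ℝ := 6 * π * √(2 * ρ0) * 16 / (√r * v0 ^ 4) with hMF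
  set lam : ℝ := t * ρ0 / (8 * v0 ^ 5) with hlam
  have hlam0 : 0 < lam := by positivity
  have hMF0 : 0 ≤ MF := by positivity
  have hQ : ∀ x ∈ Set.Icc α β, 6 * π * (x / (vW x ^ 4 * √(x * r))) ≤ MF := by
    intro x hx
    have hvx := vW_pos x
    rw [Q_form (hx0 x hx) hr, hMF, div_le_div_iff₀ (by positivity) (by positivity)]
    have h1 : √x ≤ √(2 * ρ0) := Real.sqrt_le_sqrt (hx.2.trans hβρ)
    have h2 : v0 ≤ 2 * vW x := by
      refine (sq_le_sq₀ (by positivity) (by positivity)).1 ?_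
      have := hx.1
      rw [mul_pow, vW_sq, hv]; nlinarith
    calc _ ≤ 6 * π * √(2 * ρ0) * (√r * (2 * vW x) ^ 4) := by gcongr
      _ = _ := by ring
  refine (osc_mid hαβ (fun x hx => FA_hasDeriv (by norm_num) z (by linarith [hxr x hx]))
    (fun x _ => psi_hasDeriv (-1) r t x) (fun x _ => psi1_hasDeriv (-1) r t x)
    (FA'_continuousOn (-1) r z (fun x hx => by linarith [hxr x hx])) (psi2_continuous t).continuousOn
    hlam0 hMF0 (x0 := ρ0) (D := (2 + 4 * ‖z‖) * (MF / (ρ0 / 2)))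
    (fun x hx => mid_psi ht hv0 hρ0 hv hrt x (hα1.trans hx.1) (hx.2.trans hβρ)) ?_
    (fun x hx => (FA_norm_le (by norm_num) hz (hx0 x hx) (hxr x hx)).trans (hQ x hx))
    (fun x hx => (FA'_norm_le (by norm_num) hz (hx0 x hx) (hxr x hx)).trans ?_)).trans ?_
  · intro x hx
    have := hx0 x hx
    have := vW_pos x
    unfold psi2
    rw [neg_div, mul_neg]
    have : 0 ≤ t * (x / vW x ^ 5) := by positivity
    linarith
  · have h1 := hx0 x hx
    have h2 := hα1.trans hx.1
    have h3 := hQ x hx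
    refine mul_le_mul_of_nonneg_left ?_ (by positivity)
    exact div_le_div₀ hMF0 h3 (by positivity) h2
  · have key : MF = √lam * (384 * π / t) := by
      have h1 : MF ^ 2 = (√lam * (384 * π / t)) ^ 2 := by
        rw [mul_pow, Real.sq_sqrt hlam0.le, hMF, hlam, div_pow, mul_pow, mul_pow, mul_pow, mul_pow, Real.sq_sqrt (by positivity), Real.sq_sqrt hr.le, hrt]
        field_simp
        ring
      exact (sq_eq_sq₀ hMF0 (by positivity)).1 h1
    have hsl := Real.sqrt_pos.2 hlam0
    rw [div_le_iff₀ hsl]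
    have hb : β - α ≤ 2 * ρ0 := by linarith
    calc _ ≤ 10 * MF + 2 * ((2 + 4 * ‖z‖) * (MF / (ρ0 / 2)) * (2 * ρ0)) := by gcongr
      _ = (26 + 32 * ‖z‖) * MF := by field_simp; ring
      _ ≤ (32 * (1 + ‖z‖)) * MF := by gcongr; linarith
      _ = _ := by rw [key]; ring

lemma split3 {G : ℝ → ℂ} (hG : Continuous G) {s0 B a b C : ℝ} (hsB : s0 ≤ B) (hab : a ≤ b) (hC : 0 ≤ C)
    (hL : ∀ α β, s0 ≤ α → α ≤ β → β ≤ a → ‖∫ x in α..β, G x‖ ≤ C)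
    (hM : ∀ α β, s0 ≤ α → α ≤ β → a ≤ α → β ≤ b → ‖∫ x in α..β, G x‖ ≤ C)
    (hR : ∀ α β, s0 ≤ α → α ≤ β → b ≤ α → ‖∫ x in α..β, G x‖ ≤ C) :
    ‖∫ x in s0..B, G x‖ ≤ 3 * C := by
  have hi : ∀ a b, IntervalIntegrable G volume a b := fun a b => hG.intervalIntegrable a b
  set p1 := max s0 (min B a) with hp1
  set p2 := max s0 (min B b) with hp2
  have h1 : s0 ≤ p1 := le_max_left _ _
  have h12 : p1 ≤ p2 := max_le_max le_rfl (min_le_min le_rfl hab)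
  have h2B : p2 ≤ B := max_le hsB (min_le_left _ _)
  have e : ∫ x in s0..B, G x = (∫ x in s0..p1, G x) + (∫ x in p1..p2, G x) + ∫ x in p2..B, G x := by
    rw [intervalIntegral.integral_add_adjacent_intervals (hi _ _) (hi _ _),
      intervalIntegral.integral_add_adjacent_intervals (hi _ _) (hi _ _)]
  have A : ‖∫ x in s0..p1, G x‖ ≤ C := by
    rcases le_or_gt p1 a with h | h
    · exact hL _ _ le_rfl h1 h
    · have : p1 = s0 := by
        rw [hp1]; apply max_eq_left; by_contra hh
        push Not at hh
        rw [hp1, max_eq_right hh.le] at h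
        exact absurd (min_le_right B a) (not_le.2 h)
      rw [this]; simpa using hC
  have Bd : ‖∫ x in p1..p2, G x‖ ≤ C := by
    rcases le_or_gt a p1 with h | h
    · rcases le_or_gt p2 b with h' | h'
      · exact hM _ _ h1 h12 h h'
      · have : p2 = s0 := by
          rw [hp2]; apply max_eq_left; by_contra hh
          push Not at hh
          rw [hp2, max_eq_right hh.le] at h'
          exact absurd (min_le_right B b) (not_le.2 h')
        have : p1 = p2 := le_antisymm h12 (this.le.trans h1)
        rw [this]; simpa using hC
    · have hB : B ≤ p1 := by
        have h3 : min B a ≤ p1 := le_max_right _ _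
        rcases min_le_iff.1 h3 with h4 | h4
        · exact h4
        · linarith
      have : p1 = p2 := le_antisymm h12 (h2B.trans hB)
      rw [this]; simpa using hC
  have Cd : ‖∫ x in p2..B, G x‖ ≤ C := by
    rcases le_or_gt b p2 with h | h
    · exact hR _ _ (h1.trans h12) h2B h
    · have hB : B ≤ p2 := by
        have h3 : min B b ≤ p2 := le_max_right _ _
        rcases min_le_iff.1 h3 with h4 | h4
        · exact h4
        · linarith
      have : p2 = B := le_antisymm h2B hB
      rw [this]; simpa using hC
  rw [e]
  refine (norm_add₃_le).trans ?_
  linarith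

lemma psi_continuous (η r t : ℝ) : Continuous (psi η r t) :=
  continuous_iff_continuousAt.2 fun s => (psi_hasDeriv η r t s).continuousAt
lemma FA_continuous (η r : ℝ) (z : ℂ) : Continuous (FA η r z) := by
  have h2 := amp_continuous η
  have h3 := cW_continuous (-(2 * z))
  unfold FA; fun_prop
lemma osc_integrand_continuous (η r t : ℝ) (z : ℂ) :
    Continuous (fun x : ℝ => FA η r z x * Complex.exp (Complex.I * psi η r t x)) := by
  have h2 := psi_continuous η r t
  have h3 := FA_continuous η r z
  fun_prop

lemma osc_minus {r t s0 B : ℝ} {z : ℂ} (hz : z.re = 1) (hs0 : 0 < s0) (hsB : s0 ≤ B)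
    (hr : 0 < r) (ht : 0 < t) (hsr : 1 ≤ s0 * r)
    (hcase : (t ≤ 8 * r ∧ s0 ^ 3 * t = 512) ∨ 8 * r < t) :
    ‖∫ x in s0..B, FA (-1) r z x * Complex.exp (Complex.I * psi (-1) r t x)‖ ≤
      3 * (12288 * π * (1 + ‖z‖) / t) := by
  have hC : 0 ≤ 12288 * π * (1 + ‖z‖) / t := by positivity
  have ar : ∀ α, s0 ≤ α → 1 ≤ α * r := fun α h => hsr.trans (by gcongr)
  have caseI : ∀ α, s0 ≤ α → (t ≤ 8 * r ∧ s0 ^ 3 * t = 512) → t ≤ (r * √r) * (α * √α) * vW α ^ 2 := by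
    rintro α hα ⟨h1, h2⟩
    have hα0 : 0 < α := hs0.trans_le hα
    have h4 : 1 ≤ vW α ^ 2 := by have := vW_ge_one α; nlinarith
    have h3 : t ≤ (r * √r) * (α * √α) := by
      refine (sq_le_sq₀ (by positivity) (by positivity)).1 ?_
      rw [mul_pow, mul_pow, mul_pow, Real.sq_sqrt hr.le, Real.sq_sqrt hα0.le]
      have h5 : t / 8 ≤ r := by linarith
      calc t ^ 2 = (t / 8) ^ 3 * (512 / t) := by field_simp; norm_num
        _ = (t / 8) ^ 3 * s0 ^ 3 := by rw [← h2]; field_simp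
        _ ≤ r ^ 3 * α ^ 3 := by gcongr
        _ = _ := by ring
    calc t ≤ (r * √r) * (α * √α) * 1 := by linarith
      _ ≤ _ := by gcongr
  rcases le_or_gt t r with htr | htr
  · have hI : t ≤ 8 * r ∧ s0 ^ 3 * t = 512 := by
      rcases hcase with h | h
      · exact h
      · linarith
    refine (osc_right hz hs0 hsB hr ht hsr one_pos (le_refl 0) (by norm_num) (by linarith) (by linarith) (caseI s0 le_rfl hI)).trans ?_
    linarith
  · set v0 : ℝ := (t / r) ^ (1/3 : ℝ) with hv0d
    have htr1 : 1 < t / r := by rw [one_lt_div hr]; exact htr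
    have hv03 : v0 ^ 3 = t / r := by
      rw [hv0d, ← Real.rpow_natCast, ← Real.rpow_mul (by positivity)]; norm_num
    have hrt : t = r * v0 ^ 3 := by rw [hv03]; field_simp
    have hv0 : 1 < v0 := Real.one_lt_rpow htr1 (by norm_num)
    set ρ0 : ℝ := √(3 * (v0 ^ 2 - 1)) with hρ0d
    have hρ0 : 0 < ρ0 := Real.sqrt_pos.2 (by nlinarith)
    have hv : v0 ^ 2 = 1 + ρ0 ^ 2 / 3 := by rw [hρ0d, Real.sq_sqrt (by nlinarith)]; ring
    apply split3 (osc_integrand_continuous (-1) r t z) hsB (a := ρ0 / 2) (b := 2 * ρ0) (by linarith) hC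
    · intro α β h1 h2 h3
      refine osc_left hz (hs0.trans_le h1) h2 hr ht (ar α h1) (by linarith) hρ0 hv hrt h3 ?_
      rcases hcase with ⟨h, h'⟩ | h
      · right
        constructor
        · have : v0 ^ 3 ≤ 2 ^ 3 := by rw [hv03, div_le_iff₀ hr]; linarith
          exact le_of_pow_le_pow_left₀ (by norm_num) (by norm_num) this
        · have h5 : t / 8 ≤ r := by linarith
          calc (1:ℝ) ≤ (t / 8) * (512 / t) := by field_simp; norm_num
            _ = (t / 8) * s0 ^ 3 := by rw [← h']; field_simp
            _ ≤ _ := by gcongr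
      · left
        have : 2 ^ 3 ≤ v0 ^ 3 := by rw [hv03, le_div_iff₀ hr]; linarith
        exact le_of_pow_le_pow_left₀ (by norm_num) (by linarith) this
    · intro α β h1 h2 h3 h4
      exact osc_mid' hz (hs0.trans_le h1) h2 hr ht (ar α h1) (by linarith) hρ0 hv hrt h3 h4
    · intro α β h1 h2 h3
      have hα0 := hs0.trans_le h1
      refine osc_right hz hα0 h2 hr ht (ar α h1) (by linarith) hρ0.le hv hrt.le h3 ?_
      rcases hcase with h | h
      · exact caseI α h1 h
      · have h4 : 2 ≤ v0 := by
          have : 2 ^ 3 ≤ v0 ^ 3 := by rw [hv03, le_div_iff₀ hr]; linarith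
          exact le_of_pow_le_pow_left₀ (by norm_num) (by linarith) this
        have h5 : v0 ≤ vW α := by
          have := vW_pos α
          refine (sq_le_sq₀ (by positivity) (by positivity)).1 ?_
          rw [vW_sq, hv]; nlinarith
        have h6 : v0 ≤ α := by
          refine (sq_le_sq₀ (by positivity) (by positivity)).1 ?_
          nlinarith
        have h7 : 1 ≤ √r * √α := by
          rw [← Real.sqrt_mul hr.le]; exact Real.one_le_sqrt.2 (by rw [mul_comm]; exact ar α h1)
        rw [hrt]
        calc r * v0 ^ 3 = r * 1 * v0 * v0 ^ 2 := by ring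
          _ ≤ r * (√r * √α) * α * vW α ^ 2 := by gcongr
          _ = _ := by ring

open MeasureTheory Real Complex
open scoped ENNReal InnerProductSpace

lemma psi1_zero (t x : ℝ) : psi1 1 0 t x = t / vW x ^ 3 := by unfold psi1; ring
lemma psi_zero (t x : ℝ) : psi 1 0 t x = t * wW x := by unfold psi; ring

/-- the radial integrand -/
noncomputable def kI (r t : ℝ) (z : ℂ) (ρ : ℝ) : ℂ :=
  (ρ : ℂ) * cW (-(2 * z)) ρ * (bA (ρ * r) : ℂ) * Complex.exp (Complex.I * ((t * wW ρ : ℝ) : ℂ))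

lemma wW_continuous : Continuous wW :=
  continuous_iff_continuousAt.2 fun s => (wW_hasDeriv s).continuousAt

lemma norm_expI (x : ℝ) : ‖Complex.exp (Complex.I * (x : ℂ))‖ = 1 := by
  rw [mul_comm]; exact Complex.norm_exp_ofReal_mul_I x

lemma kI_continuous (r t : ℝ) (z : ℂ) : Continuous (kI r t z) := by
  have h1 := bA_continuous
  have h2 := cW_continuous (-(2 * z))
  have h3 := wW_continuous
  unfold kI; fun_prop

lemma kI_eq (r t : ℝ) (z : ℂ) (ρ : ℝ) : kI r t z ρ =
    FA 1 r z ρ * Complex.exp (Complex.I * psi 1 r t ρ) + FA (-1) r z ρ * Complex.exp (Complex.I * psi (-1) r t ρ) := by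
  unfold kI FA psi
  rw [bA_eq_amp]
  have e1 : Complex.exp (Complex.I * ((t * wW ρ + 1 * r * ρ : ℝ) : ℂ)) =
      Complex.exp (Complex.I * ((t * wW ρ : ℝ) : ℂ)) * Complex.exp (Complex.I * ((ρ * r : ℝ) : ℂ)) := by
    rw [← Complex.exp_add]; push_cast; ring_nf
  have e2 : Complex.exp (Complex.I * ((t * wW ρ + -1 * r * ρ : ℝ) : ℂ)) =
      Complex.exp (Complex.I * ((t * wW ρ : ℝ) : ℂ)) * Complex.exp (-Complex.I * ((ρ * r : ℝ) : ℂ)) := by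
    rw [← Complex.exp_add]; push_cast; ring_nf
  rw [e1, e2]; ring

lemma kI_norm_le {r t : ℝ} {z : ℂ} (hz : z.re = 1) {ρ : ℝ} (hρ : 0 ≤ ρ) : ‖kI r t z ρ‖ ≤ 2 * π * (ρ / vW ρ ^ 4) := by
  unfold kI
  have hv := vW_pos ρ
  rw [norm_mul, norm_mul, norm_mul, norm_expI, cW_norm_neg_nat _ ρ 4 (by simp [hz]; norm_num), Complex.norm_real, Complex.norm_real,
    Real.norm_eq_abs, Real.norm_eq_abs, abs_of_nonneg hρ]
  have := bA_abs_le (ρ * r)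
  calc _ ≤ ρ * (1 / vW ρ ^ 4) * (2 * π) * 1 := by gcongr
    _ = _ := by ring

lemma tail_hasDeriv (ρ : ℝ) : HasDerivAt (fun ρ => -(3/2) * (1 / vW ρ ^ 2)) (ρ / vW ρ ^ 4) ρ := by
  have h2 := (vW_pos ρ).ne'
  have := ((hasDerivAt_const ρ (1:ℝ)).div ((vW_hasDeriv ρ).pow 2) (pow_ne_zero _ h2)).const_mul (-(3/2))
  refine HasDerivAt.congr_deriv this ?_
  simp only [Pi.pow_apply]
  field_simp
  norm_num

lemma tail_tendsto : Filter.Tendsto (fun ρ => -(3/2) * (1 / vW ρ ^ 2)) Filter.atTop (nhds 0) := by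
  have h1 : Filter.Tendsto (fun ρ : ℝ => vW ρ ^ 2) Filter.atTop Filter.atTop := by
    have : Filter.Tendsto (fun ρ : ℝ => 1 + ρ ^ 2 / 3) Filter.atTop Filter.atTop := by
      apply Filter.tendsto_atTop_add_const_left
      exact (Filter.tendsto_pow_atTop (by norm_num)).atTop_div_const (by norm_num)
    simpa only [vW_sq] using this
  have := (tendsto_inv_atTop_zero.comp h1).const_mul (-(3/2) : ℝ)
  simpa [Function.comp_def] using this

lemma tail_integrable {B : ℝ} (hB : 0 ≤ B) : IntegrableOn (fun ρ => ρ / vW ρ ^ 4) (Set.Ioi B) :=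
  integrableOn_Ioi_deriv_of_nonneg' (fun x _ => tail_hasDeriv x)
    (fun x hx => div_nonneg (hB.trans (le_of_lt hx)) (by have := vW_pos x; positivity)) tail_tendsto

lemma tail_integral {B : ℝ} (hB : 0 ≤ B) : ∫ ρ in Set.Ioi B, ρ / vW ρ ^ 4 = 3 / 2 * (1 / vW B ^ 2) := by
  rw [integral_Ioi_of_hasDerivAt_of_nonneg' (fun x _ => tail_hasDeriv x)
    (fun x hx => div_nonneg (hB.trans (le_of_lt hx)) (by have := vW_pos x; positivity)) tail_tendsto]
  ring

lemma kI_integrable (r t : ℝ) {z : ℂ} (hz : z.re = 1) {B : ℝ} (hB : 0 ≤ B) : IntegrableOn (kI r t z) (Set.Ioi B) := by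
  refine Integrable.mono' ((tail_integrable hB).const_mul (2 * π)) (kI_continuous r t z).aestronglyMeasurable ?_
  filter_upwards [ae_restrict_mem measurableSet_Ioi] with x hx
  exact kI_norm_le hz (hB.trans (le_of_lt hx))

lemma kI_tail (r t : ℝ) {z : ℂ} (hz : z.re = 1) {B : ℝ} (hB : 0 ≤ B) :
    ‖∫ ρ in Set.Ioi B, kI r t z ρ‖ ≤ 3 * π / vW B ^ 2 := by
  refine (norm_integral_le_of_norm_le ((tail_integrable hB).const_mul (2 * π)) ?_).trans ?_
  · filter_upwards [ae_restrict_mem measurableSet_Ioi] with x hx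
    exact kI_norm_le hz (hB.trans (le_of_lt hx))
  · rw [integral_const_mul, tail_integral hB]
    apply le_of_eq; ring

lemma int_id_le {b K : ℝ} (hb : 0 ≤ b) {f : ℝ → ℝ} (hf : ∀ x ∈ Set.Icc 0 b, 0 ≤ f x) (hK : ∀ x ∈ Set.Icc 0 b, f x ≤ K * x) :
    ∫ x in (0:ℝ)..b, f x ≤ K * (b ^ 2 / 2) := by
  have e : ∫ x in (0:ℝ)..b, K * x = K * (b ^ 2 / 2) := by
    rw [intervalIntegral.integral_const_mul, integral_id]; ring
  rw [← e, intervalIntegral.integral_of_le hb, intervalIntegral.integral_of_le hb]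
  apply integral_mono_of_nonneg
  · filter_upwards [ae_restrict_mem measurableSet_Ioc] with x hx using hf x ⟨hx.1.le, hx.2⟩
  · exact (((continuous_const.mul continuous_id).intervalIntegrable 0 b).1)
  · filter_upwards [ae_restrict_mem measurableSet_Ioc] with x hx using hK x ⟨hx.1.le, hx.2⟩

lemma low_one {r t b : ℝ} {z : ℂ} (hz : z.re = 1) (hb : 0 ≤ b) (hr : 0 ≤ r) (ht : 0 < t) (hbr : b * r ≤ 1) :
    ‖∫ x in (0:ℝ)..b, ((x : ℂ) * cW (-(2 * z)) x * ((bA (x * r) - 2 * π : ℝ) : ℂ)) * Complex.exp (Complex.I * psi 1 0 t x)‖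
      ≤ 16 * π * (1 + ‖z‖) / t := by
  have hz0 := norm_nonneg z
  have hd : ∀ x : ℝ, HasDerivAt (fun x : ℝ => ((bA (x * r) - 2 * π : ℝ) : ℂ)) ((bA1 (x * r) * r : ℝ) : ℂ) x := by
    intro x
    have h2 : HasDerivAt (fun ρ : ℝ => ρ * r) r x := by simpa using (hasDerivAt_id x).mul_const r
    exact (((bA_hasDeriv (x * r)).comp x h2).sub_const (2 * π)).ofReal_comp
  have hA : ∀ x ∈ Set.Icc 0 b, ‖((bA (x * r) - 2 * π : ℝ) : ℂ)‖ ≤ 2 * π * (x * r) ^ 2 := by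
    intro x hx
    rw [Complex.norm_real, Real.norm_eq_abs]
    exact bA_sub_le (mul_nonneg hx.1 hr)
  have hF : ∀ x ∈ Set.Icc 0 b, ‖(x : ℂ) * cW (-(2 * z)) x * ((bA (x * r) - 2 * π : ℝ) : ℂ)‖ ≤ x * (1 / vW x ^ 4) * (2 * π * (x * r) ^ 2) := by
    intro x hx
    have hv := vW_pos x
    rw [norm_mul, norm_mul, cW_norm_neg_nat _ x 4 (by simp [hz]; norm_num), Complex.norm_real, Real.norm_eq_abs, abs_of_nonneg hx.1]
    have := hA x hx
    have h1 := hx.1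
    gcongr
  have hpp : ∀ x, 0 < psi1 1 0 t x := by intro x; rw [psi1_zero]; have := vW_pos x; positivity
  refine (osc_ibp hb (fun x _ => (rcW_hasDeriv z x).mul (hd x)) (fun x _ => psi_hasDeriv 1 0 t x)
    (fun x _ => psi1_hasDeriv 1 0 t x) ?_ (psi2_continuous t).continuousOn (fun x _ => (hpp x).ne')).trans ?_
  · have h1 := bA1_continuous
    have h2 := bA_continuous
    have h3 := cW_continuous (-(2 * z))
    have h4 := cW_continuous (-(2 * z) - 1)
    fun_prop
  · have B0 : ‖((0:ℝ) : ℂ) * cW (-(2 * z)) 0 * ((bA (0 * r) - 2 * π : ℝ) : ℂ)‖ / |psi1 1 0 t 0| = 0 := by simp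
    have B1 : ‖(b : ℂ) * cW (-(2 * z)) b * ((bA (b * r) - 2 * π : ℝ) : ℂ)‖ / |psi1 1 0 t b| ≤ 4 * π / t := by
      have hv := vW_pos b
      rw [abs_of_pos (hpp b), psi1_zero, div_le_iff₀ (by positivity)]
      refine (hF b ⟨hb, le_rfl⟩).trans ?_
      have h1 := vW_le_two hb
      calc _ ≤ (2 * vW b) * (1 / vW b ^ 4) * (2 * π * 1 ^ 2) := by gcongr
        _ = _ := by field_simp; ring
    have I1 : ∫ x in (0:ℝ)..b, (‖(cW (-(2 * z)) x + x * (-(2 * z) * cW (-(2 * z) - 1) x * (2 * x / 3 : ℝ))) * ((bA (x * r) - 2 * π : ℝ) : ℂ)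
          + (x : ℂ) * cW (-(2 * z)) x * ((bA1 (x * r) * r : ℝ) : ℂ)‖ / |psi1 1 0 t x|
        + ‖(x : ℂ) * cW (-(2 * z)) x * ((bA (x * r) - 2 * π : ℝ) : ℂ)‖ * |psi2 t x| / psi1 1 0 t x ^ 2) ≤
        ((24 + 16 * ‖z‖) * π * r ^ 2 / t) * (b ^ 2 / 2) := by
      apply int_id_le hb
      · intro x hx; positivity
      · intro x hx
        have hv := vW_pos x
        have h1 := hx.1
        have h2 := vW_le_two hx.1
        have a1 : ‖(cW (-(2 * z)) x + x * (-(2 * z) * cW (-(2 * z) - 1) x * (2 * x / 3 : ℝ))) * ((bA (x * r) - 2 * π : ℝ) : ℂ)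
          + (x : ℂ) * cW (-(2 * z)) x * ((bA1 (x * r) * r : ℝ) : ℂ)‖ / |psi1 1 0 t x| ≤ (8 + 16 * ‖z‖) * π * r ^ 2 / t * x := by
          rw [abs_of_pos (hpp x), psi1_zero, div_le_iff₀ (by positivity)]
          refine (norm_add_le _ _).trans ?_
          rw [norm_mul, norm_mul (_ * _), norm_mul, cW_norm_neg_nat _ x 4 (by simp [hz]; norm_num), Complex.norm_real x, Real.norm_eq_abs, abs_of_nonneg hx.1]
          have b1 := rcW_deriv_le hz x
          have b2 := hA x hx
          have b3 : ‖((bA1 (x * r) * r : ℝ) : ℂ)‖ ≤ 2 * π * (x * r) * r := by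
            rw [Complex.norm_real, Real.norm_eq_abs, abs_mul, abs_of_nonneg hr]
            have := bA1_abs_le_mul (mul_nonneg hx.1 hr)
            gcongr
          calc _ ≤ (1 + 4 * ‖z‖) / vW x ^ 4 * (2 * π * (x * r) ^ 2) + x * (1 / vW x ^ 4) * (2 * π * (x * r) * r) := by gcongr
            _ = (2 + 4 * ‖z‖) * (2 * π) * r ^ 2 * x / vW x ^ 4 * x := by ring
            _ ≤ (2 + 4 * ‖z‖) * (2 * π) * r ^ 2 * x / vW x ^ 4 * (2 * vW x) := by gcongr
            _ = _ := by field_simp; ring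
        have a2 : ‖(x : ℂ) * cW (-(2 * z)) x * ((bA (x * r) - 2 * π : ℝ) : ℂ)‖ * |psi2 t x| / psi1 1 0 t x ^ 2 ≤ 16 * π * r ^ 2 / t * x := by
          rw [psi1_zero, div_le_iff₀ (by positivity)]
          have b1 := hF x hx
          have b2 : |psi2 t x| = t * (x / vW x ^ 5) := by
            unfold psi2
            rw [abs_mul, abs_div, abs_neg, abs_of_pos ht, abs_of_nonneg h1, abs_of_pos (by positivity)]
          rw [b2]
          calc _ ≤ x * (1 / vW x ^ 4) * (2 * π * (x * r) ^ 2) * (t * (x / vW x ^ 5)) := by gcongr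
            _ = 2 * π * r ^ 2 * x * (1 / vW x ^ 9) * t * x ^ 3 := by field_simp
            _ ≤ 2 * π * r ^ 2 * x * (1 / vW x ^ 9) * t * (2 * vW x) ^ 3 := by gcongr
            _ = _ := by field_simp; ring
        calc _ ≤ (8 + 16 * ‖z‖) * π * r ^ 2 / t * x + 16 * π * r ^ 2 / t * x := add_le_add a1 a2
          _ = _ := by ring
    have I2 : ((24 + 16 * ‖z‖) * π * r ^ 2 / t) * (b ^ 2 / 2) ≤ (12 + 8 * ‖z‖) * π / t := by
      have : (b * r) ^ 2 ≤ 1 := by have : 0 ≤ b * r := by positivity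
                                   nlinarith
      calc _ = (12 + 8 * ‖z‖) * π / t * (b * r) ^ 2 := by ring
        _ ≤ (12 + 8 * ‖z‖) * π / t * 1 := by gcongr
        _ = _ := by ring
    have I3 : 4 * π / t + (12 + 8 * ‖z‖) * π / t ≤ 16 * π * (1 + ‖z‖) / t := by
      rw [← add_div]; gcongr; nlinarith [mul_nonneg pi_pos.le hz0]
    refine le_trans ?_ I3
    refine le_trans (add_le_add (add_le_add B0.le B1) (I1.trans I2)) ?_
    linarith

open MeasureTheory Real Complex
open scoped ENNReal InnerProductSpace

lemma expI_hasDeriv (t x : ℝ) : HasDerivAt (fun x : ℝ => Complex.exp (Complex.I * ((t * wW x : ℝ) : ℂ)))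
    (Complex.exp (Complex.I * ((t * wW x : ℝ) : ℂ)) * (Complex.I * ((t * (1 / vW x ^ 3) : ℝ) : ℂ))) x :=
  ((((wW_hasDeriv x).const_mul t).ofReal_comp).const_mul Complex.I).cexp

lemma cW_m32 (x : ℝ) : cW (-(3/2)) x = ((1 / vW x ^ 3 : ℝ) : ℂ) := by
  unfold cW
  have e : (-(3/2) : ℂ) = ((-(3/2) : ℝ) : ℂ) := by push_cast; ring
  rw [e, ← Complex.ofReal_cpow (by positivity)]
  congr 1
  rw [← vW_sq, ← Real.rpow_natCast (vW x) 2, ← Real.rpow_mul (vW_pos x).le]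
  rw [show ((2:ℕ):ℝ) * (-(3/2)) = -((3:ℕ):ℝ) by push_cast; ring, Real.rpow_neg (vW_pos x).le,
    Real.rpow_natCast, one_div]

lemma cW_one (x : ℝ) : cW 1 x = ((1 + x ^ 2 / 3 : ℝ) : ℂ) := by unfold cW; rw [Complex.cpow_one]

lemma low_aux {t b : ℝ} {z : ℂ} (hz : z.re = 1) (hb : 0 ≤ b) (ht : 1 ≤ t) (hbt : b ^ 2 ≤ t) :
    ‖∫ x in (0:ℝ)..b, cW (3/2 - 2 * z) x * Complex.exp (Complex.I * psi 1 0 t x)‖ ≤ 4 * (1 + ‖z‖) := by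
  have hz0 := norm_nonneg z
  have ht0 : 0 < t := by linarith
  have hpp : ∀ x, 0 < psi1 1 0 t x := by intro x; rw [psi1_zero]; have := vW_pos x; positivity
  refine (osc_ibp hb (fun x _ => cW_hasDeriv (3/2 - 2 * z) x) (fun x _ => psi_hasDeriv 1 0 t x)
    (fun x _ => psi1_hasDeriv 1 0 t x) ?_ (psi2_continuous t).continuousOn (fun x _ => (hpp x).ne')).trans ?_
  · have h3 := cW_continuous (3/2 - 2 * z - 1)
    fun_prop
  · have hn : ∀ x, ‖cW (3/2 - 2 * z) x‖ = 1 / vW x ^ 1 := fun x =>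
      cW_norm_neg_nat _ x 1 (by simp [hz]; norm_num)
    have hn2 : ∀ x, ‖cW (3/2 - 2 * z - 1) x‖ = 1 / vW x ^ 3 := fun x =>
      cW_norm_neg_nat _ x 3 (by simp [hz]; norm_num)
    have hB : ∀ x, ‖cW (3/2 - 2 * z) x‖ / |psi1 1 0 t x| = (1 + x ^ 2 / 3) / t := by
      intro x
      have hv := vW_pos x
      rw [hn, abs_of_pos (hpp x), psi1_zero, ← vW_sq]
      field_simp
    rw [hB, hB]
    have hc : ‖(3/2 - 2 * z : ℂ)‖ ≤ 3/2 + 2 * ‖z‖ := by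
      refine (norm_sub_le _ _).trans ?_
      simp
    have I1 : ∫ x in (0:ℝ)..b, (‖(3/2 - 2 * z) * cW (3/2 - 2 * z - 1) x * ((2 * x / 3 : ℝ) : ℂ)‖ / |psi1 1 0 t x|
        + ‖cW (3/2 - 2 * z) x‖ * |psi2 t x| / psi1 1 0 t x ^ 2) ≤ ((2 + 2 * ‖z‖) / t) * (b ^ 2 / 2) := by
      apply int_id_le hb
      · intro x hx; positivity
      · intro x hx
        have hv := vW_pos x
        have h1 := hx.1
        have b2 : |psi2 t x| = t * (x / vW x ^ 5) := by
            unfold psi2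
            rw [abs_mul, abs_div, abs_neg, abs_of_pos ht0, abs_of_nonneg h1, abs_of_pos (by positivity)]
        rw [b2, abs_of_pos (hpp x), psi1_zero, norm_mul, norm_mul, hn, hn2, Complex.norm_real, Real.norm_eq_abs, abs_of_nonneg (by positivity)]
        calc _ ≤ (3/2 + 2 * ‖z‖) * (1 / vW x ^ 3) * (2 * x / 3) / (t / vW x ^ 3) + 1 / vW x ^ 1 * (t * (x / vW x ^ 5)) / (t / vW x ^ 3) ^ 2 := by gcongr
          _ = (2 + 4/3 * ‖z‖) / t * x := by field_simp; ring
          _ ≤ _ := by gcongr; linarith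
    have I2 : ((2 + 2 * ‖z‖) / t) * (b ^ 2 / 2) ≤ 1 + ‖z‖ := by
      calc _ ≤ ((2 + 2 * ‖z‖) / t) * (t / 2) := by gcongr
        _ = _ := by field_simp
    have I3 : (1 + (0:ℝ) ^ 2 / 3) / t ≤ 1 := by rw [div_le_one ht0]; linarith
    have I4 : (1 + b ^ 2 / 3) / t ≤ 2 := by rw [div_le_iff₀ ht0]; linarith
    linarith

lemma low_two {t b : ℝ} {z : ℂ} (hz : z.re = 1) (hb : 0 ≤ b) (ht : 1 ≤ t) (hbt : b ^ 2 ≤ t) :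
    ‖∫ x in (0:ℝ)..b, ((x : ℂ) * cW (-(2 * z)) x) * Complex.exp (Complex.I * ((t * wW x : ℝ) : ℂ))‖ ≤ 26 * (1 + ‖z‖) ^ 2 / t := by
  have hz0 := norm_nonneg z
  have ht0 : 0 < t := by linarith
  set e : ℝ → ℂ := fun x => Complex.exp (Complex.I * ((t * wW x : ℝ) : ℂ)) with he
  have hec : Continuous e := by have := wW_continuous; rw [he]; fun_prop
  have c0 := cW_continuous (-(2 * z))
  have c1 := cW_continuous (3/2 - 2 * z)
  have c2 := cW_continuous (1/2 - 2 * z)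
  set J := ∫ x in (0:ℝ)..b, ((x : ℂ) * cW (-(2 * z)) x) * e x with hJ
  set J1 := ∫ x in (0:ℝ)..b, cW (3/2 - 2 * z) x * e x with hJ1
  set J2 := ∫ x in (0:ℝ)..b, cW (1/2 - 2 * z) x * e x with hJ2
  have hd : ∀ x : ℝ, HasDerivAt (fun x : ℝ => (x : ℂ) * cW (3/2 - 2 * z) x * e x)
      ((4 - 4 * z) * (cW (3/2 - 2 * z) x * e x) - (3 - 4 * z) * (cW (1/2 - 2 * z) x * e x) + (Complex.I * t) * (((x : ℂ) * cW (-(2 * z)) x) * e x)) x := by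
    intro x
    have := (((hasDerivAt_id x).ofReal_comp).mul (cW_hasDeriv (3/2 - 2 * z) x)).mul (expI_hasDeriv t x)
    refine HasDerivAt.congr_deriv this ?_
    have h1 : cW (3/2 - 2 * z) x * ((1 / vW x ^ 3 : ℝ) : ℂ) = cW (-(2 * z)) x := by
      rw [← cW_m32, cW_mul]; ring_nf
    have h2 : cW (1/2 - 2 * z) x * ((1 + x ^ 2 / 3 : ℝ) : ℂ) = cW (3/2 - 2 * z) x := by
      rw [← cW_one, cW_mul]; ring_nf
    have h3 : (3/2 - 2 * z - 1) = 1/2 - 2 * z := by ring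
    simp only [id, Pi.mul_apply]
    rw [h3, ← h1]
    change _ = (4 - 4 * z) * (cW (3/2 - 2 * z) x * e x) - (3 - 4 * z) * (cW (1/2 - 2 * z) x * e x) + (Complex.I * t) * (((x : ℂ) * _) * e x)
    change (_ + _) * e x + _ * (e x * _) = _
    push_cast at h2 ⊢
    linear_combination ((3 - 4 * z) * e x) * h2
  have hIntg : Continuous (fun x : ℝ => (4 - 4 * z) * (cW (3/2 - 2 * z) x * e x) - (3 - 4 * z) * (cW (1/2 - 2 * z) x * e x) + (Complex.I * t) * (((x : ℂ) * cW (-(2 * z)) x) * e x)) := by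
    fun_prop
  have ftc := intervalIntegral.integral_eq_sub_of_hasDerivAt (fun x _ => hd x) (hIntg.intervalIntegrable 0 b)
  rw [intervalIntegral.integral_add (Continuous.intervalIntegrable (by fun_prop) _ _) (Continuous.intervalIntegrable (by fun_prop) _ _),
    intervalIntegral.integral_sub (Continuous.intervalIntegrable (by fun_prop) _ _) (Continuous.intervalIntegrable (by fun_prop) _ _),
    intervalIntegral.integral_const_mul, intervalIntegral.integral_const_mul, intervalIntegral.integral_const_mul] at ftc
  simp only [Complex.ofReal_zero, zero_mul, sub_zero] at ftc
  rw [← hJ, ← hJ1, ← hJ2] at ftc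
  have hJJ : (Complex.I * t) * J = (b : ℂ) * cW (3/2 - 2 * z) b * e b - (4 - 4 * z) * J1 + (3 - 4 * z) * J2 := by
    linear_combination ftc
  have hw2 : ∀ b, 0 ≤ b → wW b ≤ 2 := by
    intro b hb; unfold wW; rw [div_le_iff₀ (vW_pos b)]; exact vW_le_two hb
  have nb : ‖(b : ℂ) * cW (3/2 - 2 * z) b * e b‖ ≤ 2 := by
    rw [norm_mul, norm_mul, cW_norm_neg_nat _ b 1 (by simp [hz]; norm_num), Complex.norm_real, Real.norm_eq_abs, abs_of_nonneg hb]
    rw [show ‖e b‖ = 1 from norm_expI _]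
    have := hw2 b hb
    unfold wW at this
    calc _ = b / vW b := by ring
      _ ≤ 2 := this
  have n1 : ‖J1‖ ≤ 4 * (1 + ‖z‖) := by
    have := low_aux hz hb ht hbt
    simp only [psi_zero] at this
    exact this
  have n2 : ‖J2‖ ≤ 2 := by
    have : ∫ x in (0:ℝ)..b, 1 / vW x ^ 3 = wW b - wW 0 :=
      intervalIntegral.integral_eq_sub_of_hasDerivAt (fun x _ => wW_hasDeriv x)
        ((continuous_iff_continuousAt.2 fun s => (vW3_hasDeriv s).continuousAt).intervalIntegrable 0 b)
    refine (intervalIntegral.norm_integral_le_of_norm_le (g := fun x => 1 / vW x ^ 3) hb ?_ ((continuous_iff_continuousAt.2 fun s => (vW3_hasDeriv s).continuousAt).intervalIntegrable 0 b)).trans ?_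
    · filter_upwards with x hx
      rw [norm_mul, cW_norm_neg_nat _ x 3 (by simp [hz]; norm_num), show ‖e x‖ = 1 from norm_expI _, mul_one]
    · rw [this]
      have := hw2 b hb
      simp [wW] at this ⊢
      exact this
  have nt : t * ‖J‖ ≤ 26 * (1 + ‖z‖) ^ 2 := by
    have : t * ‖J‖ = ‖(Complex.I * t) * J‖ := by
      rw [norm_mul, norm_mul, Complex.norm_I, Complex.norm_real, Real.norm_eq_abs, abs_of_pos ht0, one_mul]
    rw [this, hJJ]
    have q1 : ‖(4 - 4 * z : ℂ)‖ ≤ 4 + 4 * ‖z‖ := by refine (norm_sub_le _ _).trans ?_; simp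
    have q2 : ‖(3 - 4 * z : ℂ)‖ ≤ 3 + 4 * ‖z‖ := by refine (norm_sub_le _ _).trans ?_; simp
    calc _ ≤ ‖(b : ℂ) * cW (3/2 - 2 * z) b * e b‖ + ‖(4 - 4 * z) * J1‖ + ‖(3 - 4 * z) * J2‖ :=
          (norm_add_le _ _).trans (add_le_add (norm_sub_le _ _) le_rfl)
      _ ≤ 2 + (4 + 4 * ‖z‖) * (4 * (1 + ‖z‖)) + (3 + 4 * ‖z‖) * 2 := by
          rw [norm_mul (4 - 4 * z), norm_mul (3 - 4 * z)]; gcongr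
      _ ≤ _ := by nlinarith
  rw [le_div_iff₀ ht0]; linarith

lemma kI_low {r t b : ℝ} {z : ℂ} (hz : z.re = 1) (hb : 0 ≤ b) (hr : 0 ≤ r) (ht : 1 ≤ t) (hbt : b ^ 2 ≤ t) (hbr : b * r ≤ 1) :
    ‖∫ x in (0:ℝ)..b, kI r t z x‖ ≤ 68 * π * (1 + ‖z‖) ^ 2 / t := by
  have ht0 : 0 < t := by linarith
  have h1 := low_one hz hb hr ht0 hbr
  have h2 := low_two hz hb ht hbt
  simp only [psi_zero] at h1
  have d1 := bA_continuous
  have d2 := cW_continuous (-(2 * z))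
  have d3 := wW_continuous
  have e : ∫ x in (0:ℝ)..b, kI r t z x = (∫ x in (0:ℝ)..b, ((x : ℂ) * cW (-(2 * z)) x * ((bA (x * r) - 2 * π : ℝ) : ℂ)) * Complex.exp (Complex.I * ((t * wW x : ℝ) : ℂ)))
      + (2 * π : ℝ) * ∫ x in (0:ℝ)..b, ((x : ℂ) * cW (-(2 * z)) x) * Complex.exp (Complex.I * ((t * wW x : ℝ) : ℂ)) := by
    rw [← intervalIntegral.integral_const_mul, ← intervalIntegral.integral_add (Continuous.intervalIntegrable (by fun_prop) _ _) (Continuous.intervalIntegrable (by fun_prop) _ _)]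
    congr 1
    ext x
    unfold kI
    push_cast; ring
  rw [e]
  refine (norm_add_le _ _).trans ?_
  rw [norm_mul, Complex.norm_real, Real.norm_eq_abs, abs_of_pos (by positivity)]
  calc _ ≤ 16 * π * (1 + ‖z‖) / t + 2 * π * (26 * (1 + ‖z‖) ^ 2 / t) := by gcongr
    _ ≤ 16 * π * (1 + ‖z‖) ^ 2 / t + 2 * π * (26 * (1 + ‖z‖) ^ 2 / t) := by
      have := norm_nonneg z
      gcongr
      nlinarith
    _ = _ := by ring

lemma kI_osc {r t s0 B : ℝ} {z : ℂ} (hz : z.re = 1) (hs0 : 0 < s0) (hsB : s0 ≤ B)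
    (hr : 0 < r) (ht : 0 < t) (hsr : 1 ≤ s0 * r)
    (hcase : (t ≤ 8 * r ∧ s0 ^ 3 * t = 512) ∨ 8 * r < t) :
    ‖∫ x in s0..B, kI r t z x‖ ≤ 49152 * π * (1 + ‖z‖) ^ 2 / t := by
  have h1 := osc_plus hz hs0 hsB hr ht hsr
  have h2 := osc_minus hz hs0 hsB hr ht hsr hcase
  simp only [kI_eq]
  rw [intervalIntegral.integral_add ((osc_integrand_continuous _ _ _ _).intervalIntegrable _ _)
    ((osc_integrand_continuous _ _ _ _).intervalIntegrable _ _)]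
  refine (norm_add_le _ _).trans ((add_le_add h1 h2).trans ?_)
  calc _ = 49152 * π * (1 + ‖z‖) / t := by ring
    _ ≤ _ := by
      have := norm_nonneg z
      gcongr
      nlinarith

lemma kI_start {r t s0 : ℝ} {z : ℂ} (hz : z.re = 1) (hs0 : 0 < s0) (hr : 0 < r) (ht : 0 < t)
    (hcase : t ≤ 8 * r ∧ s0 ^ 3 * t = 512) :
    ‖∫ x in (0:ℝ)..s0, kI r t z x‖ ≤ 384 * π / t := by
  have hb : ∀ x ∈ Set.uIoc 0 s0, ‖kI r t z x‖ ≤ 6 * π * √s0 / √r := by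
    intro x hx
    rw [Set.uIoc_of_le hs0.le] at hx
    have hx0 := hx.1
    have hv := vW_ge_one x
    have hA : |bA (x * r)| ≤ 6 * π * (1 / √(x * r)) := by
      have hp : 0 < x * r := by positivity
      rcases le_or_gt 1 (x * r) with h | h
      · have := (bA_le h).1
        rwa [sqrt_rpow hp.le] at this
      · refine (bA_abs_le _).trans ?_
        have h1 : 1 ≤ 1 / √(x * r) := by
          rw [le_div_iff₀ (Real.sqrt_pos.2 hp), one_mul]
          exact Real.sqrt_le_one.2 h.le
        nlinarith [pi_pos]
    have hsx := Real.sqrt_pos.2 hx0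
    have hsr := Real.sqrt_pos.2 hr
    unfold kI
    rw [norm_mul, norm_mul, norm_mul, norm_expI, cW_norm_neg_nat _ x 4 (by simp [hz]; norm_num), Complex.norm_real, Complex.norm_real,
      Real.norm_eq_abs, Real.norm_eq_abs, abs_of_nonneg hx0.le]
    have hv4 : 1 / vW x ^ 4 ≤ 1 := by
      rw [div_le_one (by positivity)]; exact one_le_pow₀ hv
    calc _ ≤ x * 1 * (6 * π * (1 / √(x * r))) * 1 := by gcongr
      _ = 6 * π * √x / √r := by
        rw [Real.sqrt_mul hx0.le]
        have : x = √x * √x := (Real.mul_self_sqrt hx0.le).symm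
        field_simp
        rw [Real.sq_sqrt hx0.le]
      _ ≤ _ := by gcongr; exact hx.2
  refine (intervalIntegral.norm_integral_le_of_norm_le_const hb).trans ?_
  rw [sub_zero, abs_of_pos hs0]
  refine (sq_le_sq₀ (by positivity) (by positivity)).1 ?_
  rw [mul_pow, div_pow, mul_pow, Real.sq_sqrt hs0.le, Real.sq_sqrt hr.le]
  have h1 : s0 ^ 3 = 512 / t := by rw [← hcase.2]; field_simp
  have h2 : t / 8 ≤ r := by linarith [hcase.1]
  calc _ = (6 * π) ^ 2 * s0 ^ 3 / r := by ring
    _ ≤ (6 * π) ^ 2 * s0 ^ 3 / (t / 8) := by gcongr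
    _ = _ := by rw [h1]; field_simp; ring

/-- The one-dimensional dispersive bound. -/
theorem kI_bound {r t : ℝ} {z : ℂ} (hz : z.re = 1) (hr : 0 ≤ r) (ht : 0 < t) :
    ‖∫ ρ in Set.Ioi (0:ℝ), kI r t z ρ‖ ≤ 50000 * π * (1 + ‖z‖) ^ 2 / t := by
  have hz0 := norm_nonneg z
  have hz1 : 1 ≤ (1 + ‖z‖) ^ 2 := by nlinarith
  have T := fun B (hB : 0 ≤ B) => kI_tail r t hz hB
  have S : ∀ B, 0 ≤ B → ∫ ρ in Set.Ioi (0:ℝ), kI r t z ρ = (∫ x in (0:ℝ)..B, kI r t z x) + ∫ ρ in Set.Ioi B, kI r t z ρ := by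
    intro B hB
    rw [intervalIntegral.integral_interval_add_Ioi (kI_integrable r t hz le_rfl) (kI_integrable r t hz hB)]
  rcases le_or_gt t 1 with ht1 | ht1
  · have := T 0 le_rfl
    refine this.trans ?_
    have hv : vW 0 = 1 := by simp [vW]
    rw [hv, one_pow, div_one, le_div_iff₀ ht]
    nlinarith [pi_pos, mul_le_mul_of_nonneg_left hz1 pi_pos.le]
  have hst : √t ^ 2 = t := Real.sq_sqrt ht.le
  have hst0 : 0 < √t := Real.sqrt_pos.2 ht
  have T2 : ∀ B, √t ≤ B → ‖∫ ρ in Set.Ioi B, kI r t z ρ‖ ≤ 9 * π * (1 + ‖z‖) ^ 2 / t := by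
    intro B hB
    have hB0 : 0 ≤ B := hst0.le.trans hB
    have hv := vW_pos B
    refine (T B hB0).trans ?_
    rw [div_le_div_iff₀ (by positivity) (by positivity), vW_sq]
    have : t ≤ B ^ 2 := by rw [← hst]; gcongr
    calc 3 * π * t ≤ 3 * π * (3 * (1 + B ^ 2 / 3)) := by gcongr; linarith
      _ = 9 * π * 1 * (1 + B ^ 2 / 3) := by ring
      _ ≤ _ := by gcongr
  have hi : ∀ a b, IntervalIntegrable (kI r t z) volume a b := fun a b => (kI_continuous r t z).intervalIntegrable a b
  have fin : ∀ c : ℝ, 0 ≤ c → c ≤ 50000 → c * π * (1 + ‖z‖) ^ 2 / t ≤ 50000 * π * (1 + ‖z‖) ^ 2 / t := by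
    intro c _ hc; gcongr
  rcases le_or_gt t (8 * r) with hI | hII
  · have hr0 : 0 < r := by linarith
    set s0 : ℝ := 8 * t ^ (-(1/3) : ℝ) with hs0d
    have hs0 : 0 < s0 := by positivity
    have hs3 : s0 ^ 3 * t = 512 := by
      rw [hs0d, mul_pow, ← Real.rpow_natCast (t ^ _), ← Real.rpow_mul ht.le]
      rw [show (-(1/3) : ℝ) * ((3:ℕ):ℝ) = -1 by norm_num, Real.rpow_neg_one]
      field_simp; norm_num
    have hsr : 1 ≤ s0 * r := by
      have : 1 ^ 3 ≤ (s0 * r) ^ 3 := by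
        have h5 : t / 8 ≤ r := by linarith
        calc (1:ℝ) ^ 3 ≤ t ^ 2 := by nlinarith
          _ = (512 / t) * (t / 8) ^ 3 := by field_simp; norm_num
          _ = s0 ^ 3 * (t / 8) ^ 3 := by rw [← hs3]; field_simp
          _ ≤ s0 ^ 3 * r ^ 3 := by gcongr
          _ = _ := by ring
      exact le_of_pow_le_pow_left₀ (by norm_num) (by positivity) this
    rw [S (max s0 √t) (by positivity), ← intervalIntegral.integral_add_adjacent_intervals (hi 0 s0) (hi s0 _)]
    have a1 := kI_start hz hs0 hr0 ht ⟨hI, hs3⟩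
    have a2 := kI_osc hz hs0 (le_max_left s0 √t) hr0 ht hsr (Or.inl ⟨hI, hs3⟩)
    have a3 := T2 _ (le_max_right s0 √t)
    refine norm_add₃_le.trans ((add_le_add (add_le_add a1 a2) a3).trans ?_)
    have : 384 * π / t ≤ 384 * π * (1 + ‖z‖) ^ 2 / t := by
      exact div_le_div_of_nonneg_right (le_mul_of_one_le_right (by positivity) hz1) ht.le
    have h := fin (384 + 49152 + 9) (by norm_num) (by norm_num)
    calc _ ≤ 384 * π * (1 + ‖z‖) ^ 2 / t + 49152 * π * (1 + ‖z‖) ^ 2 / t + 9 * π * (1 + ‖z‖) ^ 2 / t := by linarith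
      _ = (384 + 49152 + 9) * π * (1 + ‖z‖) ^ 2 / t := by ring
      _ ≤ _ := h
  · rcases le_or_gt (√t * r) 1 with h | h
    · rw [S √t hst0.le]
      have a1 := kI_low hz hst0.le hr ht1.le hst.le h
      have a3 := T2 √t le_rfl
      refine (norm_add_le _ _).trans ((add_le_add a1 a3).trans ?_)
      have h := fin (68 + 9) (by norm_num) (by norm_num)
      refine le_trans (le_of_eq ?_) h
      ring
    · have hr0 : 0 < r := by
        by_contra hh
        have : √t * r ≤ 0 := mul_nonpos_of_nonneg_of_nonpos hst0.le (not_lt.1 hh)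
        linarith
      have hs0 : 0 < 1 / r := by positivity
      have hsB : 1 / r ≤ √t := by rw [div_le_iff₀ hr0]; exact h.le
      rw [S √t hst0.le, ← intervalIntegral.integral_add_adjacent_intervals (hi 0 (1 / r)) (hi (1 / r) _)]
      have hsr : 1 / r * r = 1 := by field_simp
      have a1 := kI_low hz hs0.le hr ht1.le (by rw [← hst]; gcongr) hsr.le
      have a2 := kI_osc hz hs0 hsB hr0 ht hsr.ge (Or.inr hII)
      have a3 := T2 √t le_rfl
      refine norm_add₃_le.trans ((add_le_add (add_le_add a1 a2) a3).trans ?_)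
      have h := fin (68 + 49152 + 9) (by norm_num) (by norm_num)
      refine le_trans (le_of_eq ?_) h
      ring

open MeasureTheory Real Complex
open scoped ENNReal InnerProductSpace ComplexConjugate

/-- plane -/
abbrev E2 : Type := EuclideanSpace ℝ (Fin 2)

/-- multiplier of the analytic family -/
noncomputable def mK (τ μ : ℝ) (z : ℂ) (ξ : E2) : ℂ :=
  Complex.exp (Complex.I * ((τ * (‖ξ‖ / √(1 + μ * ‖ξ‖ ^ 2 / 3)) : ℝ) : ℂ)) * ((1 + μ * ‖ξ‖ ^ 2 / 3 : ℝ) : ℂ) ^ (-(2 * z))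

lemma kI_conj (r t : ℝ) (z : ℂ) (ρ : ℝ) : kI r (-t) z ρ = conj (kI r t (conj z) ρ) := by
  unfold kI cW
  simp only [map_mul, Complex.conj_ofReal, ← Complex.exp_conj, Complex.conj_I]
  have h1 : ((1 + ρ ^ 2 / 3 : ℝ) : ℂ) ^ (-(2 * z)) = conj (((1 + ρ ^ 2 / 3 : ℝ) : ℂ) ^ (-(2 * conj z))) := by
    have h0 : ((1 + ρ ^ 2 / 3 : ℝ) : ℂ).arg ≠ π := by
      rw [Complex.arg_ofReal_of_nonneg (by positivity)]; exact pi_pos.ne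
    have := Complex.conj_cpow ((1 + ρ ^ 2 / 3 : ℝ) : ℂ) (-(2 * z)) h0
    rw [Complex.conj_ofReal] at this
    rw [this, map_neg, map_mul, show conj (2:ℂ) = 2 from map_ofNat _ 2]
  rw [← h1]
  congr 2
  push_cast; ring

theorem kI_bound' {r t : ℝ} {z : ℂ} (hz : z.re = 1) (hr : 0 ≤ r) (ht : t ≠ 0) :
    ‖∫ ρ in Set.Ioi (0:ℝ), kI r t z ρ‖ ≤ 50000 * π * (1 + ‖z‖) ^ 2 / |t| := by
  rcases lt_or_gt_of_ne ht with h | h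
  · have := kI_bound (r := r) (t := -t) (z := conj z) (by simpa using hz) hr (by linarith)
    rw [abs_of_neg h]
    have e : ∫ ρ in Set.Ioi (0:ℝ), kI r t z ρ = conj (∫ ρ in Set.Ioi (0:ℝ), kI r (-t) (conj z) ρ) := by
      rw [← integral_conj]
      congr 1; ext ρ
      rw [← kI_conj]; simp
    rw [e, RCLike.norm_conj]
    simpa using this
  · rw [abs_of_pos h]; exact kI_bound hz hr h

lemma bA_complex (s : ℝ) : ∫ θ in Set.Ioo (-π) π, Complex.exp (Complex.I * ((s * Real.cos θ : ℝ) : ℂ)) = (bA s : ℂ) := by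
  have hpi : -π ≤ π := by linarith [pi_pos]
  rw [← integral_Ioc_eq_integral_Ioo, ← intervalIntegral.integral_of_le hpi]
  have e : ∀ θ : ℝ, Complex.exp (Complex.I * ((s * Real.cos θ : ℝ) : ℂ)) = ((Real.cos (s * Real.cos θ) : ℝ) : ℂ) + ((Real.sin (s * Real.cos θ) : ℝ) : ℂ) * Complex.I := by
    intro θ; rw [mul_comm, Complex.exp_mul_I]; push_cast; rfl
  simp only [e]
  rw [intervalIntegral.integral_add (Continuous.intervalIntegrable (by fun_prop) _ _) (Continuous.intervalIntegrable (by fun_prop) _ _),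
    intervalIntegral.integral_mul_const, intervalIntegral.integral_ofReal, intervalIntegral.integral_ofReal]
  have h0 : ∫ θ in (-π)..π, Real.sin (s * Real.cos θ) = 0 := by
    have hc : Continuous fun θ => Real.sin (s * Real.cos θ) := by fun_prop
    rw [← intervalIntegral.integral_add_adjacent_intervals (hc.intervalIntegrable (-π) 0) (hc.intervalIntegrable 0 π)]
    have h1 : ∫ θ in (0:ℝ)..π, Real.sin (s * Real.cos θ) = ∫ θ in (-π)..0, Real.sin (s * Real.cos (θ + π)) := by
      rw [intervalIntegral.integral_comp_add_right (fun θ => Real.sin (s * Real.cos θ))]; simp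
    rw [h1, ← intervalIntegral.integral_add (Continuous.intervalIntegrable (by fun_prop) _ _) (Continuous.intervalIntegrable (by fun_prop) _ _)]
    simp
  rw [h0]; simp [bA]

lemma exists_isom (x : E2) : ∃ U : E2 ≃ₗᵢ[ℝ] ℂ, ∀ ξ, ⟪x, ξ⟫_ℝ = ‖x‖ * (U ξ).re := by
  let U0 : E2 ≃ₗᵢ[ℝ] ℂ := Complex.orthonormalBasisOneI.repr.symm
  let a : Circle := Circle.exp (-(Complex.arg (U0 x)))
  refine ⟨U0.trans (rotation a), fun ξ => ?_⟩
  have hx : (U0.trans (rotation a)) x = (‖x‖ : ℂ) := by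
    change (a : ℂ) * U0 x = _
    have h1 := Complex.norm_mul_exp_arg_mul_I (U0 x)
    have h2 : ‖U0 x‖ = ‖x‖ := U0.norm_map x
    rw [h2] at h1
    rw [← h1, Circle.coe_exp]
    conv_lhs => rw [mul_left_comm, ← Complex.exp_add]
    simp
  rw [inner_map_complex (U0.trans (rotation a)), hx, Complex.conj_ofReal, Complex.re_mul_ofReal, mul_comm]

lemma kernel_one (τ : ℝ) {z : ℂ} (hz : z.re = 1) (x : E2) :
    ∫ ξ : E2, Complex.exp (Complex.I * (⟪x, ξ⟫_ℝ : ℂ)) * mK τ 1 z ξ = ∫ ρ in Set.Ioi (0:ℝ), kI ‖x‖ τ z ρ := by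
  obtain ⟨U, hU⟩ := exists_isom x
  let g : ℂ → ℂ := fun w => Complex.exp (Complex.I * ((‖x‖ * w.re : ℝ) : ℂ)) * (Complex.exp (Complex.I * ((τ * wW ‖w‖ : ℝ) : ℂ)) * cW (-(2 * z)) ‖w‖)
  have e1 : ∫ ξ : E2, Complex.exp (Complex.I * (⟪x, ξ⟫_ℝ : ℂ)) * mK τ 1 z ξ = ∫ w : ℂ, g w := by
    rw [← U.measurePreserving.integral_comp U.toHomeomorph.measurableEmbedding]
    congr 1; ext ξ
    simp only [g, U.norm_map, hU]
    unfold mK cW wW vW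
    simp only [one_mul]
  rw [e1, ← Complex.integral_comp_polarCoord_symm]
  have e2 : polarCoord.target = Set.Ioi (0:ℝ) ×ˢ Set.Ioo (-π) π := rfl
  have c1 := wW_continuous
  have c2 := cW_continuous (-(2 * z))
  have key : ∀ p ∈ Set.Ioi (0:ℝ) ×ˢ Set.Ioo (-π) π, p.1 • g (Complex.polarCoord.symm p) =
      ((p.1 : ℂ) * cW (-(2 * z)) p.1 * Complex.exp (Complex.I * ((τ * wW p.1 : ℝ) : ℂ))) * Complex.exp (Complex.I * ((p.1 * ‖x‖ * Real.cos p.2 : ℝ) : ℂ)) := by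
    rintro ⟨ρ, θ⟩ hp
    have hρ : 0 < ρ := hp.1
    have n1 : ‖Complex.polarCoord.symm (ρ, θ)‖ = ρ := by
      rw [Complex.norm_polarCoord_symm]; exact abs_of_pos hρ
    have n2 : (Complex.polarCoord.symm (ρ, θ)).re = ρ * Real.cos θ := by
      rw [Complex.polarCoord_symm_apply]
      simp
      left; exact Complex.cos_ofReal_re θ
    simp only [g, n1, n2, Complex.real_smul]
    rw [show ‖x‖ * (ρ * Real.cos θ) = ρ * ‖x‖ * Real.cos θ by ring]
    ring
  rw [e2, setIntegral_congr_fun (measurableSet_Ioi.prod measurableSet_Ioo) key]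
  rw [Measure.volume_eq_prod, setIntegral_prod]
  · apply setIntegral_congr_fun measurableSet_Ioi
    intro ρ hρ
    simp only
    rw [integral_const_mul, bA_complex]
    unfold kI; ring
  · unfold IntegrableOn
    rw [← Measure.prod_restrict]
    have i1 : Integrable (fun θ : ℝ => (1:ℝ)) (volume.restrict (Set.Ioo (-π) π)) := by
      apply integrable_const
    have i2 := (tail_integrable (le_refl (0:ℝ)))
    refine Integrable.mono' (Integrable.mul_prod i2 i1) ?_ ?_
    · apply Continuous.aestronglyMeasurable; fun_prop
    · rw [Measure.prod_restrict]
      filter_upwards [ae_restrict_mem (measurableSet_Ioi.prod measurableSet_Ioo)] with p hp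
      have hρ : 0 < p.1 := hp.1
      rw [norm_mul, norm_mul, norm_mul, norm_expI, norm_expI, cW_norm_neg_nat _ p.1 4 (by simp [hz]; norm_num), Complex.norm_real, Real.norm_eq_abs, abs_of_pos hρ]
      apply le_of_eq; ring

/-- The two-dimensional dispersive estimate. -/
theorem kernel_bound {τ μ : ℝ} (hμ : 0 < μ) (hτ : τ ≠ 0) {z : ℂ} (hz : z.re = 1) (x : E2) :
    ‖∫ ξ : E2, Complex.exp (Complex.I * (⟪x, ξ⟫_ℝ : ℂ)) * mK τ μ z ξ‖ ≤ 50000 * π * (1 + ‖z‖) ^ 2 / (√μ * |τ|) := by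
  have hs := Real.sqrt_pos.2 hμ
  have hs2 := Real.sq_sqrt hμ.le
  have e : ∀ ξ : E2, Complex.exp (Complex.I * (⟪x, ξ⟫_ℝ : ℂ)) * mK τ μ z ξ =
      (fun ζ : E2 => Complex.exp (Complex.I * (⟪(√μ)⁻¹ • x, ζ⟫_ℝ : ℂ)) * mK (τ / √μ) 1 z ζ) (√μ • ξ) := by
    intro ξ
    simp only [mK, norm_smul, real_inner_smul_left, real_inner_smul_right, Real.norm_eq_abs, abs_of_pos hs, mul_pow, hs2, one_mul]
    rw [show √μ * ((√μ)⁻¹ * ⟪x, ξ⟫_ℝ) = ⟪x, ξ⟫_ℝ by field_simp]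
    rw [show τ / √μ * (√μ * ‖ξ‖ / √(1 + μ * ‖ξ‖ ^ 2 / 3)) = τ * (‖ξ‖ / √(1 + μ * ‖ξ‖ ^ 2 / 3)) by field_simp]
  rw [integral_congr_ae (Filter.Eventually.of_forall e), Measure.integral_comp_smul volume (fun ζ : E2 => Complex.exp (Complex.I * (⟪(√μ)⁻¹ • x, ζ⟫_ℝ : ℂ)) * mK (τ / √μ) 1 z ζ), kernel_one _ hz, norm_smul]
  have hd : Module.finrank ℝ E2 = 2 := by simp
  rw [hd, hs2]
  have := kI_bound' (r := ‖(√μ)⁻¹ • x‖) (t := τ / √μ) hz (norm_nonneg _) (by positivity)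
  rw [Real.norm_eq_abs, abs_abs, abs_of_pos (by positivity)]
  calc _ ≤ μ⁻¹ * (50000 * π * (1 + ‖z‖) ^ 2 / |τ / √μ|) := by gcongr
    _ = _ := by
      rw [abs_div, abs_of_pos hs]
      have : 0 < |τ| := abs_pos.2 hτ
      field_simp
      nlinarith

lemma mK_norm {τ μ : ℝ} (hμ : 0 ≤ μ) (z : ℂ) (ξ : E2) : ‖mK τ μ z ξ‖ = (1 + μ * ‖ξ‖ ^ 2 / 3) ^ (-(2 * z.re)) := by
  unfold mK
  rw [norm_mul, norm_expI, one_mul, Complex.norm_cpow_eq_rpow_re_of_pos (by positivity)]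
  simp

lemma mK_continuous {τ μ : ℝ} (hμ : 0 ≤ μ) (z : ℂ) : Continuous (mK τ μ z) := by
  unfold mK
  have h0 : ∀ ξ : E2, 0 < 1 + μ * ‖ξ‖ ^ 2 / 3 := fun ξ => by positivity
  apply Continuous.mul
  · have : Continuous fun ξ : E2 => ‖ξ‖ / √(1 + μ * ‖ξ‖ ^ 2 / 3) := by
      apply Continuous.div (by fun_prop) (by fun_prop)
      intro ξ; exact (Real.sqrt_pos.2 (h0 ξ)).ne'
    fun_prop
  · apply Continuous.cpow (by fun_prop) continuous_const
    intro ξ; left; rw [Complex.ofReal_re]; exact h0 ξ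

lemma mK_integrable {τ μ : ℝ} (hμ : 0 < μ) (hμ1 : μ ≤ 1) {z : ℂ} (hz : z.re = 1) : Integrable (mK τ μ z) := by
  have h := (integrable_rpow_neg_one_add_norm_sq (E := E2) (r := 4) (μ := volume) (by simp; norm_num)).const_mul ((3 / μ) ^ 2)
  refine h.mono' (mK_continuous hμ.le z).aestronglyMeasurable ?_
  filter_upwards with ξ
  rw [mK_norm hμ.le, hz]
  have h0 : 0 < 1 + μ * ‖ξ‖ ^ 2 / 3 := by positivity
  have h1 : 0 < 1 + ‖ξ‖ ^ 2 := by positivity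
  rw [show (-(2 * 1) : ℝ) = -((2:ℕ):ℝ) by norm_num, show (-(4:ℝ) / 2) = -((2:ℕ):ℝ) by norm_num]
  rw [Real.rpow_neg h0.le, Real.rpow_neg h1.le, Real.rpow_natCast, Real.rpow_natCast, ← inv_pow, ← inv_pow, ← mul_pow]
  gcongr
  rw [inv_le_iff_one_le_mul₀ h0]
  have : (3 / μ * (1 + ‖ξ‖ ^ 2)⁻¹) * (1 + μ * ‖ξ‖ ^ 2 / 3) = (3 / μ + ‖ξ‖ ^ 2) / (1 + ‖ξ‖ ^ 2) := by
    field_simp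
  rw [this, le_div_iff₀ h1]
  have : 1 ≤ 3 / μ := by rw [le_div_iff₀ hμ]; linarith
  linarith

open MeasureTheory Real Complex
open scoped ENNReal InnerProductSpace ComplexConjugate

open scoped FourierTransform ContDiff in
lemma fourier_L1L2 {g : E2 → ℂ} (h1 : Integrable g) (h2 : MemLp g 2) :
    eLpNorm (𝓕 g) 2 volume = eLpNorm g 2 volume := by
  have hc : Continuous (𝓕 g) := by
    have := VectorFourier.fourierIntegral_continuous (V := E2) (W := E2) (μ := volume) (e := Real.fourierChar) (L := innerₗ E2) (f := g)
      Real.continuous_fourierChar (by exact continuous_inner) h1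
    exact this
  have key : ∀ᵐ ξ, (𝓕 (h2.toLp g) : Lp ℂ 2 (volume : Measure E2)) ξ = 𝓕 g ξ := by
    apply ae_eq_of_integral_contDiff_smul_eq
    · exact (Lp.memLp _).locallyIntegrable (by norm_num)
    · exact hc.locallyIntegrable
    · intro φ φs φc
      have hg₁ : HasCompactSupport (Complex.ofRealCLM ∘ φ) := φc.comp_left rfl
      have hg₂ : ContDiff ℝ ∞ (Complex.ofRealCLM ∘ φ) := by fun_prop
      let Φ : SchwartzMap E2 ℂ := hg₁.toSchwartzMap hg₂
      have hΦ : ∀ x, Φ x = (φ x : ℂ) := fun x => rfl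
      have a1 := congrArg (fun D : TemperedDistribution E2 ℂ => D Φ) (Lp.fourier_toTemperedDistribution_eq (h2.toLp g))
      simp only [TemperedDistribution.fourier_apply, Lp.toTemperedDistribution_apply] at a1
      have a2 : ∫ x, (𝓕 Φ) x • (h2.toLp g : E2 → ℂ) x = ∫ x, (𝓕 (Φ : E2 → ℂ)) x • g x := by
        apply integral_congr_ae
        filter_upwards [h2.coeFn_toLp] with x hx
        rw [hx, SchwartzMap.fourier_coe]
      rw [a2] at a1
      have a3 : ∫ x, (𝓕 (Φ : E2 → ℂ)) x • g x = ∫ x, Φ x • (𝓕 g) x := by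
        have := VectorFourier.integral_fourierIntegral_smul_eq_flip (V := E2) (W := E2) (μ := volume) (ν := volume) (e := Real.fourierChar) (L := innerₗ E2) (f := (Φ : E2 → ℂ)) (g := g)
          Real.continuous_fourierChar (by exact continuous_inner) Φ.integrable h1
        rw [flip_innerₗ] at this
        exact this
      rw [a3] at a1
      simp only [hΦ] at a1
      simpa using a1.symm
  rw [← eLpNorm_congr_ae key, ← ENNReal.toReal_eq_toReal_iff' (Lp.memLp _).eLpNorm_ne_top h2.eLpNorm_ne_top, ← Lp.norm_def, Lp.norm_fourier_eq, Lp.norm_toLp]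

/-- Inverse Fourier integral -/
noncomputable def eF (g : E2 → ℂ) (ξ : E2) : ℂ :=
  (((2 * π)⁻¹ : ℝ) : ℂ) * ∫ x : E2, Complex.exp (Complex.I * (⟪x, ξ⟫_ℝ : ℂ)) * g x

open scoped FourierTransform in
lemma eF_eq (g : E2 → ℂ) (ξ : E2) : eF g ξ = (((2 * π)⁻¹ : ℝ) : ℂ) * 𝓕 g ((-(2 * π)⁻¹) • ξ) := by
  unfold eF
  rw [Real.fourier_eq']
  congr 2
  ext x
  rw [real_inner_smul_right, smul_eq_mul]
  congr 2
  rw [mul_comm]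
  congr 2
  have := pi_pos
  field_simp

open scoped FourierTransform in
lemma eF_continuous {g : E2 → ℂ} (h1 : Integrable g) : Continuous (eF g) := by
  have hc : Continuous (𝓕 g) := by
    have := VectorFourier.fourierIntegral_continuous (V := E2) (W := E2) (μ := volume) (e := Real.fourierChar) (L := innerₗ E2) (f := g)
      Real.continuous_fourierChar (by exact continuous_inner) h1
    exact this
  have : eF g = fun ξ => (((2 * π)⁻¹ : ℝ) : ℂ) * 𝓕 g ((-(2 * π)⁻¹) • ξ) := funext (eF_eq g)
  rw [this]; fun_prop

lemma eF_norm_le (g : E2 → ℂ) (ξ : E2) : ‖eF g ξ‖ ≤ (2 * π)⁻¹ * ∫ x, ‖g x‖ := by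
  unfold eF
  rw [norm_mul, Complex.norm_real, Real.norm_eq_abs, abs_of_pos (by positivity)]
  gcongr
  refine (norm_integral_le_integral_norm _).trans (le_of_eq ?_)
  congr 1; ext x; rw [norm_mul, norm_expI, one_mul]

open scoped FourierTransform in
/-- Plancherel for integrable and square integrable functions. -/
theorem eF_plancherel {g : E2 → ℂ} (h1 : Integrable g) (h2 : MemLp g 2) :
    eLpNorm (eF g) 2 volume = eLpNorm g 2 volume := by
  rw [← fourier_L1L2 h1 h2]
  rw [eLpNorm_eq_lintegral_rpow_enorm_toReal (by norm_num) (by norm_num), eLpNorm_eq_lintegral_rpow_enorm_toReal (by norm_num) (by norm_num)]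
  congr 1
  have e : ∀ ξ, ‖eF g ξ‖ₑ ^ (2:ℝ≥0∞).toReal = ENNReal.ofReal ((2 * π)⁻¹ ^ 2) * ‖𝓕 g ((-(2 * π)⁻¹) • ξ)‖ₑ ^ (2:ℝ≥0∞).toReal := by
    intro ξ
    rw [eF_eq, enorm_mul, ENNReal.mul_rpow_of_nonneg _ _ (by simp)]
    congr 1
    rw [← ofReal_norm, Complex.norm_real, Real.norm_eq_abs, abs_of_pos (by positivity)]
    rw [ENNReal.ofReal_pow (show 0 ≤ (2 * π)⁻¹ by positivity)]; simp
  simp only [e]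
  rw [lintegral_const_mul' _ _ (by simp)]
  have hc : Continuous (𝓕 g) := by
    have := VectorFourier.fourierIntegral_continuous (V := E2) (W := E2) (μ := volume) (e := Real.fourierChar) (L := innerₗ E2) (f := g)
      Real.continuous_fourierChar (by exact continuous_inner) h1
    exact this
  have hm : ∫⁻ ξ : E2, ‖𝓕 g ((-(2 * π)⁻¹) • ξ)‖ₑ ^ (2:ℝ≥0∞).toReal = ENNReal.ofReal |((-(2 * π)⁻¹) ^ (Module.finrank ℝ E2))⁻¹| * ∫⁻ ξ : E2, ‖𝓕 g ξ‖ₑ ^ (2:ℝ≥0∞).toReal := by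
    rw [← lintegral_map (f := fun ξ => ‖𝓕 g ξ‖ₑ ^ (2:ℝ≥0∞).toReal) (g := fun ξ : E2 => (-(2 * π)⁻¹) • ξ) (by fun_prop) (by fun_prop)]
    rw [Measure.map_addHaar_smul _ (by have := pi_pos; simp [this.ne']), lintegral_smul_measure, smul_eq_mul]
  rw [hm, ← mul_assoc, ← ENNReal.ofReal_mul (by positivity)]
  have : Module.finrank ℝ E2 = 2 := by simp
  rw [this]
  have : (2 * π)⁻¹ ^ 2 * |((-(2 * π)⁻¹) ^ 2)⁻¹| = 1 := by
    rw [abs_of_nonneg (by positivity)]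
    have := pi_pos
    field_simp
  rw [this]; simp

lemma eF_memLp {g : E2 → ℂ} (h1 : Integrable g) (h2 : MemLp g 2) : MemLp (eF g) 2 :=
  ⟨(eF_continuous h1).aestronglyMeasurable, by rw [eF_plancherel h1 h2]; exact h2.2⟩

open MeasureTheory Real Complex
open scoped ENNReal InnerProductSpace ComplexConjugate

/-- integrable and square integrable -/
def Nice (u : E2 → ℂ) : Prop := Integrable u ∧ MemLp u 2

lemma Nice.add {u v : E2 → ℂ} (hu : Nice u) (hv : Nice v) : Nice (fun x => u x + v x) := ⟨hu.1.add hv.1, hu.2.add hv.2⟩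
lemma Nice.sub {u v : E2 → ℂ} (hu : Nice u) (hv : Nice v) : Nice (fun x => u x - v x) := ⟨hu.1.sub hv.1, hu.2.sub hv.2⟩
lemma Nice.const_mul {u : E2 → ℂ} (hu : Nice u) (c : ℂ) : Nice (fun x => c * u x) := ⟨hu.1.const_mul c, hu.2.const_mul c⟩

/-- square norm -/
noncomputable def n2 (u : E2 → ℂ) : ℝ := (∫ x, ‖u x‖ ^ (2:ℝ)) ^ (1 / (2:ℝ))

lemma n2_nonneg (u : E2 → ℂ) : 0 ≤ n2 u := by unfold n2; positivity

lemma n2_eq {u : E2 → ℂ} (h : MemLp u 2) : n2 u = (eLpNorm u 2 volume).toReal := by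
  rw [MemLp.eLpNorm_eq_integral_rpow_norm (by norm_num) (by norm_num) h, ENNReal.toReal_ofReal (by positivity)]
  simp [n2]

lemma n2_eF {u : E2 → ℂ} (h : Nice u) : n2 (eF u) = n2 u := by
  rw [n2_eq h.2, n2_eq (eF_memLp h.1 h.2), eF_plancherel h.1 h.2]

lemma memLp_neg {u : E2 → ℂ} (h : MemLp u 2) : MemLp (fun x => u (-x)) 2 :=
  h.comp_measurePreserving (Measure.measurePreserving_neg (volume : Measure E2))

lemma n2_neg (u : E2 → ℂ) : n2 (fun x => u (-x)) = n2 u := by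
  unfold n2
  rw [integral_neg_eq_self (fun x : E2 => ‖u x‖ ^ (2:ℝ))]

lemma cs_bound {m a b : E2 → ℂ} (hm : ∀ x, ‖m x‖ ≤ 1) (hmc : AEStronglyMeasurable m volume) (ha : MemLp a 2) (hb : MemLp b 2) :
    Integrable (fun x => m x * a x * b x) ∧ ‖∫ x, m x * a x * b x‖ ≤ n2 a * n2 b := by
  have hab : Integrable (fun x => a x * b x) := ha.integrable_mul hb
  have hI : Integrable (fun x => m x * a x * b x) := by
    refine hab.norm.mono' ((hmc.mul ha.1).mul hb.1) ?_
    filter_upwards with x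
    rw [norm_mul, norm_mul, norm_mul]
    have := mul_le_mul_of_nonneg_right (hm x) (norm_nonneg (a x))
    rw [one_mul] at this
    exact mul_le_mul_of_nonneg_right this (norm_nonneg _)
  refine ⟨hI, ?_⟩
  refine (norm_integral_le_integral_norm _).trans ?_
  refine le_trans (integral_mono hI.norm hab.norm ?_) ?_
  · intro x
    simp only [norm_mul]
    have := mul_le_mul_of_nonneg_right (hm x) (norm_nonneg (a x))
    rw [one_mul] at this
    exact mul_le_mul_of_nonneg_right this (norm_nonneg _)
  · have := integral_mul_norm_le_Lp_mul_Lq (μ := volume) (f := a) (g := b) (p := 2) (q := 2) (Real.HolderConjugate.two_two) (by simpa using ha) (by simpa using hb)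
    simp only [norm_mul]
    exact this

/-- The bilinear form -/
noncomputable def bB (τ μ : ℝ) (z : ℂ) (u v : E2 → ℂ) : ℂ := ∫ ξ : E2, mK τ μ z ξ * eF u ξ * eF v (-ξ)

lemma mK_le_one {τ μ : ℝ} (hμ : 0 ≤ μ) {z : ℂ} (hz : 0 ≤ z.re) (ξ : E2) : ‖mK τ μ z ξ‖ ≤ 1 := by
  rw [mK_norm hμ]
  apply Real.rpow_le_one_of_one_le_of_nonpos
  · have : 0 ≤ μ * ‖ξ‖ ^ 2 / 3 := by positivity
    linarith
  · linarith

lemma bB_integrable {τ μ : ℝ} (hμ : 0 ≤ μ) {z : ℂ} (hz : 0 ≤ z.re) {u v : E2 → ℂ} (hu : Nice u) (hv : Nice v) :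
    Integrable (fun ξ : E2 => mK τ μ z ξ * eF u ξ * eF v (-ξ)) :=
  (cs_bound (mK_le_one hμ hz) (mK_continuous hμ z).aestronglyMeasurable (eF_memLp hu.1 hu.2) (memLp_neg (eF_memLp hv.1 hv.2))).1

lemma bB_bound0 {τ μ : ℝ} (hμ : 0 ≤ μ) {z : ℂ} (hz : 0 ≤ z.re) {u v : E2 → ℂ} (hu : Nice u) (hv : Nice v) :
    ‖bB τ μ z u v‖ ≤ n2 u * n2 v := by
  have := (cs_bound (mK_le_one (τ := τ) hμ hz) (mK_continuous hμ z).aestronglyMeasurable (eF_memLp hu.1 hu.2) (memLp_neg (eF_memLp hv.1 hv.2))).2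
  rw [n2_neg, n2_eF hu, n2_eF hv] at this
  exact this

lemma bB_bound1 {τ μ : ℝ} (hμ : 0 < μ) (hμ1 : μ ≤ 1) (hτ : τ ≠ 0) {z : ℂ} (hz : z.re = 1) {u v : E2 → ℂ} (hu : Integrable u) (hv : Integrable v) :
    ‖bB τ μ z u v‖ ≤ (2 * π)⁻¹ ^ 2 * (50000 * π * (1 + ‖z‖) ^ 2 / (√μ * |τ|)) * ((∫ x, ‖u x‖) * ∫ x, ‖v x‖) := by
  set K := 50000 * π * (1 + ‖z‖) ^ 2 / (√μ * |τ|) with hK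
  let H : E2 → E2 × E2 → ℂ := fun ξ w => mK τ μ z ξ * (Complex.exp (Complex.I * (⟪w.1 - w.2, ξ⟫_ℝ : ℂ)) * (u w.1 * v w.2))
  have huv : Integrable (fun w : E2 × E2 => u w.1 * v w.2) (volume.prod volume) := hu.mul_prod hv
  have e1 : ∀ ξ : E2, mK τ μ z ξ * eF u ξ * eF v (-ξ) = ((((2 * π)⁻¹ : ℝ) : ℂ)) ^ 2 * ∫ w, H ξ w ∂(volume.prod volume) := by
    intro ξ
    have : ∀ w, H ξ w = mK τ μ z ξ * ((Complex.exp (Complex.I * (⟪w.1, ξ⟫_ℝ : ℂ)) * u w.1) * (Complex.exp (Complex.I * (⟪w.2, -ξ⟫_ℝ : ℂ)) * v w.2)) := by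
      intro w
      have h3 : Complex.exp (Complex.I * (⟪w.1 - w.2, ξ⟫_ℝ : ℂ)) = Complex.exp (Complex.I * (⟪w.1, ξ⟫_ℝ : ℂ)) * Complex.exp (Complex.I * (⟪w.2, -ξ⟫_ℝ : ℂ)) := by
        rw [← Complex.exp_add, inner_sub_left, inner_neg_right]
        congr 1; push_cast; ring
      simp only [H, h3]; ring
    simp only [this]
    rw [integral_const_mul, integral_prod_mul (fun x : E2 => Complex.exp (Complex.I * (⟪x, ξ⟫_ℝ : ℂ)) * u x) (fun x : E2 => Complex.exp (Complex.I * (⟪x, -ξ⟫_ℝ : ℂ)) * v x)]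
    unfold eF
    ring
  have hIntg : Integrable (Function.uncurry H) (volume.prod (volume.prod volume)) := by
    have h0 := (mK_integrable (τ := τ) hμ hμ1 hz).mul_prod huv
    refine h0.norm.mono' ?_ ?_
    · have e2 : Function.uncurry H = fun p : E2 × (E2 × E2) => Complex.exp (Complex.I * (⟪p.2.1 - p.2.2, p.1⟫_ℝ : ℂ)) * (mK τ μ z p.1 * (u p.2.1 * v p.2.2)) := by
        ext p; simp only [H, Function.uncurry]; ring
      rw [e2]
      refine AEStronglyMeasurable.mul ?_ h0.1
      apply Continuous.aestronglyMeasurable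
      fun_prop
    · filter_upwards with p
      simp only [H, Function.uncurry, norm_mul, norm_expI, one_mul]
      exact le_rfl
  unfold bB
  simp only [e1]
  rw [integral_const_mul, integral_integral_swap hIntg, norm_mul, norm_pow, Complex.norm_real, Real.norm_eq_abs, abs_of_pos (show 0 < (2 * π)⁻¹ by positivity), mul_assoc]
  refine mul_le_mul_of_nonneg_left ?_ (by positivity)
  have e3 : ∀ w : E2 × E2, ‖∫ ξ, H ξ w‖ ≤ K * (‖u w.1‖ * ‖v w.2‖) := by
    intro w
    have : ∀ ξ, H ξ w = (Complex.exp (Complex.I * (⟪w.1 - w.2, ξ⟫_ℝ : ℂ)) * mK τ μ z ξ) * (u w.1 * v w.2) := by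
      intro ξ; simp only [H]; ring
    simp only [this]
    rw [integral_mul_const, norm_mul, norm_mul]
    exact mul_le_mul_of_nonneg_right (kernel_bound hμ hτ hz _) (by positivity)
  have hi2 : Integrable (fun w : E2 × E2 => K * (‖u w.1‖ * ‖v w.2‖)) (volume.prod volume) := (hu.norm.mul_prod hv.norm).const_mul K
  refine (norm_integral_le_of_norm_le hi2 (Filter.Eventually.of_forall e3)).trans (le_of_eq ?_)
  rw [integral_const_mul, integral_prod_mul (fun x : E2 => ‖u x‖) (fun x : E2 => ‖v x‖)]

open MeasureTheory Real Complex
open scoped ENNReal InnerProductSpace ComplexConjugate Topology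

lemma mK_hasDerivAt {τ μ : ℝ} (hμ : 0 ≤ μ) (ξ : E2) (z : ℂ) :
    HasDerivAt (fun z => mK τ μ z ξ) (mK τ μ z ξ * (Complex.log ((1 + μ * ‖ξ‖ ^ 2 / 3 : ℝ) : ℂ) * (-2))) z := by
  unfold mK
  have h0 : 0 < 1 + μ * ‖ξ‖ ^ 2 / 3 := by positivity
  have h1 : HasDerivAt (fun z : ℂ => -(2 * z)) (-2) z := by
    simpa using ((hasDerivAt_id' z).const_mul (2:ℂ)).fun_neg
  have h2 := h1.const_cpow (c := ((1 + μ * ‖ξ‖ ^ 2 / 3 : ℝ) : ℂ)) (Or.inl (by exact_mod_cast h0.ne'))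
  refine (h2.const_mul (Complex.exp (Complex.I * ((τ * (‖ξ‖ / √(1 + μ * ‖ξ‖ ^ 2 / 3)) : ℝ) : ℂ)))).congr_deriv ?_
  ring

lemma mK_deriv_bound {τ μ : ℝ} (hμ : 0 ≤ μ) (ξ : E2) {z : ℂ} {s : ℝ} (hs : 0 < s) (hz : s ≤ z.re) :
    ‖mK τ μ z ξ * (Complex.log ((1 + μ * ‖ξ‖ ^ 2 / 3 : ℝ) : ℂ) * (-2))‖ ≤ 1 / s := by
  have h0 : 1 ≤ 1 + μ * ‖ξ‖ ^ 2 / 3 := by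
    have : 0 ≤ μ * ‖ξ‖ ^ 2 / 3 := by positivity
    linarith
  rw [norm_mul, mK_norm hμ, ← Complex.ofReal_log (by linarith), norm_mul, Complex.norm_real, Real.norm_eq_abs, abs_of_nonneg (Real.log_nonneg h0)]
  have h1 := Real.log_le_rpow_div (by linarith : 0 ≤ 1 + μ * ‖ξ‖ ^ 2 / 3) (show 0 < 2 * s by linarith)
  have hp : 0 < 1 + μ * ‖ξ‖ ^ 2 / 3 := by linarith
  simp only [norm_neg, Complex.norm_ofNat]
  set W := 1 + μ * ‖ξ‖ ^ 2 / 3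
  calc W ^ (-(2 * z.re)) * (Real.log W * 2) ≤ W ^ (-(2 * s)) * (W ^ (2 * s) / (2 * s) * 2) := by
        apply mul_le_mul
        · exact Real.rpow_le_rpow_of_exponent_le h0 (by linarith)
        · linarith
        · have := Real.log_nonneg h0; linarith
        · positivity
    _ = 1 / s := by
        rw [Real.rpow_neg hp.le]
        have : 0 < W ^ (2 * s) := by positivity
        field_simp

lemma bB_hol {τ μ : ℝ} (hμ : 0 ≤ μ) {u v : E2 → ℂ} (hu : Nice u) (hv : Nice v) :
    DiffContOnCl ℂ (fun z => bB τ μ z u v) (Complex.HadamardThreeLines.verticalStrip 0 1) := by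
  have hG : Integrable (fun ξ : E2 => eF u ξ * eF v (-ξ)) := (eF_memLp hu.1 hu.2).integrable_mul (memLp_neg (eF_memLp hv.1 hv.2))
  have hm : ∀ z, Continuous (fun ξ : E2 => mK τ μ z ξ * eF u ξ * eF v (-ξ)) := fun z =>
    ((mK_continuous hμ z).mul (eF_continuous hu.1)).mul ((eF_continuous hv.1).comp continuous_neg)
  constructor
  · intro z0 hz0
    have hz0' : 0 < z0.re := hz0.1
    have hs : 0 < z0.re / 2 := by linarith
    have hnh : {z : ℂ | z0.re / 2 < z.re} ∈ 𝓝 z0 := by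
      apply (isOpen_lt continuous_const Complex.continuous_re).mem_nhds
      show z0.re / 2 < z0.re
      linarith
    have := hasDerivAt_integral_of_dominated_loc_of_deriv_le (μ := volume) (F := fun (z : ℂ) (ξ : E2) => mK τ μ z ξ * eF u ξ * eF v (-ξ))
      (F' := fun (z : ℂ) (ξ : E2) => mK τ μ z ξ * (Complex.log ((1 + μ * ‖ξ‖ ^ 2 / 3 : ℝ) : ℂ) * (-2)) * eF u ξ * eF v (-ξ))
      (x₀ := z0) (bound := fun ξ => 1 / (z0.re / 2) * ‖eF u ξ * eF v (-ξ)‖) hnh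
      (Filter.Eventually.of_forall fun z => (hm z).aestronglyMeasurable)
      (bB_integrable hμ hz0'.le hu hv) ?_ ?_ (hG.norm.const_mul _) ?_
    · exact this.2.differentiableAt.differentiableWithinAt
    · have hl : Continuous (fun ξ : E2 => Complex.log ((1 + μ * ‖ξ‖ ^ 2 / 3 : ℝ) : ℂ)) := by
        apply Continuous.clog (by fun_prop)
        intro ξ; left; rw [Complex.ofReal_re]; positivity
      exact ((((mK_continuous hμ z0).mul (hl.mul continuous_const)).mul (eF_continuous hu.1)).mul ((eF_continuous hv.1).comp continuous_neg)).aestronglyMeasurable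
    · filter_upwards with ξ z hz
      rw [mul_assoc, norm_mul]
      exact mul_le_mul_of_nonneg_right (mK_deriv_bound hμ ξ hs (le_of_lt hz)) (norm_nonneg _)
    · filter_upwards with ξ z hz
      exact ((mK_hasDerivAt hμ ξ z).mul_const _).mul_const _
  · have hcl : closure (Complex.HadamardThreeLines.verticalStrip 0 1) ⊆ {z : ℂ | 0 ≤ z.re} := by
      apply closure_minimal
      · intro z hz; exact le_of_lt hz.1
      · exact isClosed_le continuous_const Complex.continuous_re
    refine ContinuousOn.mono ?_ hcl
    apply continuousOn_of_dominated (bound := fun ξ => ‖eF u ξ * eF v (-ξ)‖)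
    · intro z _; exact (hm z).aestronglyMeasurable
    · intro z hz
      filter_upwards with ξ
      rw [mul_assoc, norm_mul]
      have := mul_le_mul_of_nonneg_right (mK_le_one (τ := τ) hμ hz ξ) (norm_nonneg (eF u ξ * eF v (-ξ)))
      rwa [one_mul] at this
    · exact hG.norm
    · filter_upwards with ξ
      intro z _
      exact ((((mK_hasDerivAt hμ ξ z).mul_const _).mul_const _).continuousAt).continuousWithinAt

open MeasureTheory Real Complex
open scoped ENNReal InnerProductSpace ComplexConjugate Topology

/-- complex powers used in the analytic family -/
noncomputable def pw (p : ℝ) (z c : ℂ) : ℂ := if c = 0 then 0 else c / (‖c‖ : ℂ) * (‖c‖ : ℂ) ^ ((p : ℂ) * (1 + z) / 2)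

lemma pw_norm {p : ℝ} (hp : 0 < p) {z : ℂ} (hz : 0 ≤ z.re) (c : ℂ) : ‖pw p z c‖ = ‖c‖ ^ (p * (1 + z.re) / 2) := by
  unfold pw
  split_ifs with h
  · rw [h, norm_zero, Real.zero_rpow]; positivity
  · have h0 : 0 < ‖c‖ := norm_pos_iff.2 h
    rw [norm_mul, norm_div, Complex.norm_real, norm_norm, div_self h0.ne', one_mul, Complex.norm_cpow_eq_rpow_re_of_pos h0]
    congr 1
    simp

lemma pw_self {p a : ℝ} (hpa : p * (1 + a) / 2 = 1) (c : ℂ) : pw p a c = c := by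
  unfold pw
  split_ifs with h
  · exact h.symm
  · have h0 : 0 < ‖c‖ := norm_pos_iff.2 h
    have : ((p : ℂ) * (1 + a) / 2) = 1 := by exact_mod_cast hpa
    have h1 : (‖c‖ : ℂ) ≠ 0 := by exact_mod_cast h0.ne'
    rw [this, Complex.cpow_one]
    field_simp

lemma pw_differentiable (p : ℝ) {c : ℂ} : Differentiable ℂ (fun z => pw p z c) := by
  unfold pw
  by_cases h : c = 0
  · simp [h]
  · simp only [h, if_false]
    have h1 : (‖c‖ : ℂ) ≠ 0 := by exact_mod_cast (norm_pos_iff.2 h).ne'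
    apply Differentiable.const_mul
    apply Differentiable.const_cpow (by fun_prop) (Or.inl h1)

/-- level set indicator -/
noncomputable def lv (f : SimpleFunc E2 ℂ) (c : ℂ) (x : E2) : ℂ := (f ⁻¹' {c}).indicator (fun _ => (1:ℂ)) x

lemma lv_nice {f : SimpleFunc E2 ℂ} (hf : Integrable f) {c : ℂ} (hc : c ≠ 0) : Nice (lv f c) := by
  have hm := f.measurableSet_fiber c
  have hfin := SimpleFunc.measure_preimage_lt_top_of_integrable f hf hc
  constructor
  · exact (integrable_indicator_iff hm).2 (integrableOn_const hfin.ne)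
  · exact memLp_indicator_const 2 hm 1 (Or.inr hfin.ne)

/-- nonzero values -/
noncomputable def vs (f : SimpleFunc E2 ℂ) : Finset ℂ := f.range.filter (fun c => c ≠ 0)

lemma lv_sum (f : SimpleFunc E2 ℂ) (p : ℝ) (z : ℂ) (x : E2) : ∑ c ∈ vs f, pw p z c * lv f c x = pw p z (f x) := by
  by_cases h : f x = 0
  · rw [h]
    have : pw p z 0 = 0 := by simp [pw]
    rw [this]
    apply Finset.sum_eq_zero
    intro c hc
    have hc0 : c ≠ 0 := (Finset.mem_filter.1 hc).2
    have : lv f c x = 0 := by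
      unfold lv
      apply Set.indicator_of_notMem
      simp [h, hc0.symm]
    rw [this, mul_zero]
  · rw [Finset.sum_eq_single (f x)]
    · have : lv f (f x) x = 1 := by
        unfold lv
        rw [Set.indicator_of_mem]; simp
      rw [this, mul_one]
    · intro c hc hne
      have : lv f c x = 0 := by
        unfold lv
        apply Set.indicator_of_notMem
        simp [hne.symm]
      rw [this, mul_zero]
    · intro hn
      exfalso; apply hn
      simp [vs, h]

lemma eF_sum {ι : Type} (s : Finset ι) (α : ι → ℂ) (e : ι → E2 → ℂ) (he : ∀ i ∈ s, Integrable (e i)) (ξ : E2) :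
    eF (fun x => ∑ i ∈ s, α i * e i x) ξ = ∑ i ∈ s, α i * eF (e i) ξ := by
  unfold eF
  simp only [Finset.mul_sum]
  rw [integral_finsetSum, Finset.mul_sum]
  · apply Finset.sum_congr rfl
    intro i hi
    have : ∀ x : E2, Complex.exp (Complex.I * (⟪x, ξ⟫_ℝ : ℂ)) * (α i * e i x) = α i * (Complex.exp (Complex.I * (⟪x, ξ⟫_ℝ : ℂ)) * e i x) := by
      intro x; ring
    simp only [this]
    rw [integral_const_mul]; ring
  · intro i hi
    refine ((he i hi).const_mul (α i)).norm.mono' ?_ ?_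
    · apply AEStronglyMeasurable.mul
      · apply Continuous.aestronglyMeasurable; fun_prop
      · exact ((he i hi).const_mul (α i)).1
    · filter_upwards with x
      rw [norm_mul, norm_expI, one_mul]

lemma bB_sum {τ μ : ℝ} (hμ : 0 ≤ μ) {z : ℂ} (hz : 0 ≤ z.re) {ι : Type} (s t : Finset ι) (α β : ι → ℂ) (e e' : ι → E2 → ℂ)
    (he : ∀ i ∈ s, Nice (e i)) (he' : ∀ i ∈ t, Nice (e' i)) :
    bB τ μ z (fun x => ∑ i ∈ s, α i * e i x) (fun x => ∑ i ∈ t, β i * e' i x) = ∑ i ∈ s, ∑ j ∈ t, α i * β j * bB τ μ z (e i) (e' j) := by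
  unfold bB
  simp only [eF_sum s α e (fun i hi => (he i hi).1), eF_sum t β e' (fun i hi => (he' i hi).1)]
  have h1 : ∀ ξ : E2, mK τ μ z ξ * (∑ i ∈ s, α i * eF (e i) ξ) * (∑ j ∈ t, β j * eF (e' j) (-ξ)) =
      ∑ i ∈ s, ∑ j ∈ t, α i * β j * (mK τ μ z ξ * eF (e i) ξ * eF (e' j) (-ξ)) := by
    intro ξ
    rw [mul_assoc, Finset.sum_mul_sum, Finset.mul_sum]
    apply Finset.sum_congr rfl; intro i _
    rw [Finset.mul_sum]
    apply Finset.sum_congr rfl; intro j _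
    ring
  simp only [h1]
  rw [integral_finsetSum]
  · apply Finset.sum_congr rfl; intro i hi
    rw [integral_finsetSum]
    · apply Finset.sum_congr rfl; intro j hj
      rw [integral_const_mul]
    · intro j hj
      exact (bB_integrable hμ hz (he i hi) (he' j hj)).const_mul _
  · intro i hi
    apply integrable_finsetSum
    intro j hj
    exact (bB_integrable hμ hz (he i hi) (he' j hj)).const_mul _

lemma fz_nice {f : SimpleFunc E2 ℂ} (hf : Integrable f) (p : ℝ) (z : ℂ) : Nice (fun x => pw p z (f x)) := by
  have e : (fun x => pw p z (f x)) = fun x => ∑ c ∈ vs f, pw p z c * lv f c x := by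
    ext x; rw [lv_sum]
  rw [e]
  have h : ∀ c ∈ vs f, Nice (lv f c) := fun c hc => lv_nice hf (Finset.mem_filter.1 hc).2
  constructor
  · exact integrable_finsetSum _ fun c hc => (h c hc).1.const_mul _
  · exact memLp_finsetSum _ fun c hc => (h c hc).2.const_mul _

lemma fz_n2 {f : SimpleFunc E2 ℂ} {p : ℝ} (hp : 0 < p) {z : ℂ} (hz : z.re = 0) :
    n2 (fun x => pw p z (f x)) = (∫ x, ‖f x‖ ^ p) ^ (1 / (2:ℝ)) := by
  unfold n2
  congr 2
  ext x
  rw [pw_norm hp hz.ge, hz, ← Real.rpow_mul (norm_nonneg _)]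
  congr 1; ring

lemma fz_n1 {f : SimpleFunc E2 ℂ} {p : ℝ} (hp : 0 < p) {z : ℂ} (hz : z.re = 1) :
    ∫ x, ‖pw p z (f x)‖ = ∫ x, ‖f x‖ ^ p := by
  congr 1
  ext x
  rw [pw_norm hp (by rw [hz]; norm_num), hz]
  congr 1; ring

lemma gauss_bound {z : ℂ} (hz : z.re = 1) : ‖Complex.exp (z ^ 2)‖ * (1 + ‖z‖) ^ 2 ≤ 24 := by
  rw [Complex.norm_exp]
  have h1 : (z ^ 2).re = 1 - z.im ^ 2 := by rw [sq, Complex.mul_re, hz]; ring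
  have h2 : ‖z‖ ^ 2 = 1 + z.im ^ 2 := by rw [← Complex.normSq_eq_norm_sq, Complex.normSq_apply, hz]; ring
  rw [h1, Real.exp_sub]
  have h3 : 1 + z.im ^ 2 ≤ Real.exp (z.im ^ 2) := by linarith [Real.add_one_le_exp (z.im ^ 2)]
  have h4 : (1 + ‖z‖) ^ 2 ≤ 4 * (1 + z.im ^ 2) := by nlinarith [sq_nonneg (‖z‖ - 1), sq_nonneg z.im]
  have h5 := Real.exp_one_lt_d9
  have h6 := Real.exp_pos (z.im ^ 2)
  rw [div_mul_eq_mul_div, div_le_iff₀ h6]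
  have : (1 + ‖z‖) ^ 2 ≤ 4 * Real.exp (z.im ^ 2) := h4.trans (by linarith)
  have h7 := Real.exp_pos 1
  calc Real.exp 1 * (1 + ‖z‖) ^ 2 ≤ 3 * (4 * Real.exp (z.im ^ 2)) := by
        apply mul_le_mul (by linarith) this (by positivity) (by norm_num)
    _ ≤ _ := by nlinarith

/-- constant -/
noncomputable def KS : ℝ := (2 * π)⁻¹ ^ 2 * (50000 * π) * 24

lemma KS_pos : 0 < KS := by unfold KS; positivity

theorem stein_simple {τ μ : ℝ} (hμ : 0 < μ) (hμ1 : μ ≤ 1) (hτ : τ ≠ 0) {a p : ℝ} (ha0 : 0 ≤ a) (ha1 : a ≤ 1) (hpa : p * (1 + a) / 2 = 1)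
    (f g : SimpleFunc E2 ℂ) (hf : Integrable f) (hg : Integrable g) :
    ‖bB τ μ a f g‖ ≤ (KS / (√μ * |τ|)) ^ a * ((∫ x, ‖f x‖ ^ p) * (∫ x, ‖g x‖ ^ p)) ^ (1 / p) := by
  have hp : 0 < p := by
    by_contra h
    have : p * (1 + a) ≤ 0 := mul_nonpos_of_nonpos_of_nonneg (not_lt.1 h) (by linarith)
    linarith
  set X := ∫ x, ‖f x‖ ^ p with hX
  set Y := ∫ x, ‖g x‖ ^ p with hY
  have hX0 : 0 ≤ X := integral_nonneg fun x => by positivity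
  have hY0 : 0 ≤ Y := integral_nonneg fun x => by positivity
  have hs := Real.sqrt_pos.2 hμ
  have ht := abs_pos.2 hτ
  let Φ : ℂ → ℂ := fun z => ∑ c ∈ vs f, ∑ d ∈ vs g, pw p z c * pw p z d * bB τ μ z (lv f c) (lv g d)
  let Ψ : ℂ → ℂ := fun z => Complex.exp (z ^ 2) * Φ z
  have hnf : ∀ c ∈ vs f, Nice (lv f c) := fun c hc => lv_nice hf (Finset.mem_filter.1 hc).2
  have hng : ∀ c ∈ vs g, Nice (lv g c) := fun c hc => lv_nice hg (Finset.mem_filter.1 hc).2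
  have hΦ : ∀ z : ℂ, 0 ≤ z.re → Φ z = bB τ μ z (fun x => pw p z (f x)) (fun x => pw p z (g x)) := by
    intro z hz
    have := bB_sum (τ := τ) hμ.le hz (vs f) (vs g) (pw p z) (pw p z) (lv f) (lv g) hnf hng
    simp only [lv_sum] at this
    exact this.symm
  have hd : DiffContOnCl ℂ Ψ (Complex.HadamardThreeLines.verticalStrip 0 1) := by
    have hΦd : DiffContOnCl ℂ Φ (Complex.HadamardThreeLines.verticalStrip 0 1) := by
      have key : ∀ c ∈ vs f, ∀ d ∈ vs g, DiffContOnCl ℂ (fun z => pw p z c * pw p z d * bB τ μ z (lv f c) (lv g d)) (Complex.HadamardThreeLines.verticalStrip 0 1) := by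
        intro c hc d hd
        have h1 : Differentiable ℂ (fun z => pw p z c * pw p z d) := (pw_differentiable p).mul (pw_differentiable p)
        exact h1.diffContOnCl.smul (bB_hol hμ.le (hnf c hc) (hng d hd))
      constructor
      · apply DifferentiableOn.fun_sum; intro c hc
        apply DifferentiableOn.fun_sum; intro d hd
        exact (key c hc d hd).1
      · apply continuousOn_finsetSum; intro c hc
        apply continuousOn_finsetSum; intro d hd
        exact (key c hc d hd).2
    have h2 : Differentiable ℂ (fun z : ℂ => Complex.exp (z ^ 2)) := by fun_prop
    exact h2.diffContOnCl.smul hΦd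
  have hB : BddAbove ((norm ∘ Ψ) '' Complex.HadamardThreeLines.verticalClosedStrip 0 1) := by
    refine ⟨Real.exp 1 * ∑ c ∈ vs f, ∑ d ∈ vs g, (1 + ‖c‖) ^ p * (1 + ‖d‖) ^ p * (n2 (lv f c) * n2 (lv g d)), ?_⟩
    rintro _ ⟨z, hz, rfl⟩
    have hz0 : 0 ≤ z.re := hz.1
    have hz1 : z.re ≤ 1 := hz.2
    have hpw : ∀ c : ℂ, ‖pw p z c‖ ≤ (1 + ‖c‖) ^ p := by
      intro c
      rw [pw_norm hp hz0]
      calc ‖c‖ ^ (p * (1 + z.re) / 2) ≤ (1 + ‖c‖) ^ (p * (1 + z.re) / 2) := by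
            apply Real.rpow_le_rpow (norm_nonneg _) (by linarith) (by positivity)
        _ ≤ _ := by
            apply Real.rpow_le_rpow_of_exponent_le (by linarith [norm_nonneg c])
            nlinarith
    simp only [Function.comp, Ψ, Φ, norm_mul]
    apply mul_le_mul
    · rw [Complex.norm_exp]
      apply Real.exp_le_exp.2
      rw [sq, Complex.mul_re]; nlinarith [mul_self_nonneg z.im]
    · refine (norm_sum_le _ _).trans (Finset.sum_le_sum fun c hc => (norm_sum_le _ _).trans (Finset.sum_le_sum fun d hd => ?_))
      rw [norm_mul, norm_mul]
      have := bB_bound0 (τ := τ) hμ.le hz0 (hnf c hc) (hng d hd)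
      exact mul_le_mul (mul_le_mul (hpw c) (hpw d) (norm_nonneg _) (by positivity)) this (norm_nonneg _) (by positivity)
    · positivity
    · positivity
  have hb0 : ∀ z ∈ Complex.re ⁻¹' {(0:ℝ)}, ‖Ψ z‖ ≤ X ^ (1 / (2:ℝ)) * Y ^ (1 / (2:ℝ)) := by
    intro z hz
    have hz : z.re = 0 := hz
    simp only [Ψ, norm_mul]
    have h1 : ‖Complex.exp (z ^ 2)‖ ≤ 1 := by
      rw [Complex.norm_exp]
      apply Real.exp_le_one_iff.2
      rw [sq, Complex.mul_re, hz]; nlinarith [mul_self_nonneg z.im]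
    rw [hΦ z hz.ge]
    have h2 := bB_bound0 (τ := τ) hμ.le hz.ge (fz_nice hf p z) (fz_nice hg p z)
    rw [fz_n2 hp hz, fz_n2 hp hz] at h2
    calc _ ≤ 1 * (X ^ (1 / (2:ℝ)) * Y ^ (1 / (2:ℝ))) := mul_le_mul h1 h2 (norm_nonneg _) (by norm_num)
      _ = _ := one_mul _
  have hb1 : ∀ z ∈ Complex.re ⁻¹' {(1:ℝ)}, ‖Ψ z‖ ≤ KS / (√μ * |τ|) * (X * Y) := by
    intro z hz
    have hz : z.re = 1 := hz
    have hz0 : 0 ≤ z.re := by rw [hz]; norm_num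
    simp only [Ψ, norm_mul]
    rw [hΦ z hz0]
    have h2 := bB_bound1 (τ := τ) hμ hμ1 hτ hz (fz_nice hf p z).1 (fz_nice hg p z).1
    rw [fz_n1 hp hz, fz_n1 hp hz] at h2
    have h3 := gauss_bound hz
    calc _ ≤ ‖Complex.exp (z ^ 2)‖ * ((2 * π)⁻¹ ^ 2 * (50000 * π * (1 + ‖z‖) ^ 2 / (√μ * |τ|)) * (X * Y)) := mul_le_mul_of_nonneg_left h2 (norm_nonneg _)
      _ = (‖Complex.exp (z ^ 2)‖ * (1 + ‖z‖) ^ 2) * ((2 * π)⁻¹ ^ 2 * (50000 * π) / (√μ * |τ|) * (X * Y)) := by ring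
      _ ≤ 24 * ((2 * π)⁻¹ ^ 2 * (50000 * π) / (√μ * |τ|) * (X * Y)) := mul_le_mul_of_nonneg_right h3 (by positivity)
      _ = _ := by unfold KS; ring
  have hmain := Complex.HadamardThreeLines.norm_le_interp_of_mem_verticalClosedStrip' (z := (a:ℂ)) (f := Ψ) (l := 0) (u := 1) (by norm_num)
    (by simp [Complex.HadamardThreeLines.verticalClosedStrip, ha0, ha1]) hd hB hb0 hb1
  simp only [Complex.ofReal_re, sub_zero, div_one, Ψ, norm_mul] at hmain
  rw [hΦ _ (by simpa using ha0)] at hmain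
  simp only [pw_self hpa] at hmain
  have h1 : 1 ≤ ‖Complex.exp ((a:ℂ) ^ 2)‖ := by
    rw [Complex.norm_exp]
    apply Real.one_le_exp
    rw [sq, Complex.mul_re]; simp; nlinarith
  have h2 : ‖bB τ μ a f g‖ ≤ ‖Complex.exp ((a:ℂ) ^ 2)‖ * ‖bB τ μ a f g‖ := le_mul_of_one_le_left (norm_nonneg _) h1
  refine h2.trans (hmain.trans (le_of_eq ?_))
  have hKS := KS_pos
  rw [← Real.mul_rpow hX0 hY0, ← Real.rpow_mul (by positivity), Real.mul_rpow (x := KS / (√μ * |τ|)) (y := X * Y) (z := a) (by positivity) (by positivity)]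
  rw [mul_left_comm, ← Real.rpow_add_of_nonneg (by positivity) (by nlinarith) ha0]
  congr 2
  field_simp
  linarith

open MeasureTheory Real Complex
open scoped ENNReal InnerProductSpace ComplexConjugate Topology

/-- bounded measurable with bounded support -/
def Bd (f : E2 → ℂ) : Prop := Measurable f ∧ ∃ M R : ℝ, ∀ x, ‖f x‖ ≤ M ∧ (R < ‖x‖ → f x = 0)

lemma Bd.integrable_of_le {f : E2 → ℂ} (h : Bd f) {g : E2 → ℝ} (hg : AEStronglyMeasurable g volume) {φ : ℝ → ℝ} (hφ : Monotone φ) (hφ0 : φ 0 = 0)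
    (hle : ∀ x, ‖g x‖ ≤ φ ‖f x‖) : Integrable g := by
  obtain ⟨hm, M, R, hb⟩ := h
  have hfin : volume (Metric.closedBall (0:E2) R) < ⊤ := measure_closedBall_lt_top
  have hi : Integrable ((Metric.closedBall (0:E2) R).indicator fun _ => φ M) :=
    (integrable_indicator_iff Metric.isClosed_closedBall.measurableSet).2 (integrableOn_const hfin.ne)
  refine hi.mono' hg ?_
  filter_upwards with x
  by_cases hx : x ∈ Metric.closedBall (0:E2) R
  · rw [Set.indicator_of_mem hx]
    exact (hle x).trans (hφ (hb x).1)
  · rw [Set.indicator_of_notMem hx]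
    have : f x = 0 := (hb x).2 (by simpa using hx)
    have h2 := hle x
    rw [this, norm_zero, hφ0] at h2
    exact h2

lemma mono_pw {p C : ℝ} (hp : 0 < p) (hC : 0 ≤ C) : Monotone (fun s : ℝ => C * (max s 0) ^ p) := by
  intro s t hst
  apply mul_le_mul_of_nonneg_left _ hC
  apply Real.rpow_le_rpow (by positivity) (max_le_max hst le_rfl) hp.le

lemma Bd.pow {f : E2 → ℂ} (h : Bd f) {p : ℝ} (hp : 0 < p) {C : ℝ} (hC : 0 ≤ C) : Integrable (fun x => C * ‖f x‖ ^ p) := by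
  refine h.integrable_of_le ?_ (mono_pw hp hC) (by simp [Real.zero_rpow hp.ne']) ?_
  · exact ((h.1.norm.pow_const p).const_mul C).aestronglyMeasurable
  · intro x
    rw [max_eq_left (norm_nonneg _), Real.norm_eq_abs, abs_of_nonneg (by positivity)]

lemma Bd.nice {f : E2 → ℂ} (h : Bd f) : Nice f := by
  constructor
  · have := h.pow (p := 1) (by norm_num) (zero_le_one (α := ℝ))
    simp only [Real.rpow_one, one_mul] at this
    exact (integrable_norm_iff h.1.aestronglyMeasurable).1 this
  · have := h.pow (p := 2) (by norm_num) (zero_le_one (α := ℝ))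
    rw [← integrable_norm_rpow_iff h.1.aestronglyMeasurable (by norm_num) (by norm_num)]
    simpa using this

lemma eF_sub {u v : E2 → ℂ} (hu : Integrable u) (hv : Integrable v) (ξ : E2) : eF (fun x => u x - v x) ξ = eF u ξ - eF v ξ := by
  have h : ∀ w : E2 → ℂ, Integrable w → Integrable (fun x : E2 => Complex.exp (Complex.I * (⟪x, ξ⟫_ℝ : ℂ)) * w x) := by
    intro w hw
    refine hw.norm.mono' ?_ ?_
    · apply AEStronglyMeasurable.mul _ hw.1
      apply Continuous.aestronglyMeasurable; fun_prop
    · filter_upwards with x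
      rw [norm_mul, norm_expI, one_mul]
  unfold eF
  rw [← mul_sub, ← integral_sub (h u hu) (h v hv)]
  simp only [mul_sub]

lemma bB_sub {τ μ : ℝ} (hμ : 0 ≤ μ) {z : ℂ} (hz : 0 ≤ z.re) {u u' v v' : E2 → ℂ} (hu : Nice u) (hv : Nice v) (hu' : Nice u') (hv' : Nice v') :
    bB τ μ z u v - bB τ μ z u' v' = bB τ μ z (fun x => u x - u' x) v + bB τ μ z u' (fun x => v x - v' x) := by
  unfold bB
  rw [← integral_sub (bB_integrable hμ hz hu hv) (bB_integrable hμ hz hu' hv'), ← integral_add (bB_integrable hμ hz (hu.sub hu') hv) (bB_integrable hμ hz hu' (hv.sub hv'))]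
  congr 1; ext ξ
  rw [eF_sub hu.1 hu'.1, eF_sub hv.1 hv'.1]; ring

/-- approximating simple functions -/
noncomputable def ap (f : E2 → ℂ) (hf : Measurable f) (n : ℕ) : SimpleFunc E2 ℂ := SimpleFunc.approxOn f hf Set.univ 0 (Set.mem_univ _) n

lemma ap_tendsto (f : E2 → ℂ) (hf : Measurable f) (x : E2) : Filter.Tendsto (fun n => ap f hf n x) Filter.atTop (𝓝 (f x)) :=
  SimpleFunc.tendsto_approxOn hf (Set.mem_univ _) (by simp)

lemma ap_le (f : E2 → ℂ) (hf : Measurable f) (n : ℕ) (x : E2) : ‖ap f hf n x‖ ≤ 2 * ‖f x‖ := by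
  have := SimpleFunc.norm_approxOn_zero_le hf (Set.mem_univ (0:ℂ)) x n
  unfold ap; linarith

lemma ap_integrable {f : E2 → ℂ} (h : Bd f) (n : ℕ) : Integrable (ap f h.1 n) := by
  refine (h.nice.1.norm.const_mul 2).mono' (SimpleFunc.aestronglyMeasurable _) ?_
  filter_upwards with x using ap_le f h.1 n x

lemma ap_bd {f : E2 → ℂ} (h : Bd f) (n : ℕ) : Bd (ap f h.1 n) := by
  refine ⟨SimpleFunc.measurable _, ?_⟩
  obtain ⟨M, R, hb⟩ := h.2
  refine ⟨2 * M, R, fun x => ⟨(ap_le f h.1 n x).trans (by linarith [(hb x).1]), fun hx => ?_⟩⟩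
  have := ap_le f h.1 n x
  rw [(hb x).2 hx, norm_zero, mul_zero] at this
  exact norm_le_zero_iff.1 this

lemma ap_pow_tendsto {f : E2 → ℂ} (h : Bd f) {p : ℝ} (hp : 0 < p) :
    Filter.Tendsto (fun n => ∫ x, ‖ap f h.1 n x‖ ^ p) Filter.atTop (𝓝 (∫ x, ‖f x‖ ^ p)) := by
  apply tendsto_integral_of_dominated_convergence (fun x => (2:ℝ) ^ p * ‖f x‖ ^ p)
  · intro n; have := (ap f h.1 n).measurable
    exact (this.norm.pow_const p).aestronglyMeasurable
  · exact h.pow hp (by positivity)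
  · intro n; filter_upwards with x
    rw [Real.norm_eq_abs, abs_of_nonneg (by positivity), ← Real.mul_rpow (by norm_num) (norm_nonneg _)]
    exact Real.rpow_le_rpow (norm_nonneg _) (ap_le f h.1 n x) hp.le
  · filter_upwards with x
    exact ((ap_tendsto f h.1 x).norm).rpow_const (Or.inr hp.le)

lemma ap_sub_tendsto {f : E2 → ℂ} (h : Bd f) :
    Filter.Tendsto (fun n => n2 (fun x => f x - ap f h.1 n x)) Filter.atTop (𝓝 0) := by
  have h1 : Filter.Tendsto (fun n => ∫ x, ‖f x - ap f h.1 n x‖ ^ (2:ℝ)) Filter.atTop (𝓝 (∫ x : E2, (0:ℝ))) := by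
    apply tendsto_integral_of_dominated_convergence (fun x => (3:ℝ) ^ (2:ℝ) * ‖f x‖ ^ (2:ℝ))
    · intro n; have := (ap f h.1 n).measurable
      exact ((h.1.sub this).norm.pow_const _).aestronglyMeasurable
    · exact h.pow (by norm_num) (by positivity)
    · intro n; filter_upwards with x
      rw [Real.norm_eq_abs, abs_of_nonneg (by positivity), ← Real.mul_rpow (by norm_num) (norm_nonneg _)]
      refine Real.rpow_le_rpow (norm_nonneg _) ?_ (by norm_num)
      have := norm_sub_le (f x) (ap f h.1 n x)
      linarith [ap_le f h.1 n x]
    · filter_upwards with x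
      have := ((tendsto_const_nhds (x := f x)).sub (ap_tendsto f h.1 x)).norm.rpow_const (p := 2) (Or.inr (by norm_num))
      simpa using this
  have := h1.rpow_const (p := 1 / (2:ℝ)) (Or.inr (by norm_num))
  simpa [n2] using this

theorem stein_bd {τ μ : ℝ} (hμ : 0 < μ) (hμ1 : μ ≤ 1) (hτ : τ ≠ 0) {a p : ℝ} (ha0 : 0 ≤ a) (ha1 : a ≤ 1) (hpa : p * (1 + a) / 2 = 1)
    {f g : E2 → ℂ} (hf : Bd f) (hg : Bd g) :
    ‖bB τ μ a f g‖ ≤ (KS / (√μ * |τ|)) ^ a * ((∫ x, ‖f x‖ ^ p) * (∫ x, ‖g x‖ ^ p)) ^ (1 / p) := by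
  have hp : 0 < p := by
    by_contra h
    have : p * (1 + a) ≤ 0 := mul_nonpos_of_nonpos_of_nonneg (not_lt.1 h) (by linarith)
    linarith
  have hz : 0 ≤ ((a:ℝ):ℂ).re := by simpa using ha0
  have hlim : Filter.Tendsto (fun n => bB τ μ a (ap f hf.1 n) (ap g hg.1 n)) Filter.atTop (𝓝 (bB τ μ a f g)) := by
    rw [tendsto_iff_norm_sub_tendsto_zero]
    have hb : Filter.Tendsto (fun n => n2 (fun x => f x - ap f hf.1 n x) * n2 g + n2 (ap f hf.1 n) * n2 (fun x => g x - ap g hg.1 n x)) Filter.atTop (𝓝 (0 * n2 g + n2 f * 0)) := by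
      refine ((ap_sub_tendsto hf).mul_const _).add (Filter.Tendsto.mul ?_ (ap_sub_tendsto hg))
      have := (ap_pow_tendsto hf (p := 2) (by norm_num)).rpow_const (p := 1 / (2:ℝ)) (Or.inr (by norm_num))
      exact this
    simp only [zero_mul, mul_zero, add_zero] at hb
    refine squeeze_zero (fun n => norm_nonneg _) (fun n => ?_) hb
    rw [norm_sub_rev, bB_sub hμ.le hz hf.nice hg.nice (ap_bd hf n).nice (ap_bd hg n).nice]
    refine (norm_add_le _ _).trans (add_le_add ?_ ?_)
    · exact bB_bound0 hμ.le hz (hf.nice.sub (ap_bd hf n).nice) hg.nice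
    · exact bB_bound0 hμ.le hz (ap_bd hf n).nice (hg.nice.sub (ap_bd hg n).nice)
  have hR : Filter.Tendsto (fun n => (KS / (√μ * |τ|)) ^ a * ((∫ x, ‖ap f hf.1 n x‖ ^ p) * (∫ x, ‖ap g hg.1 n x‖ ^ p)) ^ (1 / p)) Filter.atTop
      (𝓝 ((KS / (√μ * |τ|)) ^ a * ((∫ x, ‖f x‖ ^ p) * (∫ x, ‖g x‖ ^ p)) ^ (1 / p))) := by
    refine Filter.Tendsto.const_mul _ (Filter.Tendsto.rpow_const ?_ (Or.inr (by positivity)))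
    exact (ap_pow_tendsto hf hp).mul (ap_pow_tendsto hg hp)
  exact le_of_tendsto_of_tendsto' hlim.norm hR fun n => stein_simple hμ hμ1 hτ ha0 ha1 hpa _ _ (ap_integrable hf n) (ap_integrable hg n)

open MeasureTheory Real Complex
open scoped ENNReal InnerProductSpace ComplexConjugate Topology

lemma lintegral_abs (f : ℝ → ℝ≥0∞) : ∫⁻ s, f |s| = 2 * ∫⁻ s in Set.Ioi (0:ℝ), f s := by
  rw [← lintegral_add_compl (fun s => f |s|) (measurableSet_Ioi (a := (0:ℝ))), Set.compl_Ioi, ← setLIntegral_congr (Iio_ae_eq_Iic (a := (0:ℝ)))]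
  have h1 : ∫⁻ s in Set.Ioi (0:ℝ), f |s| = ∫⁻ s in Set.Ioi (0:ℝ), f s := by
    apply setLIntegral_congr_fun measurableSet_Ioi
    intro s hs
    simp only [abs_of_pos (Set.mem_Ioi.1 hs)]
  have h2 : ∫⁻ s in Set.Iio (0:ℝ), f |s| = ∫⁻ s in Set.Ioi (0:ℝ), f |s| := by
    have := (Measure.measurePreserving_neg (volume : Measure ℝ)).setLIntegral_comp_preimage_emb (MeasurableEquiv.neg ℝ).measurableEmbedding (fun s => f |s|) (Set.Ioi 0)
    rw [← this]
    simp
  rw [h2, h1, two_mul]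

lemma near_int {a R : ℝ} (ha : a < 1) (hR : 0 < R) (t : ℝ) :
    ∫⁻ s, (if |t - s| < R then ENNReal.ofReal (|t - s| ^ (-a)) else 0) = ENNReal.ofReal (2 * (R ^ (1 - a) / (1 - a))) := by
  rw [lintegral_sub_left_eq_self (fun s => if |s| < R then ENNReal.ofReal (|s| ^ (-a)) else 0) t]
  rw [lintegral_abs (fun s => if s < R then ENNReal.ofReal (s ^ (-a)) else 0)]
  have h1 : ∫⁻ s in Set.Ioi (0:ℝ), (if s < R then ENNReal.ofReal (s ^ (-a)) else 0) = ∫⁻ s in Set.Ioo (0:ℝ) R, ENNReal.ofReal (s ^ (-a)) := by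
    rw [← Set.Iio_inter_Ioi, ← setLIntegral_indicator measurableSet_Iio]
    apply lintegral_congr
    intro s
    simp [Set.indicator_apply]
  have hi : IntervalIntegrable (fun s : ℝ => s ^ (-a)) volume 0 R := intervalIntegral.intervalIntegrable_rpow' (by linarith)
  rw [h1, ← setLIntegral_congr (Ioo_ae_eq_Ioc (a := (0:ℝ)) (b := R)).symm, ← ofReal_integral_eq_lintegral_ofReal]
  · rw [← intervalIntegral.integral_of_le hR.le, integral_rpow (Or.inl (by linarith)), Real.zero_rpow (by linarith), ENNReal.ofReal_mul (by norm_num), sub_zero, show -a + 1 = 1 - a by ring]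
    simp
  · exact (intervalIntegrable_iff_integrableOn_Ioc_of_le hR.le).1 hi
  · filter_upwards [ae_restrict_mem measurableSet_Ioc] with s hs
    have : 0 < s := hs.1
    positivity

lemma far_int {R : ℝ} (hR : 0 < R) (t : ℝ) :
    ∫⁻ s, (if |t - s| < R then 0 else ENNReal.ofReal (|t - s| ^ (-2:ℝ))) = ENNReal.ofReal (2 / R) := by
  rw [lintegral_sub_left_eq_self (fun s => if |s| < R then 0 else ENNReal.ofReal (|s| ^ (-2:ℝ))) t]
  rw [lintegral_abs (fun s => if s < R then 0 else ENNReal.ofReal (s ^ (-2:ℝ)))]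
  have h1 : ∫⁻ s in Set.Ioi (0:ℝ), (if s < R then 0 else ENNReal.ofReal (s ^ (-2:ℝ))) = ∫⁻ s in Set.Ici R, ENNReal.ofReal (s ^ (-2:ℝ)) := by
    have : Set.Ici R = Set.Ici R ∩ Set.Ioi 0 := by
      ext s; simp; intro h; linarith
    rw [this, ← setLIntegral_indicator measurableSet_Ici]
    apply lintegral_congr
    intro s
    simp only [Set.indicator_apply, Set.mem_Ici]
    by_cases h : s < R
    · simp [h, not_le.2 h]
    · simp [h, not_lt.1 h]
  rw [h1, ← setLIntegral_congr (Ioi_ae_eq_Ici (a := R)), ← ofReal_integral_eq_lintegral_ofReal]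
  · rw [integral_Ioi_rpow_of_lt (by norm_num) hR, show (2:ℝ) / R = 2 * (1 / R) by ring, ENNReal.ofReal_mul (by norm_num)]
    congr 1
    · simp
    · congr 1
      norm_num [Real.rpow_neg_one]
  · exact integrableOn_Ioi_rpow_of_lt (by norm_num) hR
  · filter_upwards [ae_restrict_mem measurableSet_Ioi] with s hs
    have : 0 < s := hR.trans hs
    positivity

/-- constant -/
noncomputable def CH (a : ℝ) : ℝ := 2 / (1 - a) + 2 ^ (a / 2)

lemma CH_pos {a : ℝ} (ha1 : a < 1) : 0 < CH a := by
  unfold CH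
  have : 0 < 1 - a := by linarith
  positivity

lemma hls_J {a p : ℝ} (ha0 : 0 < a) (ha1 : a < 1) (hp : p = 2 / (2 - a)) {φ : ℝ → ℝ} (hm : Measurable φ) (h0 : ∀ t, 0 ≤ φ t) {A : ℝ} (hA : 0 < A)
    (hI : ∫⁻ t, ENNReal.ofReal (φ t ^ p) = ENNReal.ofReal (A ^ p)) {v : ℝ} (hv : 0 < v) (t : ℝ) :
    ∫⁻ s, (if φ s ≤ v then ENNReal.ofReal (φ s * |t - s| ^ (-a)) else 0) ≤ ENNReal.ofReal (CH a * (v ^ (p - 1) * A ^ (p * (1 - a)))) := by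
  have h2a : 0 < 2 - a := by linarith
  have hp0 : 0 < p := by rw [hp]; positivity
  have hR0 : 0 < A / v := by positivity
  set R := (A / v) ^ p with hR
  have hRp : 0 < R := by positivity
  have hpc : p.HolderConjugate (2 / a) := by
    rw [Real.holderConjugate_iff]
    constructor
    · rw [hp, lt_div_iff₀ h2a]; linarith
    · rw [hp]; field_simp; ring
  have hb : ∀ s, (if φ s ≤ v then ENNReal.ofReal (φ s * |t - s| ^ (-a)) else 0) ≤
      ENNReal.ofReal v * (if |t - s| < R then ENNReal.ofReal (|t - s| ^ (-a)) else 0) + ENNReal.ofReal (φ s) * (if |t - s| < R then 0 else ENNReal.ofReal (|t - s| ^ (-a))) := by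
    intro s
    have hk : 0 ≤ |t - s| ^ (-a) := by positivity
    split_ifs with h1 h2
    · rw [mul_zero, add_zero, ← ENNReal.ofReal_mul hv.le]
      exact ENNReal.ofReal_le_ofReal (mul_le_mul_of_nonneg_right h1 hk)
    · rw [mul_zero, zero_add, ← ENNReal.ofReal_mul (h0 s)]
    · exact zero_le
    · exact zero_le
  refine (lintegral_mono hb).trans ?_
  have hmK : Measurable fun s : ℝ => (if |t - s| < R then ENNReal.ofReal (|t - s| ^ (-a)) else 0) := by
    apply Measurable.ite (measurableSet_lt (by fun_prop) (by fun_prop)) (by fun_prop) (by fun_prop)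
  have hmK2 : Measurable fun s : ℝ => (if |t - s| < R then 0 else ENNReal.ofReal (|t - s| ^ (-a))) := by
    apply Measurable.ite (measurableSet_lt (by fun_prop) (by fun_prop)) (by fun_prop) (by fun_prop)
  rw [lintegral_add_left (by fun_prop), lintegral_const_mul _ hmK, near_int ha1 hRp]
  have hfar : ∫⁻ s, ENNReal.ofReal (φ s) * (if |t - s| < R then 0 else ENNReal.ofReal (|t - s| ^ (-a))) ≤ ENNReal.ofReal (A * (2 / R) ^ (a / 2)) := by
    have := ENNReal.lintegral_mul_le_Lp_mul_Lq volume hpc (f := fun s => ENNReal.ofReal (φ s)) (g := fun s => (if |t - s| < R then 0 else ENNReal.ofReal (|t - s| ^ (-a)))) (by fun_prop) hmK2.aemeasurable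
    refine this.trans (le_of_eq ?_)
    have e1 : ∀ s, ENNReal.ofReal (φ s) ^ p = ENNReal.ofReal (φ s ^ p) := fun s => ENNReal.ofReal_rpow_of_nonneg (h0 s) hp0.le
    have e2 : ∀ s, (if |t - s| < R then 0 else ENNReal.ofReal (|t - s| ^ (-a))) ^ (2 / a) = (if |t - s| < R then 0 else ENNReal.ofReal (|t - s| ^ (-2:ℝ))) := by
      intro s
      split_ifs with h
      · exact ENNReal.zero_rpow_of_pos (by positivity)
      · rw [ENNReal.ofReal_rpow_of_nonneg (by positivity) (by positivity), ← Real.rpow_mul (abs_nonneg _)]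
        congr 2; field_simp
    simp only [e1, e2]
    rw [hI, far_int hRp, ENNReal.ofReal_rpow_of_nonneg (by positivity) (by positivity), ENNReal.ofReal_rpow_of_nonneg (by positivity) (by positivity), ← ENNReal.ofReal_mul (by positivity), ← Real.rpow_mul hA.le]
    congr 2
    · rw [mul_one_div_cancel hp0.ne', Real.rpow_one]
    · congr 1; field_simp
  refine (add_le_add le_rfl hfar).trans ?_
  have h1a : 0 < 1 - a := by linarith
  rw [← ENNReal.ofReal_mul hv.le, ← ENNReal.ofReal_add (by positivity) (by positivity)]
  apply ENNReal.ofReal_le_ofReal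
  apply le_of_eq
  have q1 : v * R ^ (1 - a) = v ^ (p - 1) * A ^ (p * (1 - a)) := by
    rw [hR, ← Real.rpow_mul hR0.le, Real.div_rpow hA.le hv.le]
    have : v = v ^ (p - 1) * v ^ (p * (1 - a)) := by
      rw [← Real.rpow_add hv]
      conv_lhs => rw [← Real.rpow_one v]
      congr 1
      rw [hp]; field_simp; ring
    have hvp : 0 < v ^ (p * (1 - a)) := by positivity
    rw [mul_div_assoc', div_eq_iff hvp.ne']
    conv_lhs => enter [1]; rw [this]
    ring
  have q2 : A * (2 / R) ^ (a / 2) = 2 ^ (a / 2) * (v ^ (p - 1) * A ^ (p * (1 - a))) := by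
    rw [Real.div_rpow (by norm_num) hRp.le, hR, ← Real.rpow_mul hR0.le, Real.div_rpow hA.le hv.le]
    have e1 : p * (a / 2) = p - 1 := by rw [hp]; field_simp; ring
    have e2 : A = A ^ (p * (1 - a)) * A ^ (p - 1) := by
      rw [← Real.rpow_add hA]
      conv_lhs => rw [← Real.rpow_one A]
      congr 1
      rw [hp]; field_simp; ring
    rw [e1]
    have hvp : 0 < v ^ (p - 1) := by positivity
    have hap : 0 < A ^ (p - 1) := by positivity
    rw [div_div_eq_mul_div, mul_div_assoc', div_eq_iff hap.ne']
    conv_lhs => enter [1]; rw [e2]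
    ring
  rw [q2, show v * (2 * (R ^ (1 - a) / (1 - a))) = 2 / (1 - a) * (v * R ^ (1 - a)) by ring, q1]
  unfold CH; ring

theorem hls {a p : ℝ} (ha0 : 0 < a) (ha1 : a < 1) (hp : p = 2 / (2 - a)) {φ : ℝ → ℝ} (hm : Measurable φ) (h0 : ∀ t, 0 ≤ φ t) {A : ℝ} (hA : 0 ≤ A)
    (hI : ∫⁻ t, ENNReal.ofReal (φ t ^ p) = ENNReal.ofReal (A ^ p)) :
    ∫⁻ t, ∫⁻ s, ENNReal.ofReal (φ t * φ s * |t - s| ^ (-a)) ≤ ENNReal.ofReal (2 * CH a * A ^ 2) := by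
  have h2a : 0 < 2 - a := by linarith
  have hp0 : 0 < p := by rw [hp]; positivity
  rcases hA.eq_or_lt with hA | hA
  · rw [← hA, Real.zero_rpow hp0.ne', ENNReal.ofReal_zero, lintegral_eq_zero_iff (by fun_prop)] at hI
    have : ∫⁻ t, ∫⁻ s, ENNReal.ofReal (φ t * φ s * |t - s| ^ (-a)) = ∫⁻ t : ℝ, 0 := by
      apply lintegral_congr_ae
      filter_upwards [hI] with t ht
      have h1 : φ t = 0 := by
        by_contra hne
        have hpos : 0 < φ t := lt_of_le_of_ne (h0 t) (Ne.symm hne)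
        have : 0 < φ t ^ p := by positivity
        simp only [Pi.zero_apply, ENNReal.ofReal_eq_zero] at ht
        linarith
      simp [h1]
    rw [this]; simp
  · set H : ℝ → ℝ → ℝ≥0∞ := fun t s => if φ s ≤ φ t then ENNReal.ofReal (φ t * φ s * |t - s| ^ (-a)) else 0 with hH
    have hHm : Measurable (Function.uncurry H) := by
      apply Measurable.ite (measurableSet_le (by fun_prop) (by fun_prop)) (by fun_prop) (by fun_prop)
    have hsym : ∀ t s, ENNReal.ofReal (φ t * φ s * |t - s| ^ (-a)) ≤ H t s + H s t := by
      intro t s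
      rcases le_total (φ s) (φ t) with h | h
      · refine le_trans (le_of_eq ?_) le_self_add
        simp [hH, h]
      · refine le_trans (le_of_eq ?_) le_add_self
        simp only [hH, h, if_true]
        rw [abs_sub_comm, mul_comm (φ t)]
    have hone : ∫⁻ t, ∫⁻ s, H t s ≤ ENNReal.ofReal (CH a * A ^ 2) := by
      have hb : ∀ t, ∫⁻ s, H t s ≤ ENNReal.ofReal (CH a * A ^ (p * (1 - a))) * ENNReal.ofReal (φ t ^ p) := by
        intro t
        rcases (h0 t).eq_or_lt with hv | hv
        · have : ∀ s, H t s = 0 := by intro s; simp [hH, ← hv]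
          simp [this]
        · have e : ∀ s, H t s = ENNReal.ofReal (φ t) * (if φ s ≤ φ t then ENNReal.ofReal (φ s * |t - s| ^ (-a)) else 0) := by
            intro s
            simp only [hH]
            split_ifs
            · rw [← ENNReal.ofReal_mul hv.le, mul_assoc]
            · simp
          simp only [e]
          rw [lintegral_const_mul' _ _ (by simp)]
          refine (mul_le_mul_right (hls_J ha0 ha1 hp hm h0 hA hI hv t) _).trans (le_of_eq ?_)
          have hc := CH_pos ha1
          rw [← ENNReal.ofReal_mul hv.le, ← ENNReal.ofReal_mul (by positivity)]
          congr 1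
          have : φ t ^ p = φ t * φ t ^ (p - 1) := by
            rw [Real.rpow_sub_one hv.ne']; field_simp
          rw [this]; ring
      refine (lintegral_mono hb).trans (le_of_eq ?_)
      have hc := CH_pos ha1
      rw [lintegral_const_mul' _ _ (by simp), hI, ← ENNReal.ofReal_mul (by positivity)]
      congr 1
      rw [mul_assoc, ← Real.rpow_add hA]
      congr 1
      rw [← Real.rpow_natCast A 2]
      congr 1
      rw [hp]; push_cast; field_simp; ring
    calc _ ≤ ∫⁻ t, ∫⁻ s, (H t s + H s t) := lintegral_mono fun t => lintegral_mono fun s => hsym t s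
      _ = ∫⁻ t, ((∫⁻ s, H t s) + ∫⁻ s, H s t) := by
          apply lintegral_congr; intro t
          exact lintegral_add_left (hHm.comp measurable_prodMk_left) _
      _ = (∫⁻ t, ∫⁻ s, H t s) + ∫⁻ t, ∫⁻ s, H s t := by
          exact lintegral_add_left hHm.lintegral_prod_right _
      _ = (∫⁻ t, ∫⁻ s, H t s) + ∫⁻ t, ∫⁻ s, H t s := by
          congr 1
          exact (lintegral_lintegral_swap hHm.aemeasurable).symm
      _ ≤ ENNReal.ofReal (CH a * A ^ 2) + ENNReal.ofReal (CH a * A ^ 2) := add_le_add hone hone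
      _ = _ := by
          have hc := CH_pos ha1
          rw [← ENNReal.ofReal_add (by positivity) (by positivity)]
          congr 1; ring

open MeasureTheory Real Complex
open scoped ENNReal InnerProductSpace ComplexConjugate Topology

lemma cs_bound' {m a b : E2 → ℂ} (hm : ∀ x, ‖m x‖ ≤ 1) (hmc : AEStronglyMeasurable m volume) (ha : MemLp a 2) (hb : MemLp b 2) :
    ∫ x, ‖m x * a x * b x‖ ≤ n2 a * n2 b := by
  have hab : Integrable (fun x => a x * b x) := ha.integrable_mul hb
  have hI := (cs_bound hm hmc ha hb).1
  refine le_trans (integral_mono hI.norm hab.norm ?_) ?_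
  · intro x
    simp only [norm_mul]
    have := mul_le_mul_of_nonneg_right (hm x) (norm_nonneg (a x))
    rw [one_mul] at this
    exact mul_le_mul_of_nonneg_right this (norm_nonneg _)
  · have := integral_mul_norm_le_Lp_mul_Lq (μ := volume) (f := a) (g := b) (p := 2) (q := 2) (Real.HolderConjugate.two_two) (by simpa using ha) (by simpa using hb)
    simp only [norm_mul]
    exact this

/-- phase -/
noncomputable def ph (μ b t : ℝ) (ξ : E2) : ℂ := Complex.exp (Complex.I * ((b * t * (‖ξ‖ / √(1 + μ * ‖ξ‖ ^ 2 / 3)) : ℝ) : ℂ))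

/-- admissible space-time test function -/
structure Adm (F : ℝ → E2 → ℂ) (M R T : ℝ) : Prop where
  meas : Measurable (Function.uncurry F)
  bound : ∀ t x, ‖F t x‖ ≤ M
  supx : ∀ t x, R < ‖x‖ → F t x = 0
  supt : ∀ t x, t ∉ Set.Ioo 0 T → F t x = 0

lemma Adm.bd {F : ℝ → E2 → ℂ} {M R T : ℝ} (h : Adm F M R T) (t : ℝ) : Bd (F t) :=
  ⟨h.meas.comp measurable_prodMk_left, M, R, fun x => ⟨h.bound t x, h.supx t x⟩⟩

lemma Adm.conj {F : ℝ → E2 → ℂ} {M R T : ℝ} (h : Adm F M R T) : Adm (fun t x => conj (F t x)) M R T where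
  meas := Complex.continuous_conj.measurable.comp h.meas
  bound t x := by rw [RCLike.norm_conj]; exact h.bound t x
  supx t x hx := by rw [h.supx t x hx, map_zero]
  supt t x hx := by rw [h.supt t x hx, map_zero]

lemma eF_conj (u : E2 → ℂ) (ξ : E2) : eF (fun x => conj (u x)) (-ξ) = conj (eF u ξ) := by
  unfold eF
  rw [map_mul, Complex.conj_ofReal, ← integral_conj]
  congr 2; ext x
  rw [map_mul, ← Complex.exp_conj, map_mul, Complex.conj_I, Complex.conj_ofReal, inner_neg_right]
  congr 2
  push_cast; ring

lemma Adm.eF_meas {F : ℝ → E2 → ℂ} {M R T : ℝ} (h : Adm F M R T) : Measurable (fun p : ℝ × E2 => eF (F p.1) p.2) := by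
  unfold eF
  apply Measurable.const_mul
  have hm := h.meas
  have : StronglyMeasurable (fun q : (ℝ × E2) × E2 => Complex.exp (Complex.I * (⟪q.2, q.1.2⟫_ℝ : ℂ)) * F q.1.1 q.2) := by
    apply Measurable.stronglyMeasurable
    apply Measurable.mul
    · apply Continuous.measurable; fun_prop
    · exact hm.comp (f := fun q : (ℝ × E2) × E2 => (q.1.1, q.2)) (by fun_prop)
  exact this.integral_prod_right'.measurable

lemma ph_continuous {μ : ℝ} (hμ : 0 ≤ μ) (b : ℝ) : Continuous (fun p : ℝ × E2 => ph μ b p.1 p.2) := by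
  unfold ph
  have : Continuous fun ξ : E2 => ‖ξ‖ / √(1 + μ * ‖ξ‖ ^ 2 / 3) := by
    apply Continuous.div (by fun_prop) (by fun_prop)
    intro ξ; exact (Real.sqrt_pos.2 (by positivity)).ne'
  have h2 := this.comp (continuous_snd (X := ℝ) (Y := E2))
  exact Complex.continuous_exp.comp (continuous_const.mul (Complex.continuous_ofReal.comp ((continuous_const.mul continuous_fst).mul h2)))

lemma Adm.n2_le {F : ℝ → E2 → ℂ} {M R T : ℝ} (h : Adm F M R T) : ∃ N : ℝ, 0 ≤ N ∧ ∀ t, n2 (F t) ≤ (if t ∈ Set.Ioo 0 T then N else 0) := by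
  refine ⟨(∫ x : E2, (Metric.closedBall (0:E2) R).indicator (fun _ => M ^ (2:ℝ)) x) ^ (1 / (2:ℝ)), ?_, fun t => ?_⟩
  · have hM : 0 ≤ M := (norm_nonneg _).trans (h.bound 0 0)
    apply Real.rpow_nonneg
    apply integral_nonneg
    intro x; apply Set.indicator_nonneg; intro _ _; positivity
  · split_ifs with ht
    · unfold n2
      refine Real.rpow_le_rpow (integral_nonneg fun x => by positivity) ?_ (by norm_num)
      apply integral_mono
      · have := (h.bd t).pow (p := 2) (by norm_num) (zero_le_one (α := ℝ))
        simpa using this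
      · exact (integrable_indicator_iff Metric.isClosed_closedBall.measurableSet).2 (integrableOn_const measure_closedBall_lt_top.ne)
      · intro x
        by_cases hx : x ∈ Metric.closedBall (0:E2) R
        · simp only [Set.indicator_of_mem hx]
          exact Real.rpow_le_rpow (norm_nonneg _) (h.bound t x) (by norm_num)
        · simp only [Set.indicator_of_notMem hx]
          rw [h.supx t x (by simpa using hx)]; simp
    · have : F t = fun _ => 0 := funext fun x => h.supt t x ht
      rw [this]; simp [n2]

/-- dual operator -/
noncomputable def dS (μ b : ℝ) (F : ℝ → E2 → ℂ) (ξ : E2) : ℂ := ∫ t, ph μ b t ξ * eF (F t) ξ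

lemma diag_null : ∀ᵐ w : ℝ × ℝ ∂(volume.prod volume), w.1 ≠ w.2 := by
  have hs : MeasurableSet {w : ℝ × ℝ | w.1 = w.2} := measurableSet_eq_fun measurable_fst measurable_snd
  have : (volume.prod volume) {w : ℝ × ℝ | w.1 = w.2} = 0 := by
    rw [Measure.measure_prod_null hs]
    filter_upwards with x
    have : Prod.mk x ⁻¹' {w : ℝ × ℝ | w.1 = w.2} = {x} := by ext y; simp [eq_comm]
    rw [this]; simp
  rw [ae_iff]
  simpa using this

lemma dS_meas {μ b : ℝ} (hμ : 0 ≤ μ) {F : ℝ → E2 → ℂ} {M R T : ℝ} (h : Adm F M R T) : Measurable (dS μ b F) := by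
  unfold dS
  have hF := h.eF_meas
  have hp := (ph_continuous hμ b).measurable
  have : StronglyMeasurable (fun q : E2 × ℝ => ph μ b q.2 q.1 * eF (F q.2) q.1) := by
    apply Measurable.stronglyMeasurable
    exact (hp.comp (g := fun p : ℝ × E2 => ph μ b p.1 p.2) (f := fun q : E2 × ℝ => (q.2, q.1)) (by fun_prop)).mul
      (hF.comp (g := fun p : ℝ × E2 => eF (F p.1) p.2) (f := fun q : E2 × ℝ => (q.2, q.1)) (by fun_prop))
  exact this.integral_prod_right'.measurable

set_option maxHeartbeats 1600000 in
theorem dual_est {μ b : ℝ} (hμ : 0 < μ) (hμ1 : μ ≤ 1) (hb : b ≠ 0) {a p pt : ℝ} (ha0 : 0 < a) (ha1 : a < 1) (hpa : p * (1 + a) / 2 = 1)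
    (hpt : pt = 2 / (2 - a)) {F : ℝ → E2 → ℂ} {M R T : ℝ} (h : Adm F M R T) {A : ℝ} (hA : 0 ≤ A)
    (hI : ∫⁻ t, ENNReal.ofReal (((∫ x, ‖F t x‖ ^ p) ^ (1 / p)) ^ pt) = ENNReal.ofReal (A ^ pt)) :
    Integrable (fun ξ => (1 + μ * ‖ξ‖ ^ 2 / 3) ^ (-(2 * a)) * ‖dS μ b F ξ‖ ^ 2) ∧
    ∫ ξ, (1 + μ * ‖ξ‖ ^ 2 / 3) ^ (-(2 * a)) * ‖dS μ b F ξ‖ ^ 2 ≤ (KS / (√μ * |b|)) ^ a * (2 * CH a * A ^ 2) := by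
  let G : ℝ × ℝ → E2 → ℂ := fun w ξ => mK (b * (w.1 - w.2)) μ a ξ * eF (F w.1) ξ * eF (fun x => conj (F w.2 x)) (-ξ)
  have haz : 0 ≤ ((a:ℝ):ℂ).re := by simpa using ha0.le
  have hs := Real.sqrt_pos.2 hμ
  have hbp := abs_pos.2 hb
  have hKS := KS_pos
  have hp0 : 0 < p := by
    by_contra hn
    have : p * (1 + a) ≤ 0 := mul_nonpos_of_nonpos_of_nonneg (not_lt.1 hn) (by linarith)
    linarith
  -- pointwise identity
  have e1 : ∀ ξ : E2, (((1 + μ * ‖ξ‖ ^ 2 / 3) ^ (-(2 * a)) * ‖dS μ b F ξ‖ ^ 2 : ℝ) : ℂ) = ∫ w, G w ξ ∂(volume.prod volume) := by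
    intro ξ
    have hW : 0 < 1 + μ * ‖ξ‖ ^ 2 / 3 := by positivity
    have hG : ∀ w, G w ξ = (((1 + μ * ‖ξ‖ ^ 2 / 3) ^ (-(2 * a)) : ℝ) : ℂ) * ((ph μ b w.1 ξ * eF (F w.1) ξ) * conj (ph μ b w.2 ξ * eF (F w.2) ξ)) := by
      intro w
      simp only [G]
      rw [eF_conj, map_mul]
      have hm : mK (b * (w.1 - w.2)) μ a ξ = (((1 + μ * ‖ξ‖ ^ 2 / 3) ^ (-(2 * a)) : ℝ) : ℂ) * (ph μ b w.1 ξ * conj (ph μ b w.2 ξ)) := by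
        unfold mK ph
        rw [← Complex.exp_conj, ← Complex.exp_add, map_mul, Complex.conj_I, Complex.conj_ofReal, mul_comm, Complex.ofReal_cpow hW.le]
        congr 2
        · push_cast; ring
        · push_cast; ring
      rw [hm]; ring
    simp only [hG]
    rw [integral_const_mul, integral_prod_mul (fun t => ph μ b t ξ * eF (F t) ξ) (fun t => conj (ph μ b t ξ * eF (F t) ξ)), integral_conj]
    change _ = _ * (dS μ b F ξ * conj (dS μ b F ξ))
    rw [Complex.mul_conj, Complex.normSq_eq_norm_sq]
    push_cast; rfl
  -- integrability
  have hmG : Measurable (fun q : (ℝ × ℝ) × E2 => G q.1 q.2) := by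
    simp only [G]
    have h1 := h.eF_meas
    have h2 := h.conj.eF_meas
    have h3 : Measurable (fun q : (ℝ × ℝ) × E2 => mK (b * (q.1.1 - q.1.2)) μ a q.2) := by
      unfold mK
      apply Measurable.mul
      · have : Continuous fun ξ : E2 => ‖ξ‖ / √(1 + μ * ‖ξ‖ ^ 2 / 3) := by
          apply Continuous.div (by fun_prop) (by fun_prop)
          intro ξ; exact (Real.sqrt_pos.2 (by positivity)).ne'
        apply Continuous.measurable
        have h2 := this.comp (continuous_snd (X := ℝ × ℝ) (Y := E2))
        refine Complex.continuous_exp.comp (continuous_const.mul (Complex.continuous_ofReal.comp (Continuous.mul ?_ h2)))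
        fun_prop
      · apply Continuous.measurable
        apply Continuous.cpow (by fun_prop) continuous_const
        intro q; left; rw [Complex.ofReal_re]; positivity
    refine (h3.mul (h1.comp (g := fun p : ℝ × E2 => eF (F p.1) p.2) (f := fun q : (ℝ × ℝ) × E2 => (q.1.1, q.2)) (by fun_prop))).mul
      (h2.comp (g := fun p : ℝ × E2 => eF (fun x => conj (F p.1 x)) p.2) (f := fun q : (ℝ × ℝ) × E2 => (q.1.2, -q.2)) (by fun_prop))
  obtain ⟨N, hN0, hN⟩ := h.n2_le
  obtain ⟨N', hN0', hN'⟩ := h.conj.n2_le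
  have hGint : Integrable (Function.uncurry G) ((volume.prod volume).prod volume) := by
    have hmG' : Measurable (Function.uncurry G) := hmG
    refine (integrable_prod_iff hmG'.aestronglyMeasurable).2 ⟨?_, ?_⟩
    · filter_upwards with w
      have hh := bB_integrable (τ := b * (w.1 - w.2)) hμ.le haz (h.bd w.1).nice (h.conj.bd w.2).nice
      simp only [Function.uncurry, G]
      exact hh
    · have hI2 : Integrable (fun w : ℝ × ℝ => (Set.Ioo 0 T).indicator (fun _ => N) w.1 * (Set.Ioo 0 T).indicator (fun _ => N') w.2) (volume.prod volume) := by
        apply Integrable.mul_prod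
        · exact (integrable_indicator_iff measurableSet_Ioo).2 (integrableOn_const (by simp))
        · exact (integrable_indicator_iff measurableSet_Ioo).2 (integrableOn_const (by simp))
      refine hI2.mono' ?_ ?_
      · exact hmG.aestronglyMeasurable.norm.integral_prod_right'
      · filter_upwards with w
        rw [Real.norm_eq_abs, abs_of_nonneg (integral_nonneg fun ξ => norm_nonneg _)]
        have := cs_bound' (mK_le_one (τ := b * (w.1 - w.2)) hμ.le haz) (mK_continuous hμ.le _).aestronglyMeasurable (eF_memLp (h.bd w.1).nice.1 (h.bd w.1).nice.2)
          (memLp_neg (eF_memLp (h.conj.bd w.2).nice.1 (h.conj.bd w.2).nice.2))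
        rw [n2_neg, n2_eF (h.bd w.1).nice, n2_eF (h.conj.bd w.2).nice] at this
        refine this.trans ?_
        rw [Set.indicator_apply, Set.indicator_apply]
        exact mul_le_mul (hN _) (hN' _) (n2_nonneg _) (by split_ifs <;> simp [hN0])
  have hIntg : Integrable (fun ξ => (1 + μ * ‖ξ‖ ^ 2 / 3) ^ (-(2 * a)) * ‖dS μ b F ξ‖ ^ 2) := by
    have := hGint.integral_prod_right
    have h2 : Integrable (fun ξ : E2 => (((1 + μ * ‖ξ‖ ^ 2 / 3) ^ (-(2 * a)) * ‖dS μ b F ξ‖ ^ 2 : ℝ) : ℂ)) := by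
      simp only [e1]; exact this
    exact_mod_cast h2.re
  refine ⟨hIntg, ?_⟩
  have hnn : 0 ≤ ∫ ξ, (1 + μ * ‖ξ‖ ^ 2 / 3) ^ (-(2 * a)) * ‖dS μ b F ξ‖ ^ 2 := integral_nonneg fun ξ => by positivity
  have e2 : ((∫ ξ, (1 + μ * ‖ξ‖ ^ 2 / 3) ^ (-(2 * a)) * ‖dS μ b F ξ‖ ^ 2 : ℝ) : ℂ) = ∫ w, bB (b * (w.1 - w.2)) μ a (F w.1) (fun x => conj (F w.2 x)) ∂(volume.prod volume) := by
    refine (integral_ofReal (𝕜 := ℂ) (μ := volume) (f := fun ξ : E2 => (1 + μ * ‖ξ‖ ^ 2 / 3) ^ (-(2 * a)) * ‖dS μ b F ξ‖ ^ 2)).symm.trans ?_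
    have := integral_integral_swap hGint
    unfold bB
    rw [this]
    apply integral_congr_ae
    filter_upwards with ξ
    exact e1 ξ
  set φ : ℝ → ℝ := fun t => (∫ x, ‖F t x‖ ^ p) ^ (1 / p) with hφ
  have hφ0 : ∀ t, 0 ≤ φ t := fun t => Real.rpow_nonneg (integral_nonneg fun x => by positivity) _
  have hφm : Measurable φ := by
    have : StronglyMeasurable (fun q : ℝ × E2 => ‖F q.1 q.2‖ ^ p) := by
      apply Measurable.stronglyMeasurable
      exact h.meas.norm.pow_const p
    exact this.integral_prod_right'.measurable.pow_const _
  have hbd : ∀ᵐ w : ℝ × ℝ ∂(volume.prod volume), ‖bB (b * (w.1 - w.2)) μ a (F w.1) (fun x => conj (F w.2 x))‖ₑ ≤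
      ENNReal.ofReal ((KS / (√μ * |b|)) ^ a) * ENNReal.ofReal (φ w.1 * φ w.2 * |w.1 - w.2| ^ (-a)) := by
    filter_upwards [diag_null] with w hw
    have hw' : w.1 - w.2 ≠ 0 := sub_ne_zero.2 hw
    have hwp := abs_pos.2 hw'
    have := stein_bd hμ hμ1 (mul_ne_zero hb hw') ha0.le ha1.le hpa (h.bd w.1) (h.conj.bd w.2)
    simp only [RCLike.norm_conj] at this
    rw [← ofReal_norm, ← ENNReal.ofReal_mul (by positivity)]
    apply ENNReal.ofReal_le_ofReal
    refine this.trans (le_of_eq ?_)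
    rw [Real.mul_rpow (integral_nonneg fun x => by positivity) (integral_nonneg fun x => by positivity), abs_mul,
      show KS / (√μ * (|b| * |w.1 - w.2|)) = (KS / (√μ * |b|)) * |w.1 - w.2|⁻¹ by field_simp,
      Real.mul_rpow (by positivity) (by positivity), Real.inv_rpow (by positivity), ← Real.rpow_neg (by positivity)]
    simp only [hφ]; ring
  have hCH := CH_pos ha1
  have h3 : ‖((∫ ξ, (1 + μ * ‖ξ‖ ^ 2 / 3) ^ (-(2 * a)) * ‖dS μ b F ξ‖ ^ 2 : ℝ) : ℂ)‖ₑ ≤ ENNReal.ofReal ((KS / (√μ * |b|)) ^ a * (2 * CH a * A ^ 2)) := by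
    rw [e2]
    refine (enorm_integral_le_lintegral_enorm _).trans ((lintegral_mono_ae hbd).trans ?_)
    rw [lintegral_const_mul' _ _ (by simp), ENNReal.ofReal_mul (by positivity)]
    refine mul_le_mul_right ?_ _
    rw [lintegral_prod _ (by fun_prop)]
    exact hls ha0 ha1 hpt hφm hφ0 hA hI
  rw [← ofReal_norm, Complex.norm_real, Real.norm_eq_abs, abs_of_nonneg hnn] at h3
  exact (ENNReal.ofReal_le_ofReal_iff (by positivity)).1 h3

open MeasureTheory Real Complex
open scoped ENNReal InnerProductSpace ComplexConjugate Topology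

/-- solution -/
noncomputable def uS (μ b : ℝ) (h : E2 → ℂ) (t : ℝ) (x : E2) : ℂ := eF (fun ξ => ph μ b t ξ * h ξ) x

lemma ph_norm (μ b t : ℝ) (ξ : E2) : ‖ph μ b t ξ‖ = 1 := norm_expI _

lemma uS_bound (μ b : ℝ) (h : E2 → ℂ) (t : ℝ) (x : E2) : ‖uS μ b h t x‖ ≤ (2 * π)⁻¹ * ∫ ξ, ‖h ξ‖ := by
  have := eF_norm_le (fun ξ => ph μ b t ξ * h ξ) x
  simp only [norm_mul, ph_norm, one_mul] at this
  exact this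

lemma uS_meas {μ : ℝ} (hμ : 0 ≤ μ) (b : ℝ) {h : E2 → ℂ} (hm : Measurable h) : Measurable (fun p : ℝ × E2 => uS μ b h p.1 p.2) := by
  unfold uS eF
  apply Measurable.const_mul
  have hp := (ph_continuous hμ b).measurable
  have : StronglyMeasurable (fun q : (ℝ × E2) × E2 => Complex.exp (Complex.I * (⟪q.2, q.1.2⟫_ℝ : ℂ)) * (ph μ b q.1.1 q.2 * h q.2)) := by
    apply Measurable.stronglyMeasurable
    apply Measurable.mul
    · apply Continuous.measurable; fun_prop
    · exact (hp.comp (g := fun p : ℝ × E2 => ph μ b p.1 p.2) (f := fun q : (ℝ × E2) × E2 => (q.1.1, q.2)) (by fun_prop)).mul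
        (hm.comp measurable_snd)
  exact this.integral_prod_right'.measurable

lemma Adm.integrable {F : ℝ → E2 → ℂ} {M R T : ℝ} (h : Adm F M R T) : Integrable (Function.uncurry F) (volume.prod volume) := by
  have hI2 : Integrable (fun w : ℝ × E2 => (Set.Ioo 0 T).indicator (fun _ => M) w.1 * (Metric.closedBall (0:E2) R).indicator (fun _ => (1:ℝ)) w.2) (volume.prod volume) := by
    apply Integrable.mul_prod
    · exact (integrable_indicator_iff measurableSet_Ioo).2 (integrableOn_const (by simp))
    · exact (integrable_indicator_iff Metric.isClosed_closedBall.measurableSet).2 (integrableOn_const measure_closedBall_lt_top.ne)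
  refine hI2.mono' h.meas.aestronglyMeasurable ?_
  filter_upwards with w
  simp only [Function.uncurry]
  by_cases h1 : w.1 ∈ Set.Ioo 0 T
  · by_cases h2 : w.2 ∈ Metric.closedBall (0:E2) R
    · rw [Set.indicator_of_mem h1, Set.indicator_of_mem h2, mul_one]; exact h.bound _ _
    · rw [Set.indicator_of_notMem h2, h.supx _ _ (by simpa using h2)]; simp
  · rw [Set.indicator_of_notMem h1, h.supt _ _ h1]; simp

set_option maxHeartbeats 1600000 in
lemma pairing {μ : ℝ} (hμ : 0 ≤ μ) (b : ℝ) {h : E2 → ℂ} (hm : Measurable h) (hi : Integrable h) {F : ℝ → E2 → ℂ} {M R T : ℝ} (hF : Adm F M R T) :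
    ∫ w, uS μ b h w.1 w.2 * F w.1 w.2 ∂(volume.prod volume) = ∫ ξ, h ξ * dS μ b F ξ := by
  let J : ℝ × E2 → E2 → ℂ := fun w ξ => ((2 * π)⁻¹ : ℝ) * (Complex.exp (Complex.I * (⟪ξ, w.2⟫_ℝ : ℂ)) * (ph μ b w.1 ξ * h ξ)) * F w.1 w.2
  have hp := (ph_continuous hμ b).measurable
  have hJm : Measurable (Function.uncurry J) := by
    simp only [Function.uncurry_def, J]
    apply Measurable.mul
    · apply Measurable.const_mul
      apply Measurable.mul
      · apply Continuous.measurable; fun_prop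
      · exact (hp.comp (g := fun p : ℝ × E2 => ph μ b p.1 p.2) (f := fun q : (ℝ × E2) × E2 => (q.1.1, q.2)) (by fun_prop)).mul
          (hm.comp measurable_snd)
    · exact hF.meas.comp (f := fun q : (ℝ × E2) × E2 => (q.1.1, q.1.2)) (by fun_prop)
  have hJi : Integrable (Function.uncurry J) ((volume.prod volume).prod volume) := by
    have h1 : Integrable (fun q : (ℝ × E2) × E2 => (‖Function.uncurry F q.1‖) * ((2 * π)⁻¹ * ‖h q.2‖)) ((volume.prod volume).prod volume) :=
      Integrable.mul_prod (f := fun w => ‖Function.uncurry F w‖) hF.integrable.norm (hi.norm.const_mul _)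
    refine h1.mono' hJm.aestronglyMeasurable ?_
    filter_upwards with q
    simp only [Function.uncurry_def, J, norm_mul, ph_norm, norm_expI, one_mul, Complex.norm_real, Real.norm_eq_abs]
    rw [abs_of_pos (by positivity), mul_comm]
  have e1 : ∀ w, uS μ b h w.1 w.2 * F w.1 w.2 = ∫ ξ, J w ξ := by
    intro w
    simp only [J]
    rw [integral_mul_const, integral_const_mul]
    rfl
  simp only [e1]
  rw [integral_integral_swap hJi]
  have hJi' := hJi.swap.prod_right_ae
  apply integral_congr_ae
  filter_upwards [hJi'] with ξ hξ
  have hξ' : Integrable (fun w => J w ξ) (volume.prod volume) := hξ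
  rw [integral_prod _ hξ']
  unfold dS
  rw [← integral_const_mul]
  congr 1; ext t
  unfold eF
  rw [← integral_const_mul, ← integral_const_mul, ← integral_const_mul]
  congr 1; ext x
  simp only [J]
  rw [real_inner_comm]
  ring

set_option maxHeartbeats 1600000 in
theorem pairing_est {μ b : ℝ} (hμ : 0 < μ) (hμ1 : μ ≤ 1) (hb : b ≠ 0) {a p pt : ℝ} (ha0 : 0 < a) (ha1 : a < 1) (hpa : p * (1 + a) / 2 = 1)
    (hpt : pt = 2 / (2 - a)) {h : E2 → ℂ} (hm : Measurable h) (hi : Integrable h)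
    (hW : MemLp (fun ξ => (((1 + μ * ‖ξ‖ ^ 2 / 3) ^ a : ℝ) : ℂ) * h ξ) 2) {F : ℝ → E2 → ℂ} {M R T : ℝ} (hF : Adm F M R T) {A : ℝ} (hA : 0 ≤ A)
    (hI : ∫⁻ t, ENNReal.ofReal (((∫ x, ‖F t x‖ ^ p) ^ (1 / p)) ^ pt) = ENNReal.ofReal (A ^ pt)) :
    ‖∫ w, uS μ b h w.1 w.2 * F w.1 w.2 ∂(volume.prod volume)‖ ≤
      (n2 (fun ξ => (((1 + μ * ‖ξ‖ ^ 2 / 3) ^ a : ℝ) : ℂ) * h ξ) * √((KS / (√μ * |b|)) ^ a * (2 * CH a))) * A := by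
  rw [pairing hμ.le b hm hi hF]
  obtain ⟨hd1, hd2⟩ := dual_est hμ hμ1 hb ha0 ha1 hpa hpt hF hA hI
  have hWp : ∀ ξ : E2, 0 < 1 + μ * ‖ξ‖ ^ 2 / 3 := fun ξ => by positivity
  have hsq : ∀ ξ, ‖(((1 + μ * ‖ξ‖ ^ 2 / 3) ^ (-a) : ℝ) : ℂ) * dS μ b F ξ‖ ^ 2 = (1 + μ * ‖ξ‖ ^ 2 / 3) ^ (-(2 * a)) * ‖dS μ b F ξ‖ ^ 2 := by
    intro ξ
    have := hWp ξ
    rw [norm_mul, mul_pow, Complex.norm_real, Real.norm_eq_abs, abs_of_pos (by positivity), ← Real.rpow_natCast, ← Real.rpow_mul this.le]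
    congr 2; push_cast; ring
  have hmW : Measurable (fun ξ : E2 => (((1 + μ * ‖ξ‖ ^ 2 / 3) ^ (-a) : ℝ) : ℂ) * dS μ b F ξ) := by
    have := dS_meas (b := b) hμ.le hF
    fun_prop
  have hL : MemLp (fun ξ => (((1 + μ * ‖ξ‖ ^ 2 / 3) ^ (-a) : ℝ) : ℂ) * dS μ b F ξ) 2 := by
    rw [memLp_two_iff_integrable_sq_norm hmW.aestronglyMeasurable]
    simp only [hsq]; exact hd1
  have hcs := (cs_bound (m := fun _ => 1) (by simp) aestronglyMeasurable_const hW hL).2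
  have e : ∀ ξ : E2, (1:ℂ) * ((((1 + μ * ‖ξ‖ ^ 2 / 3) ^ a : ℝ) : ℂ) * h ξ) * ((((1 + μ * ‖ξ‖ ^ 2 / 3) ^ (-a) : ℝ) : ℂ) * dS μ b F ξ) = h ξ * dS μ b F ξ := by
    intro ξ
    have h1 : (((1 + μ * ‖ξ‖ ^ 2 / 3) ^ a : ℝ) : ℂ) * (((1 + μ * ‖ξ‖ ^ 2 / 3) ^ (-a) : ℝ) : ℂ) = 1 := by
      rw [← Complex.ofReal_mul, ← Real.rpow_add (hWp ξ)]; simp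
    calc _ = ((((1 + μ * ‖ξ‖ ^ 2 / 3) ^ a : ℝ) : ℂ) * (((1 + μ * ‖ξ‖ ^ 2 / 3) ^ (-a) : ℝ) : ℂ)) * (h ξ * dS μ b F ξ) := by ring
      _ = _ := by rw [h1, one_mul]
  simp only [e] at hcs
  refine hcs.trans ?_
  rw [mul_assoc]
  refine mul_le_mul_of_nonneg_left ?_ (n2_nonneg _)
  unfold n2
  simp only [Real.rpow_two, hsq]
  rw [← Real.sqrt_eq_rpow]
  have hKS := KS_pos
  have hCH := CH_pos ha1
  have hbp := abs_pos.2 hb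
  calc _ ≤ √((KS / (√μ * |b|)) ^ a * (2 * CH a * A ^ 2)) := Real.sqrt_le_sqrt hd2
    _ = √(((KS / (√μ * |b|)) ^ a * (2 * CH a)) * A ^ 2) := by congr 1; ring
    _ = _ := by rw [Real.sqrt_mul (by positivity), Real.sqrt_sq hA]

open MeasureTheory Real Complex
open scoped ENNReal InnerProductSpace ComplexConjugate Topology

set_option maxHeartbeats 1600000 in
/-- duality, truncated -/
theorem dual_trunc {u : ℝ → E2 → ℂ} (hu : Measurable (fun w : ℝ × E2 => u w.1 w.2)) {B : ℝ} (hB : ∀ t x, ‖u t x‖ ≤ B)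
    {q r p pt D T R δ : ℝ} (hq : 2 < q) (hr : 2 < r) (hp : p = r / (r - 1)) (hpt : pt = q / (q - 1)) (hD : 0 ≤ D) (hδ : 0 < δ)
    (hpair : ∀ (F : ℝ → E2 → ℂ) (M : ℝ), Adm F M R T → ∀ A : ℝ, 0 ≤ A →
      ∫⁻ t, ENNReal.ofReal (((∫ x, ‖F t x‖ ^ p) ^ (1 / p)) ^ pt) = ENNReal.ofReal (A ^ pt) →
      ‖∫ w, u w.1 w.2 * F w.1 w.2 ∂(volume.prod volume)‖ ≤ D * A) :
    ∫⁻ t, ENNReal.ofReal ((Set.Ioo 0 T ∩ {t | δ ≤ (∫ x in Metric.closedBall (0:E2) R, ‖u t x‖ ^ r) ^ (1 / r)}).indicator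
      (fun t => ((∫ x in Metric.closedBall (0:E2) R, ‖u t x‖ ^ r) ^ (1 / r)) ^ q) t) ≤ ENNReal.ofReal (D ^ q) := by
  have hB0 : 0 ≤ B := (norm_nonneg _).trans (hB 0 0)
  have hr1 : 0 < r - 1 := by linarith
  have hq1 : 0 < q - 1 := by linarith
  have hp0 : 0 < p := by rw [hp]; exact div_pos (by linarith) hr1
  have hpt0 : 0 < pt := by rw [hpt]; exact div_pos (by linarith) hq1
  set Bl := Metric.closedBall (0:E2) R with hBl
  have hBlm : MeasurableSet Bl := Metric.isClosed_closedBall.measurableSet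
  set n : ℝ → ℝ := fun t => (∫ x in Bl, ‖u t x‖ ^ r) ^ (1 / r) with hn
  have hN0 : ∀ t, 0 ≤ ∫ x in Bl, ‖u t x‖ ^ r := fun t => integral_nonneg fun x => by positivity
  have hn0 : ∀ t, 0 ≤ n t := fun t => Real.rpow_nonneg (hN0 t) _
  have hnm : Measurable n := by
    have : StronglyMeasurable (fun w : ℝ × E2 => ‖u w.1 w.2‖ ^ r) := (hu.norm.pow_const r).stronglyMeasurable
    have h2 := (this.integral_prod_right' (ν := volume.restrict Bl)).measurable
    exact h2.pow_const _
  have hnr : ∀ t, n t ^ r = ∫ x in Bl, ‖u t x‖ ^ r := by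
    intro t; simp only [hn]; rw [← Real.rpow_mul (hN0 t), one_div_mul_cancel (by linarith), Real.rpow_one]
  obtain ⟨Nm, hNm⟩ : ∃ Nm : ℝ, ∀ t, n t ≤ Nm := by
    refine ⟨(∫ x in Bl, B ^ r) ^ (1 / r), fun t => ?_⟩
    refine Real.rpow_le_rpow (hN0 t) ?_ (by positivity)
    refine integral_mono_of_nonneg (Filter.Eventually.of_forall fun x => by positivity) (integrableOn_const measure_closedBall_lt_top.ne) (Filter.Eventually.of_forall fun x => ?_)
    exact Real.rpow_le_rpow (norm_nonneg _) (hB t x) (by linarith)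
  set E : Set ℝ := Set.Ioo 0 T ∩ {t | δ ≤ n t} with hE
  have hEm : MeasurableSet E := measurableSet_Ioo.inter (measurableSet_le measurable_const hnm)
  let F : ℝ → E2 → ℂ := fun t x => E.indicator (fun t => ((n t ^ (q - r) : ℝ) : ℂ)) t * Bl.indicator (fun x => ((‖u t x‖ ^ (r - 2) : ℝ) : ℂ) * conj (u t x)) x
  have hFm : Measurable (Function.uncurry F) := by
    have h1 : Measurable (fun w : ℝ × E2 => E.indicator (fun t => ((n t ^ (q - r) : ℝ) : ℂ)) w.1) := by
      refine Measurable.comp (g := E.indicator (fun t => ((n t ^ (q - r) : ℝ) : ℂ))) ?_ measurable_fst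
      exact Measurable.indicator (by fun_prop) hEm
    have h2 : Measurable (fun w : ℝ × E2 => (Prod.snd ⁻¹' Bl).indicator (fun w : ℝ × E2 => ((‖u w.1 w.2‖ ^ (r - 2) : ℝ) : ℂ) * conj (u w.1 w.2)) w) := by
      refine Measurable.indicator ?_ (measurable_snd hBlm)
      refine Measurable.mul ?_ (Complex.continuous_conj.measurable.comp hu)
      exact Complex.measurable_ofReal.comp (hu.norm.pow_const _)
    exact h1.mul h2
  have hub : ∀ t x, ‖u t x‖ ^ (r - 2) * ‖u t x‖ ≤ B ^ (r - 2) * B := fun t x =>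
    mul_le_mul (Real.rpow_le_rpow (norm_nonneg _) (hB t x) (by linarith)) (hB t x) (norm_nonneg _) (by positivity)
  have hNm0 : 0 ≤ Nm := (hn0 0).trans (hNm 0)
  have hAdm : Adm F ((δ ^ (q - r) + Nm ^ (q - r)) * (B ^ (r - 2) * B)) R T := by
    refine ⟨hFm, fun t x => ?_, fun t x hx => ?_, fun t x ht => ?_⟩
    · simp only [F, norm_mul]
      refine mul_le_mul ?_ ?_ (norm_nonneg _) (by positivity)
      · by_cases ht : t ∈ E
        · rw [Set.indicator_of_mem ht, Complex.norm_real, Real.norm_eq_abs, abs_of_nonneg (Real.rpow_nonneg (hn0 t) _)]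
          have h1 : 0 ≤ δ ^ (q - r) := by positivity
          have h2 : 0 ≤ Nm ^ (q - r) := by positivity
          rcases le_total 0 (q - r) with h | h
          · have := Real.rpow_le_rpow (hn0 t) (hNm t) h
            linarith
          · have := Real.rpow_le_rpow_of_nonpos hδ ht.2 h
            linarith
        · rw [Set.indicator_of_notMem ht, norm_zero]; positivity
      · by_cases hx : x ∈ Bl
        · rw [Set.indicator_of_mem hx, norm_mul, Complex.norm_real, RCLike.norm_conj, Real.norm_eq_abs, abs_of_nonneg (by positivity)]
          exact hub t x
        · rw [Set.indicator_of_notMem hx, norm_zero]; positivity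
    · have : x ∉ Bl := by simpa [hBl] using hx
      simp only [F, Set.indicator_of_notMem this, mul_zero]
    · have : t ∉ E := fun h => ht h.1
      simp only [F, Set.indicator_of_notMem this, zero_mul]
  -- inner norms
  have hinner : ∀ t, ((∫ x, ‖F t x‖ ^ p) ^ (1 / p)) ^ pt = E.indicator (fun t => n t ^ q) t := by
    intro t
    by_cases ht : t ∈ E
    · have hnt : 0 < n t := hδ.trans_le ht.2
      have e1 : ∀ x, ‖F t x‖ ^ p = n t ^ ((q - r) * p) * Bl.indicator (fun x => ‖u t x‖ ^ r) x := by
        intro x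
        simp only [F, Set.indicator_of_mem ht]
        by_cases hx : x ∈ Bl
        · rw [Set.indicator_of_mem hx, Set.indicator_of_mem hx, norm_mul, norm_mul, Complex.norm_real, Complex.norm_real, RCLike.norm_conj, Real.norm_eq_abs, Real.norm_eq_abs,
            abs_of_nonneg (by positivity), abs_of_nonneg (by positivity), Real.mul_rpow (by positivity) (by positivity), ← Real.rpow_mul hnt.le]
          congr 1
          have : ‖u t x‖ ^ (r - 2) * ‖u t x‖ = ‖u t x‖ ^ (r - 1) := by
            nth_rw 2 [← Real.rpow_one ‖u t x‖]
            rw [← Real.rpow_add_of_nonneg (norm_nonneg _) (by linarith) (by norm_num)]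
            congr 1; ring
          rw [this, ← Real.rpow_mul (norm_nonneg _), hp]
          congr 1; field_simp
        · rw [Set.indicator_of_notMem hx, Set.indicator_of_notMem hx]
          simp [Real.zero_rpow hp0.ne']
      simp only [e1]
      rw [integral_const_mul, integral_indicator hBlm, ← hnr, ← Real.rpow_add hnt, ← Real.rpow_mul hnt.le, ← Real.rpow_mul hnt.le, Set.indicator_of_mem ht]
      congr 1
      rw [hp, hpt]; field_simp; ring
    · have : ∀ x, F t x = 0 := fun x => by simp only [F, Set.indicator_of_notMem ht, zero_mul]
      simp only [this, Set.indicator_of_notMem ht]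
      simp [Real.zero_rpow hp0.ne', Real.zero_rpow hpt0.ne', Real.zero_rpow (inv_pos.2 hp0).ne']
  set P : ℝ := ∫ t, E.indicator (fun t => n t ^ q) t with hP
  have hP0 : 0 ≤ P := integral_nonneg fun t => Set.indicator_nonneg (fun t _ => Real.rpow_nonneg (hn0 t) _) t
  have hIntg : Integrable (E.indicator (fun t => n t ^ q)) := by
    rw [integrable_indicator_iff hEm]
    have hfin : volume E ≠ ⊤ := ne_top_of_le_ne_top (by simp) (measure_mono (t := Set.Ioo 0 T) Set.inter_subset_left)
    refine Integrable.mono' (integrableOn_const (C := Nm ^ q) hfin) (hnm.pow_const q).aestronglyMeasurable ?_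
    filter_upwards with t
    rw [Real.norm_eq_abs, abs_of_nonneg (Real.rpow_nonneg (hn0 t) _)]
    exact Real.rpow_le_rpow (hn0 t) (hNm t) (by linarith)
  have hPl : ∫⁻ t, ENNReal.ofReal (E.indicator (fun t => n t ^ q) t) = ENNReal.ofReal P :=
    (ofReal_integral_eq_lintegral_ofReal hIntg (Filter.Eventually.of_forall fun t => Set.indicator_nonneg (fun t _ => Real.rpow_nonneg (hn0 t) _) t)).symm
  have hA := hpair F _ hAdm (P ^ (1 / pt)) (by positivity) (by
    simp only [hinner]
    rw [hPl, ← Real.rpow_mul hP0, one_div_mul_cancel hpt0.ne', Real.rpow_one])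
  have huF : Integrable (fun w : ℝ × E2 => u w.1 w.2 * F w.1 w.2) (volume.prod volume) := by
    refine Integrable.bdd_mul (c := B) hAdm.integrable hu.aestronglyMeasurable ?_
    exact Filter.Eventually.of_forall fun w => hB _ _
  have hval : ∫ w, u w.1 w.2 * F w.1 w.2 ∂(volume.prod volume) = (P : ℂ) := by
    rw [integral_prod _ huF, hP]
    refine Eq.trans ?_ (integral_ofReal (𝕜 := ℂ))
    congr 1; ext t
    by_cases ht : t ∈ E
    · have hnt : 0 < n t := hδ.trans_le ht.2
      have e1 : ∀ x, u t x * F t x = ((n t ^ (q - r) * Bl.indicator (fun x => ‖u t x‖ ^ r) x : ℝ) : ℂ) := by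
        intro x
        simp only [F, Set.indicator_of_mem ht]
        by_cases hx : x ∈ Bl
        · rw [Set.indicator_of_mem hx, Set.indicator_of_mem hx]
          have : ‖u t x‖ ^ r = ‖u t x‖ ^ (r - 2) * ‖u t x‖ ^ 2 := by
            rw [← Real.rpow_two, ← Real.rpow_add_of_nonneg (norm_nonneg _) (by linarith) (by norm_num)]
            congr 1; ring
          rw [this]
          have h2 : u t x * conj (u t x) = ((‖u t x‖ ^ 2 : ℝ) : ℂ) := by
            rw [Complex.mul_conj, Complex.normSq_eq_norm_sq]
          calc _ = ((n t ^ (q - r) : ℝ) : ℂ) * (((‖u t x‖ ^ (r - 2) : ℝ) : ℂ) * (u t x * conj (u t x))) := by ring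
            _ = _ := by rw [h2]; push_cast; ring
        · rw [Set.indicator_of_notMem hx, Set.indicator_of_notMem hx]; simp
      simp only [e1]
      refine (integral_ofReal (𝕜 := ℂ) (f := fun x => n t ^ (q - r) * Bl.indicator (fun x => ‖u t x‖ ^ r) x)).trans ?_
      congr 1
      rw [integral_const_mul, integral_indicator hBlm, ← hnr, ← Real.rpow_add hnt, Set.indicator_of_mem ht]
      congr 1; ring
    · have : ∀ x, F t x = 0 := fun x => by simp only [F, Set.indicator_of_notMem ht, zero_mul]
      simp [this, Set.indicator_of_notMem ht]
  rw [hval, Complex.norm_real, Real.norm_eq_abs, abs_of_nonneg hP0] at hA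
  rw [hPl]
  apply ENNReal.ofReal_le_ofReal
  rcases hP0.eq_or_lt with h0 | hPp
  · rw [← h0]; positivity
  · have h1 : P = P ^ (1 / q) * P ^ (1 / pt) := by
      rw [← Real.rpow_add hPp, hpt, show 1 / q + 1 / (q / (q - 1)) = 1 by field_simp; ring, Real.rpow_one]
    have h2 : P ^ (1 / q) ≤ D := by
      rw [h1] at hA
      have hpp : 0 < P ^ (1 / pt) := by positivity
      rw [← h1] at hA
      have : P ^ (1 / q) * P ^ (1 / pt) ≤ D * P ^ (1 / pt) := by rw [← h1]; exact hA
      exact le_of_mul_le_mul_right this hpp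
    calc P = (P ^ (1 / q)) ^ q := by rw [← Real.rpow_mul hP0, one_div_mul_cancel (by linarith), Real.rpow_one]
      _ ≤ D ^ q := Real.rpow_le_rpow (by positivity) h2 (by linarith)

open MeasureTheory Real Complex
open scoped ENNReal InnerProductSpace ComplexConjugate Topology

set_option maxHeartbeats 1600000 in
theorem dual_full {u : ℝ → E2 → ℂ} (hu : Measurable (fun w : ℝ × E2 => u w.1 w.2)) {B : ℝ} (hB : ∀ t x, ‖u t x‖ ≤ B)
    {q r p pt D T : ℝ} (hq : 2 < q) (hr : 2 < r) (hp : p = r / (r - 1)) (hpt : pt = q / (q - 1)) (hD : 0 ≤ D)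
    (hpair : ∀ (F : ℝ → E2 → ℂ) (M R : ℝ), Adm F M R T → ∀ A : ℝ, 0 ≤ A →
      ∫⁻ t, ENNReal.ofReal (((∫ x, ‖F t x‖ ^ p) ^ (1 / p)) ^ pt) = ENNReal.ofReal (A ^ pt) →
      ‖∫ w, u w.1 w.2 * F w.1 w.2 ∂(volume.prod volume)‖ ≤ D * A) :
    ∫⁻ t in Set.Ioo 0 T, ((∫⁻ x, ‖u t x‖ₑ ^ r) ^ (1 / r)) ^ q ≤ ENNReal.ofReal (D ^ q) := by
  have hB0 : 0 ≤ B := (norm_nonneg _).trans (hB 0 0)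
  have hr0 : 0 < r := by linarith
  have hq0 : 0 < q := by linarith
  have hmu : Measurable (fun w : ℝ × E2 => ‖u w.1 w.2‖ₑ ^ r) := hu.enorm.pow_const r
  -- fixed ball
  have hfix : ∀ R : ℝ, ∫⁻ t in Set.Ioo 0 T, ((∫⁻ x in Metric.closedBall (0:E2) R, ‖u t x‖ₑ ^ r) ^ (1 / r)) ^ q ≤ ENNReal.ofReal (D ^ q) := by
    intro R
    set Bl := Metric.closedBall (0:E2) R with hBl
    have hN0 : ∀ t, 0 ≤ ∫ x in Bl, ‖u t x‖ ^ r := fun t => integral_nonneg fun x => by positivity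
    set n : ℝ → ℝ := fun t => (∫ x in Bl, ‖u t x‖ ^ r) ^ (1 / r) with hn
    have hn0 : ∀ t, 0 ≤ n t := fun t => Real.rpow_nonneg (hN0 t) _
    have hnm : Measurable n := by
      have : StronglyMeasurable (fun w : ℝ × E2 => ‖u w.1 w.2‖ ^ r) := (hu.norm.pow_const r).stronglyMeasurable
      have h2 := (this.integral_prod_right' (ν := volume.restrict Bl)).measurable
      exact h2.pow_const _
    have hut : ∀ t, Measurable (u t) := fun t => hu.comp measurable_prodMk_left
    have e : ∀ t, ((∫⁻ x in Bl, ‖u t x‖ₑ ^ r) ^ (1 / r)) ^ q = ENNReal.ofReal (n t ^ q) := by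
      intro t
      have hi : Integrable (fun x => ‖u t x‖ ^ r) (volume.restrict Bl) := by
        refine Integrable.mono' (integrableOn_const (C := B ^ r) measure_closedBall_lt_top.ne) ((hut t).norm.pow_const r).aestronglyMeasurable ?_
        filter_upwards with x
        rw [Real.norm_eq_abs, abs_of_nonneg (by positivity)]
        exact Real.rpow_le_rpow (norm_nonneg _) (hB t x) hr0.le
      have h1 : ∫⁻ x in Bl, ‖u t x‖ₑ ^ r = ENNReal.ofReal (∫ x in Bl, ‖u t x‖ ^ r) := by
        rw [ofReal_integral_eq_lintegral_ofReal hi (Filter.Eventually.of_forall fun x => by positivity)]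
        congr 1; ext x
        rw [← ofReal_norm, ENNReal.ofReal_rpow_of_nonneg (norm_nonneg _) hr0.le]
      rw [h1, ENNReal.ofReal_rpow_of_nonneg (hN0 t) (by positivity), ENNReal.ofReal_rpow_of_nonneg (hn0 t) hq0.le]
    simp only [e]
    have hδ : ∀ δ : ℝ, 0 < δ → ∫⁻ t in Set.Ioo 0 T, ENNReal.ofReal (n t ^ q) ≤ ENNReal.ofReal (D ^ q) + ENNReal.ofReal (δ ^ q) * ENNReal.ofReal T := by
      intro δ hδ
      have h1 := dual_trunc hu hB hq hr hp hpt hD hδ (fun F M => hpair F M R)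
      have h2 : ∫⁻ t in Set.Ioo 0 T, ENNReal.ofReal (n t ^ q) ≤ ∫⁻ t in Set.Ioo 0 T, (ENNReal.ofReal ((Set.Ioo 0 T ∩ {t | δ ≤ n t}).indicator (fun t => n t ^ q) t) + ENNReal.ofReal (δ ^ q)) := by
        refine setLIntegral_mono' measurableSet_Ioo fun t ht => ?_
        by_cases h : δ ≤ n t
        · rw [Set.indicator_of_mem (show t ∈ Set.Ioo 0 T ∩ {t | δ ≤ n t} from ⟨ht, h⟩)]; exact le_self_add
        · have := ENNReal.ofReal_le_ofReal (Real.rpow_le_rpow (hn0 t) (not_le.1 h).le hq0.le)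
          exact this.trans le_add_self
      refine h2.trans ?_
      rw [lintegral_add_right _ measurable_const, setLIntegral_const]
      refine add_le_add ((setLIntegral_le_lintegral _ _).trans h1) ?_
      rw [Real.volume_Ioo, sub_zero]
    have hlim : Filter.Tendsto (fun δ : ℝ => ENNReal.ofReal (D ^ q) + ENNReal.ofReal (δ ^ q) * ENNReal.ofReal T) (𝓝[>] 0) (𝓝 (ENNReal.ofReal (D ^ q) + ENNReal.ofReal ((0:ℝ) ^ q) * ENNReal.ofReal T)) := by
      refine Filter.Tendsto.mono_left ?_ nhdsWithin_le_nhds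
      refine tendsto_const_nhds.add (ENNReal.Tendsto.mul_const ?_ (Or.inr ENNReal.ofReal_ne_top))
      exact ENNReal.tendsto_ofReal ((Real.continuous_rpow_const hq0.le).tendsto 0)
    rw [Real.zero_rpow hq0.ne', ENNReal.ofReal_zero, zero_mul, add_zero] at hlim
    refine ge_of_tendsto hlim ?_
    filter_upwards [self_mem_nhdsWithin] with δ h using hδ δ h
  -- exhaust
  let g : ℕ → ℝ → ℝ≥0∞ := fun k t => ((∫⁻ x in Metric.closedBall (0:E2) k, ‖u t x‖ₑ ^ r) ^ (1 / r)) ^ q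
  have hgm : ∀ k, Measurable (g k) := by
    intro k
    have := hmu.lintegral_prod_right' (ν := volume.restrict (Metric.closedBall (0:E2) k))
    exact (this.pow_const _).pow_const _
  have hlim : ∀ t, Filter.Tendsto (fun k => g k t) Filter.atTop (𝓝 (((∫⁻ x, ‖u t x‖ₑ ^ r) ^ (1 / r)) ^ q)) := by
    intro t
    have h1 : Filter.Tendsto (fun k : ℕ => ∫⁻ x in Metric.closedBall (0:E2) k, ‖u t x‖ₑ ^ r) Filter.atTop (𝓝 (∫⁻ x, ‖u t x‖ₑ ^ r)) := by
      have hmono : Monotone fun k : ℕ => Metric.closedBall (0:E2) k := fun i j hij => Metric.closedBall_subset_closedBall (by exact_mod_cast hij)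
      have h3 := setLIntegral_iUnion_of_directed (μ := volume) (fun x => ‖u t x‖ₑ ^ r) hmono.directed_le
      have hU : ⋃ k : ℕ, Metric.closedBall (0:E2) (k:ℝ) = Set.univ := Metric.iUnion_closedBall_nat 0
      rw [hU, Measure.restrict_univ] at h3
      rw [h3]
      exact tendsto_atTop_iSup fun i j hij => lintegral_mono_set (hmono hij)
    exact ((ENNReal.continuous_rpow_const.tendsto _).comp ((ENNReal.continuous_rpow_const.tendsto _).comp h1))
  calc ∫⁻ t in Set.Ioo 0 T, ((∫⁻ x, ‖u t x‖ₑ ^ r) ^ (1 / r)) ^ q = ∫⁻ t in Set.Ioo 0 T, Filter.liminf (fun k => g k t) Filter.atTop := by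
        congr 1; ext t; exact (hlim t).liminf_eq.symm
    _ ≤ Filter.liminf (fun k => ∫⁻ t in Set.Ioo 0 T, g k t) Filter.atTop := lintegral_liminf_le hgm
    _ ≤ ENNReal.ofReal (D ^ q) := by
        refine Filter.liminf_le_of_frequently_le' (Filter.Frequently.of_forall fun k => ?_)
        exact hfix k

open MeasureTheory Real Complex
open scoped ENNReal InnerProductSpace ComplexConjugate Topology

lemma fmult_eq (m f : E2 → ℂ) : fmult m f = eF (fun ξ => m ξ * ft f ξ) := by
  ext x
  unfold fmult eF
  have : (2 * π) ^ (-((2:ℕ) : ℝ) / 2) = (2 * π)⁻¹ := by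
    rw [show -((2:ℕ) : ℝ) / 2 = -1 by norm_num, Real.rpow_neg_one]
  rw [this]
  congr 2; ext ξ
  rw [real_inner_comm, mul_assoc]

open scoped FourierTransform in
lemma ft_schwartz (f : SchwartzMap E2 ℂ) : ∃ g : SchwartzMap E2 ℂ, ft ⇑f = ⇑g := by
  let e : E2 ≃L[ℝ] E2 := ContinuousLinearEquiv.smulLeft (Units.mk0 ((2 * π)⁻¹) (by positivity : (2 * π)⁻¹ ≠ 0))
  refine ⟨((((2 * π)⁻¹ : ℝ) : ℂ)) • SchwartzMap.compCLMOfContinuousLinearEquiv ℝ e (𝓕 f), ?_⟩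
  ext ξ
  have h1 : ft ⇑f ξ = eF ⇑f (-ξ) := by
    unfold ft eF
    have : (2 * π) ^ (-((2:ℕ) : ℝ) / 2) = (2 * π)⁻¹ := by
      rw [show -((2:ℕ) : ℝ) / 2 = -1 by norm_num, Real.rpow_neg_one]
    rw [this]
    congr 2; ext x
    rw [inner_neg_right]; push_cast; ring_nf
  rw [h1, eF_eq]
  have he : e ξ = (2 * π)⁻¹ • ξ := rfl
  simp only [_root_.smul_apply, SchwartzMap.compCLMOfContinuousLinearEquiv_apply, Function.comp, he, smul_eq_mul]
  rw [smul_neg, neg_smul, neg_neg, SchwartzMap.fourier_coe]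

lemma riesz_le (γ : Fin 2 → ℕ) (ξ : E2) : ‖rieszSym γ ξ‖ ≤ 1 := by
  unfold rieszSym
  rw [norm_div, Complex.norm_real, Real.norm_eq_abs, abs_of_nonneg (by positivity)]
  apply div_le_one_of_le₀ _ (by positivity)
  rw [norm_prod, ← Finset.prod_pow_eq_pow_sum]
  apply Finset.prod_le_prod (fun i _ => norm_nonneg _)
  intro i _
  rw [norm_pow, norm_mul, Complex.norm_I, one_mul, Complex.norm_real]
  exact pow_le_pow_left₀ (norm_nonneg _) (PiLp.norm_apply_le ξ i) _

lemma riesz_meas (γ : Fin 2 → ℕ) : Measurable (rieszSym γ) := by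
  unfold rieszSym
  apply Measurable.div
  · apply Continuous.measurable; fun_prop
  · apply Continuous.measurable; fun_prop

lemma weight_nice (g : SchwartzMap E2 ℂ) {μ a : ℝ} (hμ : 0 ≤ μ) (hμ1 : μ ≤ 1) (ha : a ≤ 1) :
    Integrable (fun ξ => (((1 + μ * ‖ξ‖ ^ 2) ^ a : ℝ) : ℂ) * g ξ) ∧ MemLp (fun ξ => (((1 + μ * ‖ξ‖ ^ 2) ^ a : ℝ) : ℂ) * g ξ) 2 := by
  have hbd : ∀ ξ, ‖(((1 + μ * ‖ξ‖ ^ 2) ^ a : ℝ) : ℂ) * g ξ‖ ≤ ‖ξ‖ ^ 0 * ‖g ξ‖ + ‖ξ‖ ^ 2 * ‖g ξ‖ := by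
    intro ξ
    have h1 : 1 ≤ 1 + μ * ‖ξ‖ ^ 2 := by
      have : 0 ≤ μ * ‖ξ‖ ^ 2 := by positivity
      linarith
    rw [norm_mul, Complex.norm_real, Real.norm_eq_abs, abs_of_nonneg (by positivity), ← add_mul]
    refine mul_le_mul_of_nonneg_right ?_ (norm_nonneg _)
    calc (1 + μ * ‖ξ‖ ^ 2) ^ a ≤ (1 + μ * ‖ξ‖ ^ 2) ^ (1:ℝ) := Real.rpow_le_rpow_of_exponent_le h1 ha
      _ = 1 + μ * ‖ξ‖ ^ 2 := Real.rpow_one _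
      _ ≤ ‖ξ‖ ^ 0 + ‖ξ‖ ^ 2 := by
        have := mul_le_mul_of_nonneg_right hμ1 (sq_nonneg ‖ξ‖)
        rw [pow_zero]; linarith
  have hm : Measurable (fun ξ => (((1 + μ * ‖ξ‖ ^ 2) ^ a : ℝ) : ℂ) * g ξ) := by
    have := g.continuous.measurable
    fun_prop
  have hI : Integrable (fun ξ => (((1 + μ * ‖ξ‖ ^ 2) ^ a : ℝ) : ℂ) * g ξ) :=
    ((g.integrable_pow_mul volume 0).add (g.integrable_pow_mul volume 2)).mono' hm.aestronglyMeasurable (Filter.Eventually.of_forall hbd)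
  refine ⟨hI, ?_⟩
  obtain ⟨C0, hC0⟩ := g.decay 0 0
  obtain ⟨C2, hC2⟩ := g.decay 2 0
  simp only [norm_iteratedFDeriv_zero] at hC0 hC2
  rw [memLp_two_iff_integrable_sq_norm hm.aestronglyMeasurable]
  refine (hI.norm.const_mul (C0 + C2)).mono' (hm.norm.pow_const 2).aestronglyMeasurable (Filter.Eventually.of_forall fun ξ => ?_)
  rw [Real.norm_eq_abs, abs_of_nonneg (by positivity), sq]
  refine mul_le_mul_of_nonneg_right ?_ (norm_nonneg _)
  have := hbd ξ
  have h0 := hC0.2 ξ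
  have h2 := hC2.2 ξ
  linarith

lemma prop2_eq (σ ε t μ : ℝ) (ξ : E2) : prop2 σ (t / ε) μ ξ = ph μ (σ / ε) t ξ := by
  unfold prop2 ph
  congr 3; ring

lemma uS_eq (σ ε μ : ℝ) (γ : Fin 2 → ℕ) (f : E2 → ℂ) (t : ℝ) : fmult (fun ξ => prop2 σ (t / ε) μ ξ * rieszSym γ ξ) f = uS μ (σ / ε) (fun ξ => rieszSym γ ξ * ft f ξ) t := by
  rw [fmult_eq]
  ext x
  unfold uS
  congr 1; ext ξ
  rw [prop2_eq, mul_assoc]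

set_option maxHeartbeats 1600000 in
lemma final_r2 (σ : ℝ) (γ : Fin 2 → ℕ) (T μ ε : ℝ) (hμ : 0 < μ) (hμ1 : μ ≤ 1) (f : SchwartzMap E2 ℂ) :
    timeLp ⊤ T (fun t => eLpNorm (fmult (fun ξ => prop2 σ (t / ε) μ ξ * rieszSym γ ξ) ⇑f) 2 volume) ≤
      eLpNorm (fmult (fun ξ => (((1 + μ * ‖ξ‖ ^ 2) ^ (0:ℝ) : ℝ) : ℂ)) ⇑f) 2 volume := by
  obtain ⟨g, hg⟩ := ft_schwartz f
  have hw := weight_nice g hμ.le hμ1 (a := 0) zero_le_one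
  unfold timeLp
  rw [if_pos rfl]
  refine essSup_le_of_ae_le _ (Filter.Eventually.of_forall fun t => ?_)
  beta_reduce
  rw [uS_eq, fmult_eq, hg, eF_plancherel hw.1 hw.2]
  simp only [Real.rpow_zero, Complex.ofReal_one, one_mul] at hw ⊢
  have hmeas : Measurable (fun ξ => ph μ (σ / ε) t ξ * (rieszSym γ ξ * g ξ)) :=
    ((ph_continuous hμ.le (σ / ε)).measurable.comp (measurable_prodMk_left (x := t))).mul ((riesz_meas γ).mul g.continuous.measurable)
  have hb : ∀ ξ, ‖ph μ (σ / ε) t ξ * (rieszSym γ ξ * g ξ)‖ ≤ ‖g ξ‖ := by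
    intro ξ
    rw [norm_mul, ph_norm, one_mul, norm_mul]
    have := mul_le_mul_of_nonneg_right (riesz_le γ ξ) (norm_nonneg (g ξ))
    rwa [one_mul] at this
  unfold uS
  rw [eF_plancherel (hw.1.mono hmeas.aestronglyMeasurable (Filter.Eventually.of_forall hb)) (hw.2.mono hmeas.aestronglyMeasurable (Filter.Eventually.of_forall hb))]
  exact eLpNorm_mono hb

set_option maxHeartbeats 1600000 in
lemma final_r (σ : ℝ) (hσ : σ = 1 ∨ σ = -1) (γ : Fin 2 → ℕ) {q r : ℝ≥0∞} (hq : q ≠ ⊤) (hr : r ≠ ⊤) (hq2 : 2 < q.toReal) (hr2 : 2 < r.toReal)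
    (hqr : 1 / q.toReal + 1 / r.toReal = 1 / 2) {T μ ε : ℝ} (hμ : 0 < μ) (hμ1 : μ ≤ 1) (hε : 0 < ε) (f : SchwartzMap E2 ℂ) :
    timeLp q T (fun t => eLpNorm (fmult (fun ξ => prop2 σ (t / ε) μ ξ * rieszSym γ ξ) ⇑f) r volume) ≤
      ENNReal.ofReal (√(KS ^ (1 - 2 / r.toReal) * (2 * CH (1 - 2 / r.toReal))) * (ε / √μ) ^ (1 / 2 - r.toReal⁻¹)) *
      eLpNorm (fmult (fun ξ => (((1 + μ * ‖ξ‖ ^ 2) ^ (2 * (1 / 2 - r.toReal⁻¹)) : ℝ) : ℂ)) ⇑f) 2 volume := by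
  set q' := q.toReal with hq'
  set r' := r.toReal with hr'
  set a := 1 - 2 / r' with ha
  have hr0 : 0 < r' := by linarith
  have hq0 : 0 < q' := by linarith
  have haq : a = 2 / q' := by
    rw [ha]
    have : 2 * (1 / q' + 1 / r') = 1 := by rw [hqr]; norm_num
    rw [← this]; ring
  have ha0 : 0 < a := by rw [haq]; positivity
  have ha1 : a < 1 := by
    have : 0 < 2 / r' := by positivity
    rw [ha]; linarith
  have hbexp : 2 * (1 / 2 - r'⁻¹) = a := by rw [ha]; ring
  have haexp : 1 / 2 - r'⁻¹ = a / 2 := by rw [ha]; ring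
  have hb : σ / ε ≠ 0 := by
    apply div_ne_zero _ hε.ne'
    rcases hσ with h | h <;> rw [h] <;> norm_num
  have hba : |σ / ε| = 1 / ε := by
    rw [abs_div, abs_of_pos hε]
    rcases hσ with h | h <;> rw [h] <;> simp
  obtain ⟨g, hg⟩ := ft_schwartz f
  have hw := weight_nice g hμ.le hμ1 ha1.le
  set h : E2 → ℂ := fun ξ => rieszSym γ ξ * g ξ with hh
  have hhm : Measurable h := (riesz_meas γ).mul g.continuous.measurable
  have hhg : ∀ ξ, ‖h ξ‖ ≤ ‖g ξ‖ := by
    intro ξ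
    rw [hh]; simp only [norm_mul]
    have := mul_le_mul_of_nonneg_right (riesz_le γ ξ) (norm_nonneg (g ξ))
    rwa [one_mul] at this
  have hhi : Integrable h := g.integrable.mono hhm.aestronglyMeasurable (Filter.Eventually.of_forall hhg)
  have hWle : ∀ ξ : E2, ‖(((1 + μ * ‖ξ‖ ^ 2 / 3) ^ a : ℝ) : ℂ) * h ξ‖ ≤ ‖(((1 + μ * ‖ξ‖ ^ 2) ^ a : ℝ) : ℂ) * g ξ‖ := by
    intro ξ
    have h0 : 0 ≤ μ * ‖ξ‖ ^ 2 := by positivity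
    refine (norm_mul_le _ _).trans ?_
    rw [norm_mul (((1 + μ * ‖ξ‖ ^ 2) ^ a : ℝ) : ℂ) (g ξ), Complex.norm_real, Complex.norm_real, Real.norm_eq_abs, Real.norm_eq_abs, abs_of_nonneg (by positivity), abs_of_nonneg (by positivity)]
    refine mul_le_mul (Real.rpow_le_rpow (by positivity) (by linarith) ha0.le) (hhg ξ) (norm_nonneg _) (by positivity)
  have hWm : Measurable (fun ξ : E2 => (((1 + μ * ‖ξ‖ ^ 2 / 3) ^ a : ℝ) : ℂ) * h ξ) := by fun_prop
  have hWL : MemLp (fun ξ : E2 => (((1 + μ * ‖ξ‖ ^ 2 / 3) ^ a : ℝ) : ℂ) * h ξ) 2 := hw.2.mono hWm.aestronglyMeasurable (Filter.Eventually.of_forall hWle)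
  set D : ℝ := n2 (fun ξ => (((1 + μ * ‖ξ‖ ^ 2 / 3) ^ a : ℝ) : ℂ) * h ξ) * √((KS / (√μ * |σ / ε|)) ^ a * (2 * CH a)) with hD
  have hD0 : 0 ≤ D := mul_nonneg (n2_nonneg _) (Real.sqrt_nonneg _)
  have hKS := KS_pos
  have hCH := CH_pos ha1
  have hsμ := Real.sqrt_pos.2 hμ
  have hr1 : r' - 1 ≠ 0 := by linarith
  have hq1 : q' - 1 ≠ 0 := by linarith
  have hmain := dual_full (T := T) (uS_meas hμ.le (σ / ε) hhm) (uS_bound μ (σ / ε) h) (q := q') (r := r') hq2 hr2 rfl rfl hD0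
    (fun F M R hF A hA hI => pairing_est hμ hμ1 hb ha0 ha1
      (by rw [ha]; field_simp; ring) (by rw [haq]; field_simp; try ring) hhm hhi hWL hF hA hI)
  have hDeq : D = √(KS ^ a * (2 * CH a)) * (ε / √μ) ^ (a / 2) * n2 (fun ξ => (((1 + μ * ‖ξ‖ ^ 2 / 3) ^ a : ℝ) : ℂ) * h ξ) := by
    rw [hD, hba, show KS / (√μ * (1 / ε)) = KS * (ε / √μ) by field_simp, Real.mul_rpow hKS.le (by positivity),
      show KS ^ a * (ε / √μ) ^ a * (2 * CH a) = (KS ^ a * (2 * CH a)) * (ε / √μ) ^ a by ring, Real.sqrt_mul (by positivity) ((ε / √μ) ^ a),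
      Real.sqrt_eq_rpow ((ε / √μ) ^ a), ← Real.rpow_mul (by positivity), show a * (1 / 2) = a / 2 by ring]
    ring
  have hn2 : ENNReal.ofReal (n2 (fun ξ => (((1 + μ * ‖ξ‖ ^ 2 / 3) ^ a : ℝ) : ℂ) * h ξ)) ≤ eLpNorm (fun ξ => (((1 + μ * ‖ξ‖ ^ 2) ^ a : ℝ) : ℂ) * g ξ) 2 volume := by
    rw [n2_eq hWL, ENNReal.ofReal_toReal hWL.2.ne]
    exact eLpNorm_mono hWle
  rw [hbexp, haexp, fmult_eq (fun ξ => (((1 + μ * ‖ξ‖ ^ 2) ^ a : ℝ) : ℂ)), hg, eF_plancherel hw.1 hw.2]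
  have hr00 : r ≠ 0 := by rintro rfl; simp [hr'] at hr0
  unfold timeLp
  rw [if_neg hq]
  simp only [uS_eq, hg, eLpNorm_eq_lintegral_rpow_enorm_toReal hr00 hr]
  calc _ ≤ (ENNReal.ofReal (D ^ q')) ^ (1 / q') := ENNReal.rpow_le_rpow hmain (by positivity)
    _ = ENNReal.ofReal D := by
      rw [ENNReal.ofReal_rpow_of_nonneg (by positivity) (by positivity), ← Real.rpow_mul hD0, mul_one_div_cancel hq0.ne', Real.rpow_one]
    _ ≤ _ := by
      rw [hDeq, ENNReal.ofReal_mul (by positivity)]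
      exact mul_le_mul_right hn2 _

/-- Homogeneous 2D Strichartz estimate (first estimate of (3.4)): for admissible
`(q,r)` with `1/q + 1/r = 1/2`, `r < ∞`,
`‖e^{±i(t/ε)|D|/√(1+μ|D|²/3)} (∇^γ/|D|^{|γ|}) f‖_{L^q(0,T;L^r)} ≤ C (ε/√μ)^{1/2−1/r}
‖(1+μ|D|²)^{2(1/2−1/r)} f‖_{L²}`. -/
theorem stmt17 (σ : ℝ) (hσ : σ = 1 ∨ σ = -1) (γ : Fin 2 → ℕ) (q r : ℝ≥0∞)
    (hq : 2 ≤ q) (hr : 2 ≤ r) (hqr : 1 / q + 1 / r = 1 / 2) (hrtop : r ≠ ⊤) :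
    ∃ C : ℝ, 0 < C ∧ ∀ T : ℝ, 0 < T → ∀ μ ∈ Set.Ioc (0 : ℝ) 1, ∀ ε ∈ Set.Ioc (0 : ℝ) 1,
      ∀ f : SchwartzMap (EuclideanSpace ℝ (Fin 2)) ℂ,
        timeLp q T
            (fun t => eLpNorm
              (fmult (fun ξ => prop2 σ (t / ε) μ ξ * rieszSym γ ξ) ⇑f) r volume) ≤
          ENNReal.ofReal (C * (ε / Real.sqrt μ) ^ (1 / 2 - (r⁻¹).toReal)) *
            eLpNorm
              (fmult (fun ξ =>
                (((1 + μ * ‖ξ‖ ^ 2) ^ (2 * (1 / 2 - (r⁻¹).toReal)) : ℝ) : ℂ)) ⇑f) 2 volume := by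
  rcases hr.eq_or_lt with h2 | h2
  · subst h2
    have hqt : q = ⊤ := by
      have h3 : 1 / q + 1 / 2 = 0 + 1 / 2 := by rw [hqr, zero_add]
      have h4 := (ENNReal.add_left_inj (by simp)).1 h3
      simpa using h4
    subst hqt
    refine ⟨1, one_pos, fun T hT μ hμ ε hε f => ?_⟩
    have h5 : (1 / 2 - ((2:ℝ≥0∞)⁻¹).toReal) = 0 := by simp
    rw [h5, mul_zero, Real.rpow_zero, mul_one, ENNReal.ofReal_one, one_mul]
    exact final_r2 σ γ T μ ε hμ.1 hμ.2 f
  · have hr2 : 2 < r.toReal := by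
      have := (ENNReal.toReal_lt_toReal (by simp) hrtop).2 h2
      simpa using this
    have hqt : q ≠ ⊤ := by
      rintro rfl
      simp only [one_div, ENNReal.inv_top, zero_add, inv_inj] at hqr
      exact h2.ne' hqr
    have hq0 : q ≠ 0 := by rintro rfl; simp at hq
    have hr0 : r ≠ 0 := by rintro rfl; simp at hr
    have hqr' : 1 / q.toReal + 1 / r.toReal = 1 / 2 := by
      have h3 := congrArg ENNReal.toReal hqr
      rw [ENNReal.toReal_add (by simp [hq0]) (by simp [hr0])] at h3
      simpa using h3
    have hqp : 0 < q.toReal := ENNReal.toReal_pos hq0 hqt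
    have hq2 : 2 < q.toReal := by
      have h3 : 0 < 1 / r.toReal := by positivity
      have h4 : 1 / q.toReal < 1 / 2 := by linarith
      exact (one_div_lt_one_div hqp (by norm_num)).1 h4
    have ha1 : 1 - 2 / r.toReal < 1 := by
      have : 0 < 2 / r.toReal := by positivity
      linarith
    have hKS := KS_pos
    have hCH := CH_pos ha1
    refine ⟨√(KS ^ (1 - 2 / r.toReal) * (2 * CH (1 - 2 / r.toReal))), by positivity, fun T hT μ hμ ε hε f => ?_⟩
    rw [ENNReal.toReal_inv]
    exact final_r σ hσ γ hqt hrtop hq2 hr2 hqr' hμ.1 hμ.2 hε.1 f
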